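/- Let f:(R,m) → (S,n) be a local homomorphism of noetherian local rings such that the flat dimension of S as an R-module is finite, and let M be a non-zero finitely generated S-module with Gfd_R(M) ≤ edim(R) − edim(S). Then: (i) M is a totally reflexive S-module; (ii) f is an exceptional complete intersection map; and (iii) Gfd_R(M) = edim(R) − edim(S). In particular, if M is Gorenstein flat as an R-module, then edim(R) = edim(S). -/

import Mathlib

/- ## Preliminary definitions -/

universe u

open IsLocalRing

noncomputable section

/-- The embedding dimension of a local ring: `dim_k (m/m²)`. -/
def embDim (R : Type u) [CommRing R] [IsLocalRing R] : ℕ :=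
  Module.finrank (ResidueField R) (CotangentSpace R)

/-- Witness that `Q` is a Gorenstein flat `R`-module: a two-sided exact complex `F` of
flat modules, which stays exact after applying `I ⊗ᵣ -` for every injective module `I`,
with `Q` isomorphic to the image of the differential `F₁ → F₀`. -/
structure GorensteinFlatWitness (R : Type u) [CommRing R] (Q : Type u) [AddCommGroup Q]
    [Module R Q] where
  F : ℤ → Type u
  [instAdd : ∀ i, AddCommGroup (F i)]
  [instMod : ∀ i, Module R (F i)]
  d : (i : ℤ) → F (i + 1) →ₗ[R] F i
  flat : ∀ i, Module.Flat R (F i)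
  exact : ∀ i : ℤ, Function.Exact (d (i + 1)) (d i)
  exact_tensor : ∀ (I : Type u) [AddCommGroup I] [Module R I], Module.Injective R I →
    ∀ i : ℤ, Function.Exact (LinearMap.lTensor I (d (i + 1))) (LinearMap.lTensor I (d i))
  iso : Nonempty (Q ≃ₗ[R] LinearMap.range (d 0))

/-- `Q` is a Gorenstein flat `R`-module. -/
def IsGorensteinFlat (R : Type u) [CommRing R] (Q : Type u) [AddCommGroup Q]
    [Module R Q] : Prop :=
  Nonempty (GorensteinFlatWitness R Q)

/-- Witness that `J` is a Gorenstein injective `R`-module: a two-sided exact complex `I` of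
injective modules, which stays exact after applying `Hom_R(E, -)` for every injective module
`E`, with `J` isomorphic to the image of the differential `I₁ → I₀`. -/
structure GorensteinInjectiveWitness (R : Type u) [CommRing R] (J : Type u) [AddCommGroup J]
    [Module R J] where
  I : ℤ → Type u
  [instAdd : ∀ i, AddCommGroup (I i)]
  [instMod : ∀ i, Module R (I i)]
  d : (i : ℤ) → I (i + 1) →ₗ[R] I i
  injective : ∀ i, Module.Injective R (I i)
  exact : ∀ i : ℤ, Function.Exact (d (i + 1)) (d i)
  exact_hom : ∀ (E : Type u) [AddCommGroup E] [Module R E], Module.Injective R E →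
    ∀ i : ℤ, Function.Exact
      (LinearMap.llcomp (σ₁₂ := RingHom.id R) R E (I (i + 1 + 1)) (I (i + 1)) (d (i + 1)))
      (LinearMap.llcomp (σ₁₂ := RingHom.id R) R E (I (i + 1)) (I i) (d i))
  iso : Nonempty (J ≃ₗ[R] LinearMap.range (d 0))

/-- `J` is a Gorenstein injective `R`-module. -/
def IsGorensteinInjective (R : Type u) [CommRing R] (J : Type u) [AddCommGroup J]
    [Module R J] : Prop :=
  Nonempty (GorensteinInjectiveWitness R J)

/-- A surjection onto `M` whose source is Gorenstein flat. -/
structure GorensteinFlatCover (R : Type u) [CommRing R] (M : Type u) [AddCommGroup M]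
    [Module R M] where
  Q : Type u
  [instAdd : AddCommGroup Q]
  [instMod : Module R Q]
  π : Q →ₗ[R] M
  gflat : IsGorensteinFlat R Q
  surj : Function.Surjective π

attribute [instance] GorensteinFlatCover.instAdd GorensteinFlatCover.instMod

/-- `M` admits an exact sequence `0 → Qₙ → ⋯ → Q₀ → M → 0` with all `Qᵢ` Gorenstein flat;
equivalently (by splicing), defined by recursion on `n`. -/
def gfdLE (R : Type u) [CommRing R] :
    (n : ℕ) → (M : Type u) → [AddCommGroup M] → [Module R M] → Prop
  | 0, M, _, _ => IsGorensteinFlat R M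
  | n + 1, M, _, _ => ∃ c : GorensteinFlatCover R M, gfdLE R n (LinearMap.ker c.π)

/-- The Gorenstein flat dimension of `M` over `R`, as an element of `ℕ∞`
(the zero module has Gorenstein flat dimension `0` here, and `⊤` means infinite). -/
def gfd (R : Type u) [CommRing R] (M : Type u) [AddCommGroup M] [Module R M] : ℕ∞ :=
  sInf ((↑) '' { n : ℕ | gfdLE R n M })

/-- A flat cover of `M`. -/
structure FlatCover (R : Type u) [CommRing R] (M : Type u) [AddCommGroup M]
    [Module R M] where
  Q : Type u
  [instAdd : AddCommGroup Q]
  [instMod : Module R Q]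
  π : Q →ₗ[R] M
  flat : Module.Flat R Q
  surj : Function.Surjective π

attribute [instance] FlatCover.instAdd FlatCover.instMod

/-- `M` admits a flat resolution of length `≤ n`. -/
def fdLE (R : Type u) [CommRing R] :
    (n : ℕ) → (M : Type u) → [AddCommGroup M] → [Module R M] → Prop
  | 0, M, _, _ => Module.Flat R M
  | n + 1, M, _, _ => ∃ c : FlatCover R M, fdLE R n (LinearMap.ker c.π)

/-- The flat dimension of `M` over `R`, as an element of `ℕ∞`. -/
def flatDim (R : Type u) [CommRing R] (M : Type u) [AddCommGroup M] [Module R M] : ℕ∞ :=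
  sInf ((↑) '' { n : ℕ | fdLE R n M })

/-- An embedding of `M` into a Gorenstein injective module. -/
structure GorensteinInjectiveHull (R : Type u) [CommRing R] (M : Type u) [AddCommGroup M]
    [Module R M] where
  J : Type u
  [instAdd : AddCommGroup J]
  [instMod : Module R J]
  ι : M →ₗ[R] J
  ginj : IsGorensteinInjective R J
  inj : Function.Injective ι

attribute [instance] GorensteinInjectiveHull.instAdd GorensteinInjectiveHull.instMod

/-- `M` admits an exact sequence `0 → M → J₀ → ⋯ → J₋ₙ → 0` with all `Jᵢ`
Gorenstein injective. -/
def gidLE (R : Type u) [CommRing R] :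
    (n : ℕ) → (M : Type u) → [AddCommGroup M] → [Module R M] → Prop
  | 0, M, _, _ => IsGorensteinInjective R M
  | n + 1, M, _, _ => ∃ c : GorensteinInjectiveHull R M,
      gidLE R n (c.J ⧸ LinearMap.range c.ι)

/-- The Gorenstein injective dimension of `M` over `R`, as an element of `ℕ∞`. -/
def gid (R : Type u) [CommRing R] (M : Type u) [AddCommGroup M] [Module R M] : ℕ∞ :=
  sInf ((↑) '' { n : ℕ | gidLE R n M })

/-- An embedding of `M` into an injective module. -/
structure InjectiveHullStep (R : Type u) [CommRing R] (M : Type u) [AddCommGroup M]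
    [Module R M] where
  J : Type u
  [instAdd : AddCommGroup J]
  [instMod : Module R J]
  ι : M →ₗ[R] J
  injective : Module.Injective R J
  inj : Function.Injective ι

attribute [instance] InjectiveHullStep.instAdd InjectiveHullStep.instMod

/-- `M` admits an injective resolution of length `≤ n`. -/
def idLE (R : Type u) [CommRing R] :
    (n : ℕ) → (M : Type u) → [AddCommGroup M] → [Module R M] → Prop
  | 0, M, _, _ => Module.Injective R M
  | n + 1, M, _, _ => ∃ c : InjectiveHullStep R M, idLE R n (c.J ⧸ LinearMap.range c.ι)

/-- The injective dimension of `M` over `R`, as an element of `ℕ∞`. -/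
def injDim (R : Type u) [CommRing R] (M : Type u) [AddCommGroup M] [Module R M] : ℕ∞ :=
  sInf ((↑) '' { n : ℕ | idLE R n M })

/-- The `i`-th Ext module `Ext_R^i(N, M)`. -/
def extModule (R : Type u) [CommRing R] (i : ℕ) (N M : Type u) [AddCommGroup N] [Module R N]
    [AddCommGroup M] [Module R M] : ModuleCat.{u} R :=
  ((Ext R (ModuleCat.{u} R) i).obj (Opposite.op (ModuleCat.of R N))).obj (ModuleCat.of R M)

/-- The depth of `M` with respect to the ideal `I`: the least `i` such that
`Ext_R^i(R/I, M) ≠ 0` (with value `⊤ : ℕ∞` if no such `i` exists). -/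
def idealDepth (R : Type u) [CommRing R] (I : Ideal R) (M : Type u) [AddCommGroup M]
    [Module R M] : ℕ∞ :=
  sInf ((↑) '' { i : ℕ | ¬ Subsingleton (extModule R i (R ⧸ I) M) })

/-- A finitely generated `S`-module `M` is totally reflexive if the biduality map
`M → Hom_S(Hom_S(M,S),S)` is bijective and `Ext_S^i(M,S) = 0 = Ext_S^i(M^*,S)`
for all `i ≥ 1`. -/
def IsTotallyReflexive (S : Type u) [CommRing S] (M : Type u) [AddCommGroup M]
    [Module S M] : Prop :=
  Module.Finite S M ∧ Function.Bijective (Module.Dual.eval S M) ∧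
    ∀ i : ℕ, 1 ≤ i → Subsingleton (extModule S i M S) ∧
      Subsingleton (extModule S i (Module.Dual S M) S)

/-- A noetherian local ring is G-regular if every totally reflexive module is free. -/
def IsGRegular (S : Type u) [CommRing S] : Prop :=
  ∀ (M : Type u) [AddCommGroup M] [Module S M], IsTotallyReflexive S M → Module.Free S M

/-- A commutative ring is a regular local ring if it is a noetherian local ring whose
maximal ideal is generated by a regular sequence. -/
def IsRegularLocal (A : Type u) [CommRing A] : Prop :=
  IsNoetherianRing A ∧ ∃ h : IsLocalRing A, ∃ rs : List A,
    RingTheory.Sequence.IsRegular A rs ∧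
      Ideal.span { x | x ∈ rs } = @IsLocalRing.maximalIdeal A _ h

/-- A Gorenstein local ring: a noetherian local ring of finite self-injective dimension. -/
def IsGorensteinLocal (A : Type u) [CommRing A] : Prop :=
  IsNoetherianRing A ∧ IsLocalRing A ∧ injDim A A < ⊤

/-- `E` is an injective envelope (injective hull) of the residue field of the local
ring `S`: an injective module containing the residue field as an essential submodule. -/
def IsInjEnvResidueField (S : Type u) [CommRing S] [IsLocalRing S] (E : Type u)
    [AddCommGroup E] [Module S E] : Prop :=
  Module.Injective S E ∧ ∃ ι : ResidueField S →ₗ[S] E, Function.Injective ι ∧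
    ∀ N : Submodule S E, N ≠ ⊥ → N ⊓ LinearMap.range ι ≠ ⊥

end
/- ## Cohen factorizations and (exceptional) complete intersection maps -/

noncomputable section

/-- The canonical ring homomorphism from a local ring `S` to its
maximal-adic completion. -/
def completionHom (S : Type u) [CommRing S] [IsLocalRing S] :
    S →+* AdicCompletion (maximalIdeal S) S :=
  algebraMap S (AdicCompletion (maximalIdeal S) S)

/-- `R → R' → Ŝ` is a Cohen factorization of the local homomorphism `f : R → S`:
`R'` is a complete noetherian local ring, `R → R'` is a flat local homomorphism with
regular closed fiber `R'/mR'`, and `R' → Ŝ` is surjective, the composite being the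
composition of `f` with the completion map of `S`. -/
def IsCohenFactorization {R S R' : Type u} [CommRing R] [CommRing S] [IsLocalRing R]
    [IsLocalRing S] [CommRing R'] (f : R →+* S) (g : R →+* R')
    (h : R' →+* AdicCompletion (maximalIdeal S) S) : Prop :=
  IsNoetherianRing R' ∧ IsLocalRing R' ∧ IsAdicComplete ((⊥ : Ideal R').jacobson) R' ∧
    h.comp g = (completionHom S).comp f ∧ IsLocalHom g ∧ g.Flat ∧
    IsRegularLocal (R' ⧸ (maximalIdeal R).map g) ∧ Function.Surjective h

/-- A local homomorphism `f : R → S` of noetherian local rings is a complete intersection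
map if in some Cohen factorization `R → R' → Ŝ` the kernel of `R' → Ŝ` is generated by a
regular sequence. -/
def IsCIMap {R S : Type u} [CommRing R] [CommRing S] [IsLocalRing R] [IsLocalRing S]
    (f : R →+* S) : Prop :=
  ∃ (R' : Type u) (_ : CommRing R') (g : R →+* R')
    (h : R' →+* AdicCompletion (maximalIdeal S) S),
    IsCohenFactorization f g h ∧ ∃ rs : List R',
      RingTheory.Sequence.IsRegular R' rs ∧ RingHom.ker h = Ideal.span { x | x ∈ rs }

/-- A local homomorphism `f : R → S` of noetherian local rings is an exceptional complete
intersection map if it is a complete intersection map and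
`edim R - dim R = edim S - dim S`. -/
def IsExceptionalCIMap {R S : Type u} [CommRing R] [CommRing S] [IsLocalRing R]
    [IsLocalRing S] (f : R →+* S) : Prop :=
  IsCIMap f ∧
    (embDim R : WithBot ℕ∞) + ringKrullDim S =
      (embDim S : WithBot ℕ∞) + ringKrullDim R

end
/- ## Homological dimensions along a ring homomorphism -/

noncomputable section

variable {R S : Type u} [CommRing R] [CommRing S]

/-- The flat dimension `fd_R S` of `S` as an `R`-module along `f : R → S`. -/
def flatDimAlong (f : R →+* S) : ℕ∞ :=
  letI := f.toModule; flatDim R S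

/-- The Gorenstein flat dimension over `R` of an `S`-module `M`, viewed as an
`R`-module along `f : R → S`. -/
def gfdAlong (f : R →+* S) (M : Type u) [AddCommGroup M] [Module S M] : ℕ∞ :=
  letI := Module.compHom M f; gfd R M

/-- The Gorenstein injective dimension over `R` of an `S`-module `M`, viewed as an
`R`-module along `f : R → S`. -/
def gidAlong (f : R →+* S) (M : Type u) [AddCommGroup M] [Module S M] : ℕ∞ :=
  letI := Module.compHom M f; gid R M

/-- `M` is Gorenstein flat as an `R`-module along `f : R → S`. -/
def IsGorensteinFlatAlong (f : R →+* S) (M : Type u) [AddCommGroup M] [Module S M] : Prop :=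
  letI := Module.compHom M f; IsGorensteinFlat R M

/-- `M` is Gorenstein injective as an `R`-module along `f : R → S`. -/
def IsGorensteinInjectiveAlong (f : R →+* S) (M : Type u) [AddCommGroup M]
    [Module S M] : Prop :=
  letI := Module.compHom M f; IsGorensteinInjective R M

end

namespace GFD

open CategoryTheory

section ExtVanishing

variable {R : Type u} [CommRing R]
variable {X X' X'' Y Y' Y'' : Type u}
  [AddCommGroup X] [Module R X] [AddCommGroup X'] [Module R X'] [AddCommGroup X''] [Module R X'']
  [AddCommGroup Y] [Module R Y] [AddCommGroup Y'] [Module R Y'] [AddCommGroup Y''] [Module R Y'']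

/-- Vanishing of `Ext_R^i(X, Y)`. -/
def EV (R : Type u) [CommRing R] (i : ℕ) (X Y : Type u) [AddCommGroup X] [Module R X]
    [AddCommGroup Y] [Module R Y] : Prop :=
  Subsingleton (Abelian.Ext.{u} (ModuleCat.of R X) (ModuleCat.of R Y) i)

/-- A short exact sequence `0 → X' → X → X'' → 0` of linear maps. -/
structure SES (f : X' →ₗ[R] X) (g : X →ₗ[R] X'') : Prop where
  inj : Function.Injective f
  exact : Function.Exact f g
  surj : Function.Surjective g

theorem SES.ofSurj (g : X →ₗ[R] X'') (hg : Function.Surjective g) :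
    SES (LinearMap.ker g).subtype g :=
  ⟨Submodule.subtype_injective _, LinearMap.exact_subtype_ker_map g, hg⟩

theorem SES.ofInj (f : X' →ₗ[R] X) (hf : Function.Injective f) :
    SES f (LinearMap.range f).mkQ :=
  ⟨hf, LinearMap.exact_map_mkQ_range f, Submodule.mkQ_surjective _⟩

theorem SES.ofSub (N : Submodule R X) : SES N.subtype N.mkQ :=
  ⟨Submodule.subtype_injective _, LinearMap.exact_subtype_mkQ N, Submodule.mkQ_surjective _⟩

theorem SES.comp_zero {f : X' →ₗ[R] X} {g : X →ₗ[R] X''} (h : SES f g) (x : X') : g (f x) = 0 :=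
  h.exact.apply_apply_eq_zero x

/-- The short complex attached to a short exact sequence. -/
abbrev SES.cplx {f : X' →ₗ[R] X} {g : X →ₗ[R] X''} (h : SES f g) : ShortComplex (ModuleCat.{u} R) :=
  ShortComplex.mk (ModuleCat.ofHom f) (ModuleCat.ofHom g)
    (by ext x; exact h.comp_zero x)

theorem SES.shortExact {f : X' →ₗ[R] X} {g : X →ₗ[R] X''} (h : SES f g) : h.cplx.ShortExact where
  exact := (ShortComplex.ShortExact.moduleCat_exact_iff_function_exact _).2 h.exact
  mono_f := (ModuleCat.mono_iff_injective _).2 h.inj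
  epi_g := (ModuleCat.epi_iff_surjective _).2 h.surj

theorem EV.zero_iff : EV R 0 X Y ↔ ∀ φ : X →ₗ[R] Y, φ = 0 := by
  constructor
  · intro h φ
    have : Abelian.Ext.mk₀ (ModuleCat.ofHom φ) = Abelian.Ext.mk₀ (ModuleCat.ofHom (0 : X →ₗ[R] Y)) :=
      h.elim _ _
    have := (Abelian.Ext.mk₀_bijective _ _).1 this
    exact congrArg ModuleCat.Hom.hom this
  · intro h
    refine ⟨fun a b => ?_⟩
    obtain ⟨a, rfl⟩ := (Abelian.Ext.mk₀_bijective _ _).2 a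
    obtain ⟨b, rfl⟩ := (Abelian.Ext.mk₀_bijective _ _).2 b
    have : a = b := by
      ext x
      rw [show a.hom = b.hom from (h a.hom).trans (h b.hom).symm]
    rw [this]

theorem SES.ev_mid {f : X' →ₗ[R] X} {g : X →ₗ[R] X''} (h : SES f g) {i : ℕ}
    (h1 : EV R i X' Y) (h3 : EV R i X'' Y) : EV R i X Y := by
  refine ⟨fun a b => ?_⟩
  rw [← sub_eq_zero]
  obtain ⟨c, hc⟩ := Abelian.Ext.contravariant_sequence_exact₂ h.shortExact (ModuleCat.of R Y) (a - b)
    (h1.elim _ _)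
  rw [← hc, h3.elim c 0]; simp

theorem SES.ev_left {f : X' →ₗ[R] X} {g : X →ₗ[R] X''} (h : SES f g) {i : ℕ}
    (h2 : EV R i X Y) (h3 : EV R (i + 1) X'' Y) : EV R i X' Y := by
  refine ⟨fun a b => ?_⟩
  rw [← sub_eq_zero]
  obtain ⟨c, hc⟩ := Abelian.Ext.contravariant_sequence_exact₁ h.shortExact (ModuleCat.of R Y) (a - b)
    (add_comm 1 i) (h3.elim _ _)
  rw [← hc, h2.elim c 0]; simp

theorem SES.ev_right {f : X' →ₗ[R] X} {g : X →ₗ[R] X''} (h : SES f g) {i : ℕ}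
    (h1 : EV R i X' Y) (h2 : EV R (i + 1) X Y) : EV R (i + 1) X'' Y := by
  refine ⟨fun a b => ?_⟩
  rw [← sub_eq_zero]
  obtain ⟨c, hc⟩ := Abelian.Ext.contravariant_sequence_exact₃ h.shortExact (ModuleCat.of R Y) (a - b)
    (h2.elim _ _) (add_comm 1 i)
  rw [← hc, h1.elim c 0]; simp

theorem SES.ev_mid' {f : Y' →ₗ[R] Y} {g : Y →ₗ[R] Y''} (h : SES f g) {i : ℕ}
    (h1 : EV R i X Y') (h3 : EV R i X Y'') : EV R i X Y := by
  refine ⟨fun a b => ?_⟩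
  rw [← sub_eq_zero]
  obtain ⟨c, hc⟩ := Abelian.Ext.covariant_sequence_exact₂ (ModuleCat.of R X) h.shortExact (a - b)
    (h3.elim _ _)
  rw [← hc, h1.elim c 0]; simp

theorem SES.ev_left' {f : Y' →ₗ[R] Y} {g : Y →ₗ[R] Y''} (h : SES f g) {i : ℕ}
    (h2 : EV R (i + 1) X Y) (h3 : EV R i X Y'') : EV R (i + 1) X Y' := by
  refine ⟨fun a b => ?_⟩
  rw [← sub_eq_zero]
  obtain ⟨c, hc⟩ := Abelian.Ext.covariant_sequence_exact₁ (ModuleCat.of R X) h.shortExact (a - b)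
    (h2.elim _ _) rfl
  rw [← hc, h3.elim c 0]; simp

theorem SES.ev_right' {f : Y' →ₗ[R] Y} {g : Y →ₗ[R] Y''} (h : SES f g) {i : ℕ}
    (h1 : EV R (i + 1) X Y') (h2 : EV R i X Y) : EV R i X Y'' := by
  refine ⟨fun a b => ?_⟩
  rw [← sub_eq_zero]
  obtain ⟨c, hc⟩ := Abelian.Ext.covariant_sequence_exact₃ (ModuleCat.of R X) h.shortExact (a - b)
    rfl (h1.elim _ _)
  rw [← hc, h2.elim c 0]; simp

theorem EV.of_projective [Module.Projective R X] (i : ℕ) : EV R (i + 1) X Y :=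
  have : Projective (ModuleCat.of R X) := (IsProjective.iff_projective X).1 inferInstance
  Abelian.Ext.subsingleton_of_projective _ _ _

theorem EV.of_injective (hY : Module.Injective R Y) (i : ℕ) : EV R (i + 1) X Y :=
  have : Injective (ModuleCat.of R Y) := Module.injective_object_of_injective_module R Y
  Abelian.Ext.subsingleton_of_injective _ _ _

theorem EV.of_retract_left {i : ℕ} (h : EV R i X Y) (f : X' →ₗ[R] X) (g : X →ₗ[R] X')
    (hgf : ∀ x, g (f x) = x) : EV R i X' Y := by
  refine ⟨fun a b => ?_⟩
  have key : ∀ a : Abelian.Ext.{u} (ModuleCat.of R X') (ModuleCat.of R Y) i,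
      a = (Abelian.Ext.mk₀ (ModuleCat.ofHom f)).comp
        ((Abelian.Ext.mk₀ (ModuleCat.ofHom g)).comp a (zero_add i)) (zero_add i) := by
    intro a
    rw [Abelian.Ext.mk₀_comp_mk₀_assoc, ← ModuleCat.ofHom_comp]
    have : g ∘ₗ f = LinearMap.id := by ext x; exact hgf x
    rw [this]
    exact (Abelian.Ext.mk₀_id_comp a).symm
  rw [key a, key b]
  congr 1
  exact h.elim _ _

theorem EV.of_retract_right {i : ℕ} (h : EV R i X Y) (f : Y' →ₗ[R] Y) (g : Y →ₗ[R] Y')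
    (hgf : ∀ x, g (f x) = x) : EV R i X Y' := by
  refine ⟨fun a b => ?_⟩
  have key : ∀ a : Abelian.Ext.{u} (ModuleCat.of R X) (ModuleCat.of R Y') i,
      a = (a.comp (Abelian.Ext.mk₀ (ModuleCat.ofHom f)) (add_zero i)).comp
        (Abelian.Ext.mk₀ (ModuleCat.ofHom g)) (add_zero i) := by
    intro a
    rw [Abelian.Ext.comp_assoc_of_second_deg_zero, Abelian.Ext.mk₀_comp_mk₀, ← ModuleCat.ofHom_comp]
    have : g ∘ₗ f = LinearMap.id := by ext x; exact hgf x
    rw [this]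
    exact (Abelian.Ext.comp_mk₀_id a).symm
  rw [key a, key b]
  congr 1
  exact h.elim _ _

theorem EV.congr_left (e : X ≃ₗ[R] X') {i : ℕ} (h : EV R i X Y) : EV R i X' Y :=
  h.of_retract_left e.symm.toLinearMap e.toLinearMap fun x => e.apply_symm_apply x

theorem EV.congr_right (e : Y ≃ₗ[R] Y') {i : ℕ} (h : EV R i X Y) : EV R i X Y' :=
  h.of_retract_right e.symm.toLinearMap e.toLinearMap fun x => e.apply_symm_apply x

theorem EV.of_subsingleton_left [Subsingleton X] {i : ℕ} : EV R i X Y := by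
  cases i with
  | zero => exact EV.zero_iff.2 fun φ => by ext x; rw [Subsingleton.elim x 0]; simp
  | succ n => exact EV.of_projective _

theorem EV.of_subsingleton_right [Subsingleton Y] {i : ℕ} : EV R i X Y := by
  cases i with
  | zero => exact EV.zero_iff.2 fun φ => by ext x; exact Subsingleton.elim _ _
  | succ n => exact EV.of_injective ⟨fun _ _ _ _ _ _ _ _ _ => ⟨0, fun _ => Subsingleton.elim _ _⟩⟩ _

/-- If `Ext¹(X'', Y) = 0`, every map `X' → Y` extends to `X`. -/
theorem SES.extend {f : X' →ₗ[R] X} {g : X →ₗ[R] X''} (h : SES f g) (h3 : EV R 1 X'' Y)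
    (φ : X' →ₗ[R] Y) : ∃ ψ : X →ₗ[R] Y, ψ ∘ₗ f = φ := by
  obtain ⟨c, hc⟩ := Abelian.Ext.contravariant_sequence_exact₁ h.shortExact (ModuleCat.of R Y)
    (Abelian.Ext.mk₀ (ModuleCat.ofHom φ)) (add_comm 1 0) (h3.elim _ _)
  obtain ⟨c, rfl⟩ := (Abelian.Ext.mk₀_bijective _ _).2 c
  rw [Abelian.Ext.mk₀_comp_mk₀] at hc
  have := (Abelian.Ext.mk₀_bijective _ _).1 hc
  exact ⟨c.hom, congrArg ModuleCat.Hom.hom this⟩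

/-- If every map `X' → Y` extends to `X` and `Ext¹(X, Y) = 0` then `Ext¹(X'', Y) = 0`. -/
theorem SES.ev_one {f : X' →ₗ[R] X} {g : X →ₗ[R] X''} (h : SES f g) (h2 : EV R 1 X Y)
    (hext : ∀ φ : X' →ₗ[R] Y, ∃ ψ : X →ₗ[R] Y, ψ ∘ₗ f = φ) : EV R 1 X'' Y := by
  refine ⟨fun a b => ?_⟩
  rw [← sub_eq_zero]
  obtain ⟨c, hc⟩ := Abelian.Ext.contravariant_sequence_exact₃ h.shortExact (ModuleCat.of R Y) (a - b)
    (h2.elim _ _) (add_comm 1 0)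
  obtain ⟨c, rfl⟩ := (Abelian.Ext.mk₀_bijective _ _).2 c
  obtain ⟨ψ, hψ⟩ := hext c.hom
  have : c = h.cplx.f ≫ ModuleCat.ofHom ψ := by
    ext x; exact (LinearMap.congr_fun hψ x).symm
  rw [← hc, this, ← Abelian.Ext.mk₀_comp_mk₀]
  exact h.shortExact.extClass_comp_assoc _

/-- If `Ext¹(X, Y') = 0`, every map `X → Y''` lifts to `Y`. -/
theorem SES.lift {f : Y' →ₗ[R] Y} {g : Y →ₗ[R] Y''} (h : SES f g) (h1 : EV R 1 X Y')
    (φ : X →ₗ[R] Y'') : ∃ ψ : X →ₗ[R] Y, g ∘ₗ ψ = φ := by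
  obtain ⟨c, hc⟩ := Abelian.Ext.covariant_sequence_exact₃ (ModuleCat.of R X) h.shortExact
    (Abelian.Ext.mk₀ (ModuleCat.ofHom φ)) rfl (h1.elim _ _)
  obtain ⟨c, rfl⟩ := (Abelian.Ext.mk₀_bijective _ _).2 c
  rw [Abelian.Ext.mk₀_comp_mk₀] at hc
  have := (Abelian.Ext.mk₀_bijective _ _).1 hc
  exact ⟨c.hom, congrArg ModuleCat.Hom.hom this⟩

/-- If every map `X → Y''` lifts to `Y` and `Ext¹(X, Y) = 0` then `Ext¹(X, Y') = 0`. -/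
theorem SES.ev_one' {f : Y' →ₗ[R] Y} {g : Y →ₗ[R] Y''} (h : SES f g) (h2 : EV R 1 X Y)
    (hlift : ∀ φ : X →ₗ[R] Y'', ∃ ψ : X →ₗ[R] Y, g ∘ₗ ψ = φ) : EV R 1 X Y' := by
  refine ⟨fun a b => ?_⟩
  rw [← sub_eq_zero]
  obtain ⟨c, hc⟩ := Abelian.Ext.covariant_sequence_exact₁ (ModuleCat.of R X) h.shortExact (a - b)
    (h2.elim _ _) rfl
  obtain ⟨c, rfl⟩ := (Abelian.Ext.mk₀_bijective _ _).2 c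
  obtain ⟨ψ, hψ⟩ := hlift c.hom
  have : c = ModuleCat.ofHom ψ ≫ h.cplx.g := by
    ext x; exact (LinearMap.congr_fun hψ x).symm
  rw [← hc, this, ← Abelian.Ext.mk₀_comp_mk₀, Abelian.Ext.comp_assoc (h₂₃ := zero_add 1) (h := rfl),
    h.shortExact.comp_extClass, Abelian.Ext.comp_zero]

/-- The standard free cover. -/
noncomputable def freeCover (R : Type u) [CommRing R] (X : Type u) [AddCommGroup X] [Module R X] :
    (X →₀ R) →ₗ[R] X := Finsupp.linearCombination R id

theorem freeCover_surjective : Function.Surjective (freeCover R X) :=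
  Finsupp.linearCombination_id_surjective R X

theorem SES.freeCover : SES (X' := LinearMap.ker (GFD.freeCover R X)) (LinearMap.ker (GFD.freeCover R X)).subtype (GFD.freeCover R X) :=
  SES.ofSurj _ freeCover_surjective

/-- The canonical first syzygy. -/
abbrev Syz (R : Type u) [CommRing R] (X : Type u) [AddCommGroup X] [Module R X] : Type u :=
  LinearMap.ker (GFD.freeCover R X)

theorem SES.ev_shift {f : X' →ₗ[R] X} {g : X →ₗ[R] X''} (h : SES f g)
    (hX : ∀ i, EV R (i + 1) X Y) (i : ℕ) : EV R (i + 2) X'' Y ↔ EV R (i + 1) X' Y :=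
  ⟨fun h3 => h.ev_left (hX i) h3, fun h1 => h.ev_right h1 (hX (i + 1))⟩

theorem SES.ev_shift' {f : Y' →ₗ[R] Y} {g : Y →ₗ[R] Y''} (h : SES f g)
    (hY : ∀ i, EV R (i + 1) X Y) (i : ℕ) : EV R (i + 2) X Y' ↔ EV R (i + 1) X Y'' :=
  ⟨fun h1 => h.ev_right' h1 (hY i), fun h3 => h.ev_left' (hY (i + 1)) h3⟩

end ExtVanishing

end GFD

namespace GFD

open TensorProduct

section CharacterDuality

variable {R : Type u} [CommRing R]
variable {X X' X'' V V' V'' : Type u}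
  [AddCommGroup X] [Module R X] [AddCommGroup X'] [Module R X'] [AddCommGroup X''] [Module R X'']
  [AddCommGroup V] [Module R V] [AddCommGroup V'] [Module R V'] [AddCommGroup V''] [Module R V'']

theorem dual_exact {f : X' →ₗ[R] X} {g : X →ₗ[R] X''} (h : Function.Exact f g) :
    Function.Exact (CharacterModule.dual g) (CharacterModule.dual f) := by
  intro c
  constructor
  · intro hc
    have hker : (LinearMap.ker g).toAddSubgroup ≤ AddMonoidHom.ker (c : X →+ AddCircle (1 : ℚ)) := by
      intro x hx
      obtain ⟨y, rfl⟩ := (h x).1 hx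
      exact DFunLike.congr_fun hc y
    let c' : (X ⧸ LinearMap.ker g) →+ AddCircle (1 : ℚ) :=
      QuotientAddGroup.lift (LinearMap.ker g).toAddSubgroup (c : X →+ AddCircle (1 : ℚ)) hker
    obtain ⟨d, hd⟩ := CharacterModule.dual_surjective_of_injective
      (LinearMap.range g).subtype (Submodule.subtype_injective _)
      (c'.comp (g.quotKerEquivRange.symm.toLinearMap.toAddMonoidHom))
    refine ⟨d, ?_⟩
    ext x
    have h2 : g.quotKerEquivRange.symm ⟨g x, x, rfl⟩ = Submodule.Quotient.mk x := by
      rw [LinearEquiv.symm_apply_eq]; rfl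
    exact (DFunLike.congr_fun hd ⟨g x, x, rfl⟩).trans (congrArg c' h2)
  · rintro ⟨d, rfl⟩
    ext x
    change d (g (f x)) = 0
    rw [h.apply_apply_eq_zero, map_zero]

theorem SES.dual {f : X' →ₗ[R] X} {g : X →ₗ[R] X''} (h : SES f g) :
    SES (CharacterModule.dual g) (CharacterModule.dual f) :=
  ⟨CharacterModule.dual_injective_of_surjective _ h.surj, dual_exact h.exact,
    CharacterModule.dual_surjective_of_injective _ h.inj⟩

theorem injective_characterModule [Module.Flat R X] :
    Module.Injective R (CharacterModule X) := Module.Flat.iff_characterModule_injective.1 inferInstance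

/-- Extending maps into `V^+` along `f` amounts to injectivity of `f ⊗ V`. -/
theorem extend_iff_rTensor {f : X' →ₗ[R] X} :
    (∀ φ : X' →ₗ[R] CharacterModule V, ∃ ψ : X →ₗ[R] CharacterModule V, ψ ∘ₗ f = φ) ↔
      Function.Injective (f.rTensor V) := by
  rw [rTensor_injective_iff_lcomp_surjective]; rfl

theorem SES.ev_one_iff_rTensor {f : X' →ₗ[R] X} {g : X →ₗ[R] X''} (h : SES f g)
    (hX : EV R 1 X (CharacterModule V)) :
    EV R 1 X'' (CharacterModule V) ↔ Function.Injective (f.rTensor V) :=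
  ⟨fun h3 => extend_iff_rTensor.1 fun φ => h.extend h3 φ,
    fun hi => h.ev_one hX (extend_iff_rTensor.2 hi)⟩

theorem homEquiv_symm_apply_apply (c : CharacterModule (X ⊗[R] V)) (x : X) (v : V) :
    CharacterModule.homEquiv.symm c x v = c (x ⊗ₜ v) := rfl

theorem homEquiv_tmul (φ : X →ₗ[R] CharacterModule V) (x : X) (v : V) :
    CharacterModule.homEquiv φ (x ⊗ₜ v) = φ x v := by
  rw [← homEquiv_symm_apply_apply, LinearEquiv.symm_apply_apply]

theorem lift_dual_iff_lTensor {f : V' →ₗ[R] V} :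
    (∀ φ : X →ₗ[R] CharacterModule V', ∃ ψ : X →ₗ[R] CharacterModule V,
      CharacterModule.dual f ∘ₗ ψ = φ) ↔ Function.Injective (f.lTensor X) := by
  rw [← CharacterModule.dual_surjective_iff_injective]
  constructor
  · intro h c
    obtain ⟨ψ, hψ⟩ := h (CharacterModule.homEquiv.symm c)
    refine ⟨CharacterModule.homEquiv ψ, ?_⟩
    apply CharacterModule.homEquiv.symm.injective
    rw [← hψ]
    ext x v
    exact homEquiv_tmul ψ x (f v)
  · intro h φ
    obtain ⟨c, hc⟩ := h (CharacterModule.homEquiv φ)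
    refine ⟨CharacterModule.homEquiv.symm c, ?_⟩
    ext x v
    rw [← homEquiv_tmul φ, ← hc]
    rfl

/-- `Ext¹(X, V''^+) = 0` in terms of a flat presentation of `V''`. -/
theorem SES.ev_one_dual_iff [Module.Flat R V] {f : V' →ₗ[R] V} {g : V →ₗ[R] V''} (h : SES f g) :
    EV R 1 X (CharacterModule V'') ↔ Function.Injective (f.lTensor X) := by
  rw [← lift_dual_iff_lTensor]
  exact ⟨fun h1 φ => h.dual.lift h1 φ,
    fun hl => h.dual.ev_one' (EV.of_injective injective_characterModule 0) hl⟩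

theorem SES.ev_dual_shift [Module.Flat R V] {f : V' →ₗ[R] V} {g : V →ₗ[R] V''} (h : SES f g)
    (i : ℕ) : EV R (i + 2) X (CharacterModule V'') ↔ EV R (i + 1) X (CharacterModule V') :=
  h.dual.ev_shift' (fun i => EV.of_injective injective_characterModule i) i

theorem EV.of_flat [Module.Flat R X] (i : ℕ) : EV R (i + 1) X (CharacterModule V) := by
  induction i generalizing V with
  | zero =>
    exact (SES.freeCover (R := R) (X := V)).ev_one_dual_iff.2
      (Module.Flat.lTensor_preserves_injective_linearMap _ (Submodule.subtype_injective _))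
  | succ n ih => exact ((SES.freeCover (R := R) (X := V)).ev_dual_shift n).2 ih

end CharacterDuality

section InjectiveModules

variable {R : Type u} [CommRing R]

theorem injective_factor {I U V : Type u} [AddCommGroup I] [Module R I] [AddCommGroup U] [Module R U]
    [AddCommGroup V] [Module R V] (hI : Module.Injective R I) (α : U →ₗ[R] V) (x : U →ₗ[R] I)
    (h : LinearMap.ker α ≤ LinearMap.ker x) : ∃ θ : V →ₗ[R] I, θ ∘ₗ α = x := by
  obtain ⟨θ, hθ⟩ := hI.out (LinearMap.range α).subtype (Submodule.subtype_injective _)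
    ((LinearMap.ker α).liftQ x h ∘ₗ α.quotKerEquivRange.symm.toLinearMap)
  refine ⟨θ, ?_⟩
  ext u
  have h2 : α.quotKerEquivRange.symm ⟨α u, u, rfl⟩ = Submodule.Quotient.mk u := by
    rw [LinearEquiv.symm_apply_eq]; rfl
  have := hθ ⟨α u, u, rfl⟩
  simpa [h2] using this

/-- Systems of equations over an injective module are solvable if they are consistent. -/
theorem injective_solve {E : Type u} [AddCommGroup E] [Module R E] (hE : Module.Injective R E)
    {ι : Type} [Fintype ι] (f : ι → R) (e : ι → E)
    (h : ∀ y : ι → R, ∑ i, y i * f i = 0 → ∑ i, y i • e i = 0) : ∃ e₀ : E, ∀ i, f i • e₀ = e i := by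
  classical
  obtain ⟨θ, hθ⟩ := injective_factor hE (Fintype.linearCombination R f)
    (Fintype.linearCombination R e) (by
      intro y hy
      simp only [LinearMap.mem_ker, Fintype.linearCombination_apply, smul_eq_mul] at hy ⊢
      exact h y hy)
  refine ⟨θ 1, fun i => ?_⟩
  have := LinearMap.congr_fun hθ (Pi.single i 1)
  simp only [LinearMap.comp_apply, Fintype.linearCombination_apply_single, one_smul] at this
  rw [← this, ← map_smul, smul_eq_mul, mul_one]

/-- Over a noetherian ring, the relations on `f` are finitely generated. -/
theorem exists_relations [IsNoetherianRing R] {ι : Type} [Fintype ι] {M : Type u} [AddCommGroup M]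
    [Module R M] (f : ι → M) :
    ∃ (q : ℕ) (a : Fin q → ι → R), (∀ k, ∑ i, a k i • f i = 0) ∧
      ∀ y : ι → R, ∑ i, y i • f i = 0 → ∃ b : Fin q → R, ∀ i, y i = ∑ k, b k * a k i := by
  obtain ⟨q, a, ha⟩ := Submodule.fg_iff_exists_fin_generating_family.1
    (IsNoetherian.noetherian (LinearMap.ker (Fintype.linearCombination R f)))
  refine ⟨q, a, fun k => ?_, fun y hy => ?_⟩
  · have : a k ∈ LinearMap.ker (Fintype.linearCombination R f) := by
      rw [← ha]; exact Submodule.subset_span ⟨k, rfl⟩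
    simpa [Fintype.linearCombination_apply] using this
  · have : y ∈ LinearMap.ker (Fintype.linearCombination R f) := by
      simpa [Fintype.linearCombination_apply] using hy
    rw [← ha] at this
    obtain ⟨b, hb⟩ := (Submodule.mem_span_range_iff_exists_fun R).1 this
    refine ⟨b, fun i => ?_⟩
    rw [← hb]; simp

theorem flat_hom_injective [IsNoetherianRing R] {E I : Type u} [AddCommGroup E] [Module R E]
    [AddCommGroup I] [Module R I] (hE : Module.Injective R E) (hI : Module.Injective R I) :
    Module.Flat R (E →ₗ[R] I) := by
  classical
  refine Module.Flat.of_forall_isTrivialRelation ?_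
  intro l f x hfx
  obtain ⟨q, a, ha, ha'⟩ := exists_relations (R := R) f
  let α : (Fin l → E) →ₗ[R] (Fin q → E) :=
    LinearMap.pi fun k => ∑ i, a k i • LinearMap.proj i
  let ξ : (Fin l → E) →ₗ[R] I := ∑ i, x i ∘ₗ LinearMap.proj i
  obtain ⟨θ, hθ⟩ := injective_factor hI α ξ (by
    intro e he
    have he' : ∀ k, ∑ i, a k i • e i = 0 := fun k => by
      have := congrFun (LinearMap.mem_ker.1 he) k
      simpa [α] using this
    obtain ⟨e₀, h₀⟩ := injective_solve hE f e (by
      intro y hy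
      obtain ⟨b, hb⟩ := ha' y (by simpa using hy)
      simp_rw [hb, Finset.sum_smul, mul_smul]
      rw [Finset.sum_comm]
      simp_rw [← Finset.smul_sum, he', smul_zero, Finset.sum_const_zero])
    have h3 : e = fun i => f i • e₀ := funext fun i => (h₀ i).symm
    rw [LinearMap.mem_ker, h3]
    have := LinearMap.congr_fun hfx e₀
    simpa [ξ] using this)
  refine ⟨q, fun i k => a k i, fun k => θ ∘ₗ LinearMap.single R (fun _ => E) k, ?_, ?_⟩
  · intro i
    ext e
    have := LinearMap.congr_fun hθ (Pi.single i e)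
    have h1 : ξ (Pi.single i e) = x i e := by
      simp only [ξ, LinearMap.sum_apply, LinearMap.comp_apply, LinearMap.proj_apply]
      rw [Finset.sum_eq_single i (by intro j _ hj; simp [hj]) (by simp)]
      simp
    have h2 : α (Pi.single i e) = ∑ k, a k i • Pi.single k e := by
      ext k
      simp only [α, LinearMap.pi_apply, LinearMap.sum_apply, LinearMap.smul_apply,
        LinearMap.proj_apply, Finset.sum_apply, Pi.smul_apply]
      rw [Finset.sum_eq_single i (by intro j _ hj; simp [hj]) (by simp),
        Finset.sum_eq_single k (by intro j _ hj; simp [hj.symm]) (by simp)]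
      simp
    rw [LinearMap.comp_apply, h1, h2] at this
    rw [← this]
    simp
  · intro k
    simpa [mul_comm] using ha k

end InjectiveModules

section Dagger

variable {R : Type u} [CommRing R]

/-- `X^† = Hom(X, E^+)`. -/
abbrev Dg (R E X : Type u) [CommRing R] [AddCommGroup E] [Module R E] [AddCommGroup X]
    [Module R X] : Type u := X →ₗ[R] CharacterModule E

variable {E X Y Z : Type u} [AddCommGroup E] [Module R E]
  [AddCommGroup X] [Module R X] [AddCommGroup Y] [Module R Y] [AddCommGroup Z] [Module R Z]

/-- Swapping the roles of the two modules in `Hom(X, E^+)`. -/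
noncomputable def dgSwap (R E X : Type u) [CommRing R] [AddCommGroup E] [Module R E]
    [AddCommGroup X] [Module R X] :
    Dg R E X ≃ₗ[R] (E →ₗ[R] CharacterModule X) :=
  CharacterModule.homEquiv ≪≫ₗ CharacterModule.congr (TensorProduct.comm R X E) ≪≫ₗ
    CharacterModule.homEquiv.symm

theorem dgSwap_apply (φ : Dg R E X) (e : E) (x : X) : dgSwap R E X φ e x = φ x e := by
  exact homEquiv_tmul φ x e

theorem flat_dg [IsNoetherianRing R] (hE : Module.Injective R E) [Module.Flat R X] :
    Module.Flat R (Dg R E X) :=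
  have := flat_hom_injective hE (injective_characterModule (R := R) (X := X))
  Module.Flat.of_linearEquiv (dgSwap R E X)

theorem flat_characterModule [IsNoetherianRing R] (hE : Module.Injective R E) :
    Module.Flat R (CharacterModule E) :=
  have := flat_dg (X := R) hE
  Module.Flat.of_linearEquiv (LinearMap.ringLmapEquivSelf R R (CharacterModule E)).symm

/-- The dual sequence of a short exact sequence with `Ext¹(Z, E^+) = 0`. -/
theorem SES.dg {f : X →ₗ[R] Y} {g : Y →ₗ[R] Z} (h : SES f g)
    (hZ : EV R 1 Z (CharacterModule E)) :
    SES (LinearMap.lcomp R (CharacterModule E) g) (LinearMap.lcomp R (CharacterModule E) f) := by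
  refine ⟨?_, ?_, fun φ => h.extend hZ φ⟩
  · intro a b hab
    ext1 z
    obtain ⟨y, rfl⟩ := h.surj z
    exact LinearMap.congr_fun hab y
  · exact LinearMap.exact_lcomp_of_exact_of_surjective (CharacterModule E) h.exact h.surj

end Dagger

end GFD

namespace GFD

open TensorProduct

section Torsion

variable {R : Type u} [CommRing R]

/-- The `I`-power torsion submodule. -/
def Gam (I : Ideal R) (M : Type u) [AddCommGroup M] [Module R M] : Submodule R M where
  carrier := {x | ∃ n : ℕ, ∀ a ∈ I ^ n, a • x = 0}
  zero_mem' := ⟨0, fun a _ => smul_zero a⟩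
  add_mem' := by
    rintro x y ⟨n, hn⟩ ⟨m, hm⟩
    refine ⟨n + m, fun a ha => ?_⟩
    rw [smul_add, hn a (Ideal.pow_le_pow_right (Nat.le_add_right n m) ha),
      hm a (Ideal.pow_le_pow_right (Nat.le_add_left m n) ha), add_zero]
  smul_mem' := by
    rintro r x ⟨n, hn⟩
    exact ⟨n, fun a ha => by rw [smul_comm, hn a ha, smul_zero]⟩

variable {M N : Type u} [AddCommGroup M] [Module R M] [AddCommGroup N] [Module R N]

theorem map_mem_Gam {I : Ideal R} (f : M →ₗ[R] N) {x : M} (hx : x ∈ Gam I M) : f x ∈ Gam I N := by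
  obtain ⟨n, hn⟩ := hx
  exact ⟨n, fun a ha => by rw [← map_smul, hn a ha, map_zero]⟩

theorem injective_Gam_of_extend [IsNoetherianRing R] (I : Ideal R)
    (hM : ∀ (N : ℕ) (b : Ideal R) (φ : b →ₗ[R] M), (∀ y : b, (y : R) ∈ I ^ N → φ y = 0) →
      ∃ θ : R ⧸ I ^ N →ₗ[R] M, ∀ y : b, θ (Submodule.Quotient.mk (y : R)) = φ y) :
    Module.Injective R (Gam I M) := by
  rw [← Module.Baer.iff_injective]
  intro b φ
  -- a power of `I` kills the image of `φ`
  obtain ⟨n, hn⟩ : ∃ n : ℕ, ∀ y : b, ∀ a ∈ I ^ n, a • (φ y) = 0 := by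
    obtain ⟨s, hs⟩ := IsNoetherian.noetherian (⊤ : Submodule R b)
    have hsn : ∀ t : Finset b, ∃ n : ℕ, ∀ y ∈ t, ∀ a ∈ I ^ n, a • (φ y) = 0 := by
      classical
      intro t
      induction t using Finset.induction_on with
      | empty => exact ⟨0, by simp⟩
      | insert y t _ ih =>
        obtain ⟨n, hn⟩ := ih
        obtain ⟨m, hm⟩ := (φ y).2
        refine ⟨n + m, fun z hz a ha => ?_⟩
        rcases Finset.mem_insert.1 hz with rfl | hz
        · exact Subtype.ext (hm a (Ideal.pow_le_pow_right (Nat.le_add_left m n) ha))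
        · exact hn z hz a (Ideal.pow_le_pow_right (Nat.le_add_right n m) ha)
    obtain ⟨n, hn⟩ := hsn s
    refine ⟨n, fun y a ha => ?_⟩
    have hy : y ∈ Submodule.span R (s : Set b) := hs ▸ Submodule.mem_top
    induction hy using Submodule.span_induction with
    | mem y hy => exact hn y hy a ha
    | zero => simp
    | add y z _ _ h1 h2 => rw [map_add, smul_add, h1, h2, add_zero]
    | smul r y _ h1 => rw [map_smul, smul_comm, h1, smul_zero]
  obtain ⟨k, hk⟩ := Ideal.exists_pow_inf_eq_pow_smul I (b : Submodule R R)
  have hkill : ∀ (y : b), (y : R) ∈ I ^ (n + k) → φ y = 0 := by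
    intro y hy
    have h1 : (y : R) ∈ I ^ (n + k) • (⊤ : Submodule R R) ⊓ b :=
      ⟨by simpa using hy, y.2⟩
    rw [hk (n + k) (Nat.le_add_left k n), Nat.add_sub_cancel] at h1
    have h2 : ∀ z ∈ I ^ n • (I ^ k • (⊤ : Submodule R R) ⊓ b), ∃ hz : z ∈ b, φ ⟨z, hz⟩ = 0 := by
      intro z hz
      induction hz using Submodule.smul_induction_on' with
      | smul a ha w hw =>
        refine ⟨b.smul_mem a hw.2, ?_⟩
        have := hn ⟨w, hw.2⟩ a ha
        rw [← map_smul] at this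
        exact this
      | add z hz w hw h1 h2 =>
        obtain ⟨hz, h1⟩ := h1
        obtain ⟨hw, h2⟩ := h2
        refine ⟨b.add_mem hz hw, ?_⟩
        have : φ (⟨z, hz⟩ + ⟨w, hw⟩) = 0 := by rw [map_add, h1, h2, add_zero]
        exact this
    exact (h2 _ h1).2
  obtain ⟨θ, hθ⟩ := hM (n + k) b ((Gam I M).subtype ∘ₗ φ) fun y hy => by
    rw [LinearMap.comp_apply, hkill y hy, map_zero]
  let x₀ : Gam I M := ⟨θ (Submodule.Quotient.mk 1), n + k, fun a ha => by
    rw [← map_smul, ← Submodule.Quotient.mk_smul, smul_eq_mul, mul_one,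
      (Submodule.Quotient.mk_eq_zero _).2 ha, map_zero]⟩
  refine ⟨LinearMap.toSpanSingleton R _ x₀, fun y hy => ?_⟩
  apply Subtype.ext
  have := hθ ⟨y, hy⟩
  simp only [LinearMap.comp_apply, Submodule.subtype_apply] at this
  rw [← this]
  simp only [LinearMap.toSpanSingleton_apply, Submodule.coe_smul, x₀]
  rw [← map_smul, ← Submodule.Quotient.mk_smul, smul_eq_mul, mul_one]

theorem injective_Gam [IsNoetherianRing R] (I : Ideal R) (hM : Module.Injective R M) :
    Module.Injective R (Gam I M) := by
  refine injective_Gam_of_extend I fun N b φ hφ => ?_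
  obtain ⟨θ, hθ⟩ := injective_factor hM ((I ^ N).mkQ ∘ₗ b.subtype) φ (by
      intro y hy
      simp only [LinearMap.mem_ker, LinearMap.comp_apply, Submodule.mkQ_apply,
        Submodule.Quotient.mk_eq_zero, Submodule.subtype_apply] at hy ⊢
      exact hφ y hy)
  exact ⟨θ, fun y => LinearMap.congr_fun hθ y⟩

/-- Divisibility of injective modules modulo torsion. -/
theorem injective_divisible [IsNoetherianRing R] (hM : Module.Injective R M) (x : R) (v : M)
    (N : ℕ) : ∃ u : M, ∃ n : ℕ, x ^ n • (x ^ N • u - v) = 0 := by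
  obtain ⟨n, hn⟩ := monotone_stabilizes_iff_noetherian.2 (inferInstance : IsNoetherian R R)
    ⟨fun n => LinearMap.ker (LinearMap.mulLeft R (x ^ n)), fun a b hab y hy => by
      simp only [LinearMap.mem_ker, LinearMap.mulLeft_apply] at hy ⊢
      rw [← Nat.add_sub_cancel' hab, pow_add, mul_right_comm, hy, zero_mul]⟩
  obtain ⟨u, hu⟩ := injective_solve (ι := Unit) hM (fun _ => x ^ (n + N)) (fun _ => x ^ n • v) (by
    intro y hy
    simp only [Finset.univ_unique, Finset.sum_singleton] at hy ⊢
    have h1 : y () ∈ LinearMap.ker (LinearMap.mulLeft R (x ^ (n + N))) := by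
      simpa [mul_comm] using hy
    have h2 : LinearMap.ker (LinearMap.mulLeft R (x ^ n)) =
      LinearMap.ker (LinearMap.mulLeft R (x ^ (n + N))) := hn (n + N) (Nat.le_add_right _ _)
    rw [← h2] at h1
    have h3 : x ^ n * y () = 0 := h1
    change y () • x ^ n • v = 0
    rw [smul_smul, mul_comm, h3, zero_smul])
  refine ⟨u, n, ?_⟩
  rw [smul_sub, smul_smul, ← pow_add, hu (), sub_self]

/-- Torsion functors are exact on exact complexes of injectives. -/
theorem gam_exact [IsNoetherianRing R] (s : List R) :
    ∀ (I : ℤ → Type u) [∀ i, AddCommGroup (I i)] [∀ i, Module R (I i)]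
    (d : ∀ i, I i →ₗ[R] I (i + 1)) (_ : ∀ i, Module.Injective R (I i))
    (_ : ∀ i, Function.Exact (d i) (d (i + 1))) (i : ℤ) (v : I (i + 1)) (_ : d (i + 1) v = 0)
    (_ : ∀ x ∈ s, ∃ n : ℕ, x ^ n • v = 0),
    ∃ u : I i, d i u = v ∧ ∀ x ∈ s, ∃ n : ℕ, x ^ n • u = 0 := by
  induction s with
  | nil =>
    intro I _ _ d hI hd i v hv _
    obtain ⟨u, hu⟩ := (hd i v).1 hv
    exact ⟨u, hu, by simp⟩
  | cons x s ih =>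
    intro I _ _ d hI hd i v hv hs
    let d' : ∀ i, Gam (Ideal.span {x}) (I i) →ₗ[R] Gam (Ideal.span {x}) (I (i + 1)) :=
      fun i => (d i).restrict fun y hy => map_mem_Gam _ hy
    have hgam : ∀ {i} (y : I i), y ∈ Gam (Ideal.span {x}) (I i) ↔ ∃ n : ℕ, x ^ n • y = 0 := by
      intro i y
      refine exists_congr fun n => ?_
      rw [Ideal.span_singleton_pow]
      refine ⟨fun h => h _ (Ideal.mem_span_singleton_self _), fun h a ha => ?_⟩
      obtain ⟨c, rfl⟩ := Ideal.mem_span_singleton'.1 ha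
      rw [mul_smul, h, smul_zero]
    have hex : ∀ i (w : I (i + 1)), d (i + 1) w = 0 → w ∈ Gam (Ideal.span {x}) (I (i + 1)) →
        ∃ u : I i, d i u = w ∧ u ∈ Gam (Ideal.span {x}) (I i) := by
      intro i w hw hwx
      obtain ⟨j, rfl⟩ : ∃ j, i = j + 1 := ⟨i - 1, by ring⟩
      obtain ⟨u, rfl⟩ := (hd _ w).1 hw
      obtain ⟨N, hN⟩ := (hgam _).1 hwx
      rw [← map_smul] at hN
      obtain ⟨z, hz⟩ := (hd _ _).1 hN
      obtain ⟨z', n, hz'⟩ := injective_divisible (hI j) x z N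
      refine ⟨u - d j z', ?_, (hgam _).2 ⟨n + N, ?_⟩⟩
      · rw [map_sub, (hd j).apply_apply_eq_zero, sub_zero]
      · rw [pow_add, mul_smul, smul_sub, ← hz, ← map_smul, ← map_sub, ← map_smul]
        rw [smul_sub, sub_eq_zero] at hz'
        rw [smul_sub, ← hz', sub_self, map_zero]
    obtain ⟨u, hu, hus⟩ := ih (fun i => Gam (Ideal.span {x}) (I i)) d'
      (fun i => injective_Gam _ (hI i)) (by
        intro i w
        constructor
        · intro hw
          obtain ⟨u, hu, hu'⟩ := hex i w.1 (congrArg Subtype.val hw) w.2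
          exact ⟨⟨u, hu'⟩, Subtype.ext hu⟩
        · rintro ⟨u, rfl⟩
          exact Subtype.ext ((hd i).apply_apply_eq_zero _)) i
      ⟨v, (hgam v).2 (hs x (by simp))⟩ (Subtype.ext hv) (by
        intro y hy
        obtain ⟨n, hn⟩ := hs y (by simp [hy])
        exact ⟨n, Subtype.ext hn⟩)
    refine ⟨u.1, congrArg Subtype.val hu, fun y hy => ?_⟩
    rcases List.mem_cons.1 hy with rfl | hy
    · exact (hgam _).1 u.2
    · obtain ⟨n, hn⟩ := hus y hy
      exact ⟨n, congrArg Subtype.val hn⟩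

theorem mem_Gam_span_iff (s : List R) (v : M) :
    v ∈ Gam (Ideal.span {x : R | x ∈ s}) M ↔ ∀ x ∈ s, ∃ n : ℕ, x ^ n • v = 0 := by
  constructor
  · rintro ⟨n, hn⟩ x hx
    exact ⟨n, hn _ (Ideal.pow_mem_pow (Ideal.subset_span (show x ∈ {x : R | x ∈ s} from hx)) n)⟩
  · intro h
    let K : Ideal R := LinearMap.ker (LinearMap.toSpanSingleton R M v)
    have h1 : Ideal.span {x : R | x ∈ s} ≤ K.radical := by
      rw [Ideal.span_le]
      intro x hx
      obtain ⟨n, hn⟩ := h x hx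
      exact ⟨n, hn⟩
    obtain ⟨n, hn⟩ := Ideal.exists_pow_le_of_le_radical_of_fg h1
      (by classical exact ⟨s.toFinset, by congr 1; ext; simp⟩)
    exact ⟨n, fun a ha => hn ha⟩

end Torsion

end GFD

namespace GFD

open TensorProduct

section Hull

variable {R : Type u} [CommRing R]

theorem exists_injective_embedding (R : Type u) [CommRing R] (X : Type u) [AddCommGroup X]
    [Module R X] : ∃ (J : Type u) (_ : AddCommGroup J) (_ : Module R J) (i : X →ₗ[R] J),
      Module.Injective R J ∧ Function.Injective i := by
  let ev : X →ₗ[R] CharacterModule (CharacterModule X) :=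
    { toFun := fun x => (AddMonoidHom.eval x : _)
      map_add' := fun x y => by ext c; exact map_add c x y
      map_smul' := fun r x => by ext c; rfl }
  refine ⟨CharacterModule (CharacterModule X →₀ R), inferInstance, inferInstance,
    CharacterModule.dual (freeCover R (CharacterModule X)) ∘ₗ ev, injective_characterModule, ?_⟩
  refine (CharacterModule.dual_injective_of_surjective _ freeCover_surjective).comp ?_
  rw [← LinearMap.ker_eq_bot, LinearMap.ker_eq_bot']
  intro x hx
  by_contra h
  obtain ⟨c, hc⟩ := CharacterModule.exists_character_apply_ne_zero_of_ne_zero h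
  exact hc (DFunLike.congr_fun hx c)

theorem injective_of_retract {I J : Type u} [AddCommGroup I] [Module R I] [AddCommGroup J]
    [Module R J] (hI : Module.Injective R I) (i : J →ₗ[R] I) (p : I →ₗ[R] J)
    (h : ∀ x, p (i x) = x) : Module.Injective R J :=
  ⟨fun _ _ _ _ _ _ f hf g => by
    obtain ⟨k, hk⟩ := hI.out f hf (i ∘ₗ g)
    exact ⟨p ∘ₗ k, fun x => by rw [LinearMap.comp_apply, hk, LinearMap.comp_apply, h]⟩⟩

/-- `E` is an injective `𝔪`-torsion module with socle generated by `ε`. -/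
structure IsHull (𝔪 : Ideal R) (E : Type u) [AddCommGroup E] [Module R E] (ε : E) : Prop where
  inj : Module.Injective R E
  tors : ∀ e : E, ∃ n : ℕ, ∀ a ∈ 𝔪 ^ n, a • e = 0
  ne : ε ≠ 0
  ann : ∀ a ∈ 𝔪, a • ε = 0
  soc : ∀ e : E, (∀ a ∈ 𝔪, a • e = 0) → ∃ r : R, e = r • ε

theorem exists_hull [IsNoetherianRing R] (𝔪 : Ideal R) [h𝔪 : 𝔪.IsMaximal] :
    ∃ (E : Type u) (_ : AddCommGroup E) (_ : Module R E) (ε : E), IsHull 𝔪 E ε := by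
  obtain ⟨J₀, _, _, i, hJ₀, hi⟩ := exists_injective_embedding R (R ⧸ 𝔪)
  let J := Gam 𝔪 J₀
  have hJ : Module.Injective R J := injective_Gam 𝔪 hJ₀
  have hmk : ∀ a ∈ 𝔪, a • (i 1) = 0 := fun a ha => by
    rw [← map_smul, show a • (1 : R ⧸ 𝔪) = Ideal.Quotient.mk 𝔪 a by
      rw [Algebra.smul_def, mul_one]; rfl, Ideal.Quotient.eq_zero_iff_mem.2 ha, map_zero]
  let ε : J := ⟨i 1, 1, fun a ha => hmk a (by simpa using ha)⟩
  have hε : ∀ a ∈ 𝔪, a • ε = 0 := fun a ha => Subtype.ext (hmk a ha)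
  have hε0 : ε ≠ 0 := fun h => by
    have h1 : i 1 = 0 := congrArg Subtype.val h
    exact one_ne_zero (hi (h1.trans (map_zero i).symm))
  -- a maximal submodule with socle spanned by `ε`
  obtain ⟨E, -, hE⟩ := zorn_le_nonempty₀
    {E : Submodule R J | ε ∈ E ∧ ∀ x ∈ E, (∀ a ∈ 𝔪, a • x = 0) → x ∈ R ∙ ε} (by
      intro c hc hchain y hy
      refine ⟨sSup c, ⟨Submodule.mem_sSup_of_mem hy (hc hy).1, fun x hx h => ?_⟩,
        fun z hz => le_sSup hz⟩
      obtain ⟨z, hz, hxz⟩ := (Submodule.mem_sSup_of_directed ⟨y, hy⟩ hchain.directedOn).1 hx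
      exact (hc hz).2 x hxz h) (R ∙ ε)
    ⟨Submodule.mem_span_singleton_self ε, fun x hx _ => hx⟩
  -- a maximal complement
  obtain ⟨C, -, hC⟩ := zorn_le_nonempty₀ {C : Submodule R J | ∀ x ∈ C, x ∈ E → x = 0} (by
      intro c hc hchain y hy
      refine ⟨sSup c, fun x hx h => ?_, fun z hz => le_sSup hz⟩
      obtain ⟨z, hz, hxz⟩ := (Submodule.mem_sSup_of_directed ⟨y, hy⟩ hchain.directedOn).1 hx
      exact hc hz x hxz h) ⊥ (fun x hx _ => hx)
  obtain ⟨θ, hθ⟩ := injective_factor hJ (C.mkQ ∘ₗ E.subtype) E.subtype (by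
    intro x hx
    simp only [LinearMap.mem_ker, LinearMap.comp_apply, Submodule.mkQ_apply,
      Submodule.Quotient.mk_eq_zero, Submodule.subtype_apply] at hx ⊢
    exact hC.1 _ hx x.2)
  let ψ : J →ₗ[R] J := θ ∘ₗ C.mkQ
  have hψE : ∀ x ∈ E, ψ x = x := fun x hx => LinearMap.congr_fun hθ ⟨x, hx⟩
  have hrange : LinearMap.range ψ = E := by
    refine le_antisymm (hE.2 ⟨⟨ε, hψE ε hE.1.1⟩, ?_⟩ fun x hx => ⟨x, hψE x hx⟩)
      fun x hx => ⟨x, hψE x hx⟩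
    rintro _ ⟨j, rfl⟩ hj
    by_cases hjC : j ∈ C
    · have : ψ j = 0 := by
        change θ (C.mkQ j) = 0
        rw [Submodule.mkQ_apply, (Submodule.Quotient.mk_eq_zero _).2 hjC, map_zero]
      rw [this]; exact zero_mem _
    obtain ⟨y, hy, hyE, hy0⟩ : ∃ y ∈ C ⊔ R ∙ j, y ∈ E ∧ y ≠ 0 := by
      by_contra! h
      exact hjC (hC.2 (y := C ⊔ R ∙ j) h le_sup_left
        (Submodule.mem_sup_right (Submodule.mem_span_singleton_self j)))
    obtain ⟨c, hc, z, hz, rfl⟩ := Submodule.mem_sup.1 hy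
    obtain ⟨r, rfl⟩ := Submodule.mem_span_singleton.1 hz
    have h1 : c + r • j = r • ψ j := by
      rw [← hψE _ hyE, map_add, map_smul]
      have : ψ c = 0 := by
        change θ (C.mkQ c) = 0
        rw [Submodule.mkQ_apply, (Submodule.Quotient.mk_eq_zero _).2 hc, map_zero]
      rw [this, zero_add]
    have hr : r ∉ 𝔪 := fun hr => hy0 (h1.trans (hj r hr))
    obtain ⟨s, a, ha, hs⟩ := h𝔪.exists_inv hr
    refine hE.1.2 _ ?_ hj
    have : ψ j = s • (c + r • j) := by
      rw [h1, smul_smul]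
      conv_lhs => rw [← one_smul R (ψ j), ← hs, add_smul, hj a ha, add_zero]
    rw [this]
    exact E.smul_mem s hyE
  refine ⟨E, inferInstance, inferInstance, ⟨ε, hE.1.1⟩, ?_, ?_, ?_, ?_, ?_⟩
  · exact injective_of_retract hJ E.subtype (ψ.codRestrict E fun x => hrange ▸ ⟨x, rfl⟩)
      fun x => Subtype.ext (hψE x x.2)
  · rintro ⟨⟨e, n, hn⟩, he⟩
    exact ⟨n, fun a ha => Subtype.ext (Subtype.ext (hn a ha))⟩
  · exact fun h => hε0 (congrArg Subtype.val h)
  · exact fun a ha => Subtype.ext (hε a ha)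
  · intro e he
    obtain ⟨r, hr⟩ := Submodule.mem_span_singleton.1
      (hE.1.2 e e.2 fun a ha => congrArg Subtype.val (he a ha))
    exact ⟨r, Subtype.ext hr.symm⟩

variable {𝔪 : Ideal R} {E : Type u} [AddCommGroup E] [Module R E] {ε : E}

/-- The submodule of elements killed by `I`. -/
def Killed (I : Ideal R) (E : Type u) [AddCommGroup E] [Module R E] : Submodule R E where
  carrier := {e | ∀ a ∈ I, a • e = 0}
  zero_mem' := fun a _ => smul_zero a
  add_mem' := fun hx hy a ha => by rw [smul_add, hx a ha, hy a ha, add_zero]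
  smul_mem' := fun r x hx a ha => by rw [smul_comm, hx a ha, smul_zero]

theorem mem_Killed_mul {I J : Ideal R} {e : E} :
    e ∈ Killed (J * I) E ↔ ∀ v ∈ J, v • e ∈ Killed I E := by
  constructor
  · intro h v hv a ha
    rw [smul_smul, mul_comm]
    exact h _ (Ideal.mul_mem_mul hv ha)
  · intro h a ha
    induction ha using Submodule.mul_induction_on' with
    | mem_mul_mem v hv a ha => rw [mul_comm, mul_smul]; exact h v hv a ha
    | add x _ y _ hx hy => rw [add_smul, hx, hy, add_zero]

theorem mem_Killed_span {b : ℕ} {v : Fin b → R} {e : E} :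
    e ∈ Killed (Ideal.span (Set.range v)) E ↔ ∀ i, v i • e = 0 := by
  constructor
  · exact fun h i => h _ (Ideal.subset_span ⟨i, rfl⟩)
  · intro h a ha
    induction ha using Submodule.span_induction with
    | mem x hx => obtain ⟨i, rfl⟩ := hx; exact h i
    | zero => simp
    | add x y _ _ hx hy => rw [add_smul, hx, hy, add_zero]
    | smul r x _ hx => rw [smul_assoc, hx, smul_zero]

theorem IsHull.exists_mem_killed (h : IsHull 𝔪 E ε) {n : ℕ} (e : Fin n → E) :
    ∃ j, ∀ i, e i ∈ Killed (𝔪 ^ j) E := by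
  choose N hN using fun i => h.tors (e i)
  refine ⟨∑ i, N i, fun i a ha => hN i a (Ideal.pow_le_pow_right ?_ ha)⟩
  exact Finset.single_le_sum (fun _ _ => Nat.zero_le _) (Finset.mem_univ i)

theorem IsHull.fg_killed [IsNoetherianRing R] (h : IsHull 𝔪 E ε) (j : ℕ) :
    (Killed (𝔪 ^ j) E).FG := by
  induction j with
  | zero =>
    have : Killed (𝔪 ^ 0) E = ⊥ := by
      rw [eq_bot_iff]
      intro e he
      simpa using he 1 (by simp)
    rw [this]; exact Submodule.fg_bot
  | succ j ih =>
    obtain ⟨b, v, hv⟩ := Submodule.fg_iff_exists_fin_generating_family.1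
      (IsNoetherian.noetherian (𝔪 ^ j))
    let Φ : E →ₗ[R] (Fin b → E) := LinearMap.pi fun i => LinearMap.lsmul R E (v i)
    refine Submodule.fg_of_fg_map_of_fg_inf_ker Φ ?_ ?_
    · refine Submodule.FG.of_le (T := Submodule.pi Set.univ fun _ => R ∙ ε)
        (Submodule.fg_pi fun _ => Submodule.fg_span_singleton ε) ?_
      rintro _ ⟨e, he, rfl⟩ i -
      rw [SetLike.mem_coe, pow_succ, mem_Killed_mul] at he
      obtain ⟨r, hr⟩ := h.soc (v i • e) (he (v i) (hv ▸ Submodule.subset_span ⟨i, rfl⟩))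
      exact Submodule.mem_span_singleton.2 ⟨r, hr.symm⟩
    · refine Submodule.FG.of_le ih ?_
      rintro e ⟨-, he⟩
      rw [← hv]
      exact mem_Killed_span.2 fun i => congrFun he i

theorem IsHull.exists_smul [IsNoetherianRing R] (h : IsHull 𝔪 E ε) (ψ : E →ₗ[R] E) (j : ℕ) :
    ∃ r : R, ∀ e ∈ Killed (𝔪 ^ j) E, ψ e = r • e := by
  classical
  induction j with
  | zero =>
    refine ⟨0, fun e he => ?_⟩
    have : e = 0 := by simpa using he 1 (by simp)
    rw [this, map_zero, smul_zero]
  | succ j ih =>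
    obtain ⟨r, hr⟩ := ih
    obtain ⟨b, v, hv⟩ := Submodule.fg_iff_exists_fin_generating_family.1
      (IsNoetherian.noetherian (𝔪 ^ j))
    let Φ : E →ₗ[R] (Fin b → E) := LinearMap.pi fun i => LinearMap.lsmul R E (v i)
    obtain ⟨θ, hθ⟩ := injective_factor h.inj (Φ ∘ₗ (Killed (𝔪 ^ (j + 1)) E).subtype)
      ((ψ - LinearMap.lsmul R E r) ∘ₗ (Killed (𝔪 ^ (j + 1)) E).subtype) (by
        intro e he
        have h1 : (e : E) ∈ Killed (𝔪 ^ j) E := by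
          rw [← hv]; exact mem_Killed_span.2 fun i => congrFun he i
        simp [hr _ h1])
    have hc : ∀ i, ∃ c : R, θ (Pi.single i ε) = c • ε := fun i => h.soc _ fun a ha => by
      rw [← map_smul, ← Pi.single_smul, h.ann a ha, Pi.single_zero, map_zero]
    choose c hc using hc
    refine ⟨r + ∑ i, c i * v i, fun e he => ?_⟩
    have h1 := LinearMap.congr_fun hθ ⟨e, he⟩
    simp only [LinearMap.comp_apply, Submodule.subtype_apply, LinearMap.sub_apply,
      LinearMap.lsmul_apply] at h1
    rw [add_smul, ← sub_eq_iff_eq_add', ← h1, ← Finset.univ_sum_single (Φ e), map_sum,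
      Finset.sum_smul]
    refine Finset.sum_congr rfl fun i _ => ?_
    rw [pow_succ, mem_Killed_mul] at he
    obtain ⟨s, hs⟩ := h.soc (v i • e) (he (v i) (hv ▸ Submodule.subset_span ⟨i, rfl⟩))
    have : Φ e i = s • ε := hs
    rw [this, Pi.single_smul, map_smul, hc, mul_smul, hs, smul_comm]

theorem IsHull.mem_pow (h : IsHull 𝔪 E ε) [h𝔪 : 𝔪.IsMaximal] {j : ℕ} {r : R}
    (hr : ∀ e ∈ Killed (𝔪 ^ j) E, r • e = 0) : r ∈ 𝔪 ^ j := by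
  by_contra hrj
  obtain ⟨θ, hθ⟩ := injective_factor h.inj
    (LinearMap.toSpanSingleton R (R ⧸ 𝔪 ^ j) (Ideal.Quotient.mk _ r))
    (LinearMap.toSpanSingleton R E ε) (by
      intro a ha
      have ha' : a * r ∈ 𝔪 ^ j := by
        rw [← Ideal.Quotient.eq_zero_iff_mem, map_mul]; exact ha
      refine h.ann a ?_
      by_contra ham
      have h1 : Ideal.span {a} ⊔ 𝔪 ^ j = ⊤ := Ideal.sup_pow_eq_top (by
        rw [sup_comm]
        by_contra hne
        have := h𝔪.eq_of_le hne le_sup_left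
        exact ham (this ▸ Submodule.mem_sup_right (Ideal.mem_span_singleton_self a)))
      have h2 : (1 : R) ∈ Ideal.span {a} ⊔ 𝔪 ^ j := h1 ▸ Submodule.mem_top
      obtain ⟨_, hc, u, hu, hcu⟩ := Submodule.mem_sup.1 h2
      obtain ⟨c, rfl⟩ := Ideal.mem_span_singleton'.1 hc
      apply hrj
      rw [← one_mul r, ← hcu, add_mul, mul_assoc]
      exact add_mem (Ideal.mul_mem_left _ _ ha') (Ideal.mul_mem_right _ _ hu))
  have hkill : θ 1 ∈ Killed (𝔪 ^ j) E := by
    intro a ha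
    rw [← map_smul, show a • (1 : R ⧸ 𝔪 ^ j) = Ideal.Quotient.mk _ a by
      rw [Algebra.smul_def, mul_one]; rfl, Ideal.Quotient.eq_zero_iff_mem.2 ha, map_zero]
  apply h.ne
  have h1 := LinearMap.congr_fun hθ 1
  simp only [LinearMap.comp_apply, LinearMap.toSpanSingleton_apply, one_smul] at h1
  rw [← h1, ← hr _ hkill, ← map_smul, Algebra.smul_def, mul_one]
  rfl

/-- The evaluation map. -/
noncomputable def evE (R E I : Type u) [CommRing R] [AddCommGroup E] [Module R E] [AddCommGroup I]
    [Module R I] : (E →ₗ[R] I) ⊗[R] E →ₗ[R] I := TensorProduct.lift LinearMap.id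

@[simp] theorem evE_tmul {I : Type u} [AddCommGroup I] [Module R I] (φ : E →ₗ[R] I) (e : E) :
    evE R E I (φ ⊗ₜ e) = φ e := rfl

theorem exists_fin_sum {X Y : Type u} [AddCommGroup X] [Module R X] [AddCommGroup Y] [Module R Y]
    (t : X ⊗[R] Y) : ∃ (n : ℕ) (x : Fin n → X) (y : Fin n → Y), t = ∑ i, x i ⊗ₜ[R] y i := by
  induction t using TensorProduct.induction_on with
  | zero => exact ⟨0, 0, 0, by simp⟩
  | tmul x y => exact ⟨1, fun _ => x, fun _ => y, by simp⟩
  | add s t hs ht =>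
    obtain ⟨n, x, y, rfl⟩ := hs
    obtain ⟨m, x', y', rfl⟩ := ht
    exact ⟨n + m, Fin.append x x', Fin.append y y', by simp [Fin.sum_univ_add]⟩

theorem IsHull.evE_injective [IsNoetherianRing R] (h : IsHull 𝔪 E ε) {I : Type u}
    [AddCommGroup I] [Module R I] (hI : Module.Injective R I) :
    Function.Injective (evE R E I) := by
  classical
  rw [← LinearMap.ker_eq_bot, LinearMap.ker_eq_bot']
  intro t ht
  obtain ⟨n, φ, e, rfl⟩ := exists_fin_sum t
  simp only [map_sum, evE_tmul] at ht
  obtain ⟨q, a, ha, ha'⟩ := exists_relations (R := R) e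
  let Φ : (Fin n → E) →ₗ[R] I := ∑ i, φ i ∘ₗ LinearMap.proj i
  let α : (Fin n → E) →ₗ[R] (Fin q → E) :=
    LinearMap.pi fun k => ∑ i, a k i • LinearMap.proj i
  obtain ⟨θ, hθ⟩ := injective_factor hI α Φ (by
    intro x hx
    have hx' : ∀ k, ∑ i, a k i • x i = 0 := fun k => by
      simpa [α] using congrFun hx k
    obtain ⟨ψ, hψ⟩ := injective_factor h.inj (Fintype.linearCombination R e)
      (Fintype.linearCombination R x) (by
        intro y hy
        simp only [LinearMap.mem_ker, Fintype.linearCombination_apply] at hy ⊢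
        obtain ⟨b, hb⟩ := ha' y hy
        simp_rw [hb, Finset.sum_smul, mul_smul]
        rw [Finset.sum_comm]
        simp_rw [← Finset.smul_sum, hx', smul_zero, Finset.sum_const_zero])
    obtain ⟨j, hj⟩ := h.exists_mem_killed e
    obtain ⟨r, hr⟩ := h.exists_smul ψ j
    have hxe : ∀ i, x i = r • e i := fun i => by
      have := LinearMap.congr_fun hψ (Pi.single i 1)
      simp only [LinearMap.comp_apply, Fintype.linearCombination_apply_single, one_smul] at this
      rw [← this, hr _ (hj i)]
    simp only [LinearMap.mem_ker, Φ, LinearMap.sum_apply, LinearMap.comp_apply,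
      LinearMap.proj_apply, hxe, map_smul]
    rw [← Finset.smul_sum, ht, smul_zero])
  have hφ : ∀ i, φ i = ∑ k, a k i • (θ ∘ₗ LinearMap.single R (fun _ => E) k) := by
    intro i
    ext y
    have h1 := LinearMap.congr_fun hθ (Pi.single i y)
    have h2 : Φ (Pi.single i y) = φ i y := by
      simp only [Φ, LinearMap.sum_apply, LinearMap.comp_apply, LinearMap.proj_apply]
      rw [Finset.sum_eq_single i]
      · simp
      · intro b _ hb; rw [Pi.single_eq_of_ne hb, map_zero]
      · simp
    have h3 : α (Pi.single i y) = fun k => a k i • y := by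
      ext k
      simp only [α, LinearMap.pi_apply, LinearMap.sum_apply, LinearMap.smul_apply,
        LinearMap.proj_apply]
      rw [Finset.sum_eq_single i]
      · simp
      · intro b _ hb; rw [Pi.single_eq_of_ne hb, smul_zero]
      · simp
    rw [LinearMap.comp_apply, h2, h3, ← Finset.univ_sum_single (fun k => a k i • y), map_sum] at h1
    rw [← h1, LinearMap.sum_apply]
    refine Finset.sum_congr rfl fun k _ => ?_
    rw [LinearMap.smul_apply, LinearMap.comp_apply, ← map_smul, ← map_smul]
    rfl
  simp_rw [hφ, TensorProduct.sum_tmul]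
  rw [Finset.sum_comm]
  refine Finset.sum_eq_zero fun k _ => ?_
  simp_rw [TensorProduct.smul_tmul]
  rw [← TensorProduct.tmul_sum, ha, TensorProduct.tmul_zero]

theorem IsHull.mem_range_evE [IsNoetherianRing R] (h : IsHull 𝔪 E ε) [𝔪.IsMaximal] {I : Type u}
    [AddCommGroup I] [Module R I] (hI : Module.Injective R I) {z : I} (hz : z ∈ Gam 𝔪 I) :
    ∃ t, evE R E I t = z := by
  classical
  obtain ⟨j, hj⟩ := hz
  obtain ⟨p, e, he⟩ := Submodule.fg_iff_exists_fin_generating_family.1 (h.fg_killed j)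
  obtain ⟨θ, hθ⟩ := injective_factor hI (LinearMap.toSpanSingleton R (Fin p → E) e)
    (LinearMap.toSpanSingleton R I z) (by
      intro r hr
      refine hj r (h.mem_pow fun x hx => ?_)
      rw [← he] at hx
      induction hx using Submodule.span_induction with
      | mem x hx => obtain ⟨i, rfl⟩ := hx; exact congrFun hr i
      | zero => simp
      | add x y _ _ hx hy => rw [smul_add, hx, hy, add_zero]
      | smul s x _ hx => rw [smul_comm, hx, smul_zero])
  refine ⟨∑ i, (θ ∘ₗ LinearMap.single R (fun _ => E) i) ⊗ₜ e i, ?_⟩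
  have h1 := LinearMap.congr_fun hθ 1
  simp only [LinearMap.comp_apply, LinearMap.toSpanSingleton_apply, one_smul] at h1
  rw [map_sum, ← h1]
  conv_rhs => rw [← Finset.univ_sum_single e, map_sum]
  rfl

theorem IsHull.evE_mem (h : IsHull 𝔪 E ε) {I : Type u} [AddCommGroup I] [Module R I]
    (t : (E →ₗ[R] I) ⊗[R] E) : evE R E I t ∈ Gam 𝔪 I := by
  induction t using TensorProduct.induction_on with
  | zero => rw [map_zero]; exact zero_mem _
  | tmul φ e => rw [evE_tmul]; exact map_mem_Gam φ (h.tors e)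
  | add s t hs ht => rw [map_add]; exact add_mem hs ht

end Hull

end GFD

namespace GFD

open TensorProduct

section Cycles

variable {R : Type u} [CommRing R]

/-- All higher `Ext` into `E^+` vanish. -/
def Acyc (R E X : Type u) [CommRing R] [AddCommGroup E] [Module R E] [AddCommGroup X]
    [Module R X] : Prop := ∀ i : ℕ, EV R (i + 1) X (CharacterModule E)

/-- `X` and its dual into `E^+` are both acyclic. -/
def Bi (R E X : Type u) [CommRing R] [AddCommGroup E] [Module R E] [AddCommGroup X]
    [Module R X] : Prop := Acyc R E X ∧ Acyc R E (Dg R E X)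

variable {E X Y Z U F : Type u} [AddCommGroup E] [Module R E]
  [AddCommGroup X] [Module R X] [AddCommGroup Y] [Module R Y] [AddCommGroup Z] [Module R Z]
  [AddCommGroup U] [Module R U] [AddCommGroup F] [Module R F]

/-- The evaluation map on the dual into `E^+`. -/
noncomputable def evD (R E X : Type u) [CommRing R] [AddCommGroup E] [Module R E]
    [AddCommGroup X] [Module R X] : Dg R E X ⊗[R] E →ₗ[R] CharacterModule X :=
  evE R E (CharacterModule X) ∘ₗ (dgSwap R E X).toLinearMap.rTensor E

theorem evD_tmul (φ : Dg R E X) (e : E) (x : X) : evD R E X (φ ⊗ₜ e) x = φ x e :=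
  dgSwap_apply φ e x

theorem evD_naturality (g : U →ₗ[R] F) (t : Dg R E F ⊗[R] E) :
    evD R E U ((LinearMap.lcomp R (CharacterModule E) g).rTensor E t) =
      CharacterModule.dual g (evD R E F t) := by
  induction t using TensorProduct.induction_on with
  | zero => rw [map_zero, map_zero, map_zero, map_zero]
  | tmul φ e =>
    ext u
    rw [LinearMap.rTensor_tmul, evD_tmul, CharacterModule.dual_apply]
    exact (evD_tmul φ e (g u)).symm
  | add s t hs ht => rw [map_add, map_add, hs, ht, map_add, map_add]

theorem rTensor_lcomp_injective {g : U →ₗ[R] F} (hg : Function.Surjective g)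
    (h : Function.Injective (evD R E F)) :
    Function.Injective ((LinearMap.lcomp R (CharacterModule E) g).rTensor E) := by
  intro s t hst
  apply h
  apply CharacterModule.dual_injective_of_surjective g hg
  rw [← evD_naturality, ← evD_naturality, hst]

variable {𝔪 : Ideal R} {ε : E}

theorem IsHull.evD_injective [IsNoetherianRing R] (h : IsHull 𝔪 E ε) [Module.Flat R F] :
    Function.Injective (evD R E F) := by
  refine (h.evE_injective injective_characterModule).comp ?_
  exact (LinearEquiv.rTensor E (dgSwap R E F)).injective

theorem IsHull.evD_mem (h : IsHull 𝔪 E ε) (t : Dg R E F ⊗[R] E) :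
    evD R E F t ∈ Gam 𝔪 (CharacterModule F) := h.evE_mem _

theorem IsHull.mem_range_evD [IsNoetherianRing R] (h : IsHull 𝔪 E ε) [𝔪.IsMaximal]
    [Module.Flat R F] {z : CharacterModule F} (hz : z ∈ Gam 𝔪 (CharacterModule F)) :
    ∃ t, evD R E F t = z := by
  obtain ⟨t, ht⟩ := h.mem_range_evE injective_characterModule hz
  refine ⟨(LinearEquiv.rTensor E (dgSwap R E F)).symm t, ?_⟩
  rw [← ht]
  exact congrArg (evE R E _) ((LinearEquiv.rTensor E (dgSwap R E F)).apply_symm_apply t)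

theorem Acyc.of_flat [Module.Flat R F] : Acyc R E F := fun i => EV.of_flat i

theorem Bi.of_flat [IsNoetherianRing R] (hE : Module.Injective R E) [Module.Flat R F] :
    Bi R E F := ⟨Acyc.of_flat, have := flat_dg (X := F) hE; Acyc.of_flat⟩

section

variable {F : ℤ → Type u} [∀ i, AddCommGroup (F i)] [∀ i, Module R (F i)]
  {d : (i : ℤ) → F (i + 1) →ₗ[R] F i}

theorem ses_cycle (hd : ∀ i : ℤ, Function.Exact (d (i + 1)) (d i)) (i : ℤ) :
    SES (LinearMap.range (d (i + 1))).subtype (d i).rangeRestrict := by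
  refine ⟨Submodule.subtype_injective _, ?_, LinearMap.surjective_rangeRestrict _⟩
  rw [LinearMap.exact_iff, LinearMap.ker_rangeRestrict, Submodule.range_subtype]
  exact LinearMap.exact_iff.1 (hd i)

theorem acyc_cycle [∀ i, Module.Flat R (F i)] (hd : ∀ i : ℤ, Function.Exact (d (i + 1)) (d i))
    (hE : ∀ i : ℤ, Function.Exact ((d (i + 1)).lTensor E) ((d i).lTensor E)) (i : ℤ) :
    Acyc R E (LinearMap.range (d i)) := by
  intro n
  induction n generalizing i with
  | zero =>
    rw [(ses_cycle hd i).ev_one_iff_rTensor (EV.of_flat 0), ← LinearMap.lTensor_inj_iff_rTensor_inj,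
      ← LinearMap.ker_eq_bot, LinearMap.ker_eq_bot']
    intro t ht
    obtain ⟨s, rfl⟩ := LinearMap.lTensor_surjective E
      (LinearMap.surjective_rangeRestrict (d (i + 1))) t
    rw [← LinearMap.comp_apply, ← LinearMap.lTensor_comp,
      LinearMap.subtype_comp_codRestrict] at ht
    obtain ⟨r, rfl⟩ := (hE _ s).1 ht
    rw [← LinearMap.comp_apply, ← LinearMap.lTensor_comp]
    have : (d (i + 1)).rangeRestrict ∘ₗ d (i + 1 + 1) = 0 := by
      ext x
      exact (hd (i + 1)).apply_apply_eq_zero x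
    rw [this]; simp
  | succ n ih =>
    exact ((ses_cycle hd i).ev_shift (fun i => EV.of_flat i) n).2 (ih (i + 1))

theorem IsHull.evD_cycle_injective [IsNoetherianRing R] [𝔪.IsMaximal] (h : IsHull 𝔪 E ε)
    [∀ i, Module.Flat R (F i)] (hd : ∀ i : ℤ, Function.Exact (d (i + 1)) (d i))
    (hE : ∀ i : ℤ, Function.Exact ((d (i + 1)).lTensor E) ((d i).lTensor E)) (i : ℤ) :
    Function.Injective (evD R E (LinearMap.range (d i))) := by
  obtain ⟨j, rfl⟩ : ∃ j, i = j + 1 := ⟨i - 1, by ring⟩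
  rw [← LinearMap.ker_eq_bot, LinearMap.ker_eq_bot']
  intro t ht
  have hses := (ses_cycle hd j).dg (acyc_cycle hd hE j 0)
  obtain ⟨s, rfl⟩ := LinearMap.rTensor_surjective E hses.surj t
  rw [evD_naturality] at ht
  obtain ⟨L, hL⟩ : ∃ L : List R, 𝔪 = Ideal.span {x : R | x ∈ L} := by
    obtain ⟨S, hS⟩ := IsNoetherian.noetherian 𝔪
    exact ⟨S.toList, by rw [← hS]; simp [Ideal.span]⟩
  have hs := h.evD_mem s
  rw [hL, mem_Gam_span_iff] at hs
  obtain ⟨w, hw, hwL⟩ := gam_exact L (fun i => CharacterModule (F i))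
    (fun i => CharacterModule.dual (d i)) (fun i => injective_characterModule)
    (fun i => dual_exact (hd i)) j (evD R E (F (j + 1)) s) (by
      ext x
      exact DFunLike.congr_fun ht ⟨d (j + 1) x, x, rfl⟩) hs
  rw [← mem_Gam_span_iff, ← hL] at hwL
  obtain ⟨s', rfl⟩ := h.mem_range_evD hwL
  rw [← evD_naturality] at hw
  rw [← h.evD_injective hw, ← LinearMap.comp_apply, ← LinearMap.rTensor_comp]
  have : LinearMap.lcomp R (CharacterModule E) (LinearMap.range (d (j + 1))).subtype ∘ₗ
      LinearMap.lcomp R (CharacterModule E) (d j) = 0 := by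
    ext φ x : 2
    obtain ⟨_, y, rfl⟩ := x
    change φ (d j (d (j + 1) y)) = 0
    rw [(hd j).apply_apply_eq_zero, map_zero]
  rw [this]; simp

theorem IsHull.bi_cycle [IsNoetherianRing R] [𝔪.IsMaximal] (h : IsHull 𝔪 E ε)
    [∀ i, Module.Flat R (F i)] (hd : ∀ i : ℤ, Function.Exact (d (i + 1)) (d i))
    (hE : ∀ i : ℤ, Function.Exact ((d (i + 1)).lTensor E) ((d i).lTensor E)) (i : ℤ) :
    Bi R E (LinearMap.range (d i)) := by
  refine ⟨acyc_cycle hd hE i, ?_⟩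
  intro n
  obtain ⟨j, rfl⟩ : ∃ j, i = j + 1 := ⟨i - 1, by ring⟩
  induction n generalizing j with
  | zero =>
    have := flat_dg (X := F (j + 1)) h.inj
    rw [((ses_cycle hd j).dg (acyc_cycle hd hE j 0)).ev_one_iff_rTensor (EV.of_flat 0)]
    exact rTensor_lcomp_injective (ses_cycle hd j).surj (h.evD_cycle_injective hd hE j)
  | succ n ih =>
    have := flat_dg (X := F (j + 1)) h.inj
    obtain ⟨j, rfl⟩ : ∃ k, j = k + 1 := ⟨j - 1, by ring⟩
    exact (((ses_cycle hd (j + 1)).dg (acyc_cycle hd hE (j + 1) 0)).ev_shift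
      (fun i => EV.of_flat i) n).2 (ih j)

end

end Cycles

end GFD

namespace GFD

open TensorProduct

section Sequences

variable {R : Type u} [CommRing R] {A B X U V K P Q T : Type u}
  [AddCommGroup A] [Module R A] [AddCommGroup B] [Module R B] [AddCommGroup X] [Module R X]
  [AddCommGroup U] [Module R U] [AddCommGroup V] [Module R V] [AddCommGroup K] [Module R K]
  [AddCommGroup P] [Module R P] [AddCommGroup Q] [Module R Q] [AddCommGroup T] [Module R T]

theorem SES.factor {f : X →ₗ[R] U} {g : U →ₗ[R] V} (h : SES f g) (φ : T →ₗ[R] U)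
    (hφ : ∀ t, g (φ t) = 0) : ∃ ψ : T →ₗ[R] X, ∀ t, f (ψ t) = φ t := by
  refine ⟨(LinearEquiv.ofInjective f h.inj).symm.toLinearMap ∘ₗ
    φ.codRestrict _ fun t => (h.exact _).1 (hφ t), fun t => ?_⟩
  have := (LinearEquiv.ofInjective f h.inj).apply_symm_apply
    (φ.codRestrict _ (fun t => (h.exact _).1 (hφ t)) t)
  exact congrArg Subtype.val this

theorem SES.congr_right {f : X →ₗ[R] U} {g : U →ₗ[R] V} (h : SES f g) (e : V ≃ₗ[R] T) :
    SES f (e.toLinearMap ∘ₗ g) :=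
  ⟨h.inj, fun u => by
    rw [← h.exact u]
    exact e.map_eq_zero_iff, e.surjective.comp h.surj⟩

theorem ses_inl_snd : SES (LinearMap.inl R X U) (LinearMap.snd R X U) :=
  ⟨LinearMap.inl_injective, Function.Exact.inl_snd, LinearMap.snd_surjective⟩

theorem ses_inr_fst : SES (LinearMap.inr R X U) (LinearMap.fst R X U) :=
  ⟨LinearMap.inr_injective, Function.Exact.inr_fst, LinearMap.fst_surjective⟩

/-- Comparing a short exact sequence with a projective cover. -/
theorem SES.schanuel {i : A →ₗ[R] B} {g : B →ₗ[R] X} (h : SES i g) {a : K →ₗ[R] P}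
    {p : P →ₗ[R] X} (hp : SES a p) [Module.Projective R P] :
    ∃ (u : K →ₗ[R] P × A) (v : P × A →ₗ[R] B), SES u v := by
  obtain ⟨q, hq⟩ := Module.projective_lifting_property g p h.surj
  have hq' : ∀ y, g (q y) = p y := fun y => LinearMap.congr_fun hq y
  obtain ⟨s, hs⟩ := h.factor (q ∘ₗ a) fun k => by
    rw [LinearMap.comp_apply, hq', hp.comp_zero]
  refine ⟨a.prod (-s), q.coprod i, ?_, ?_, ?_⟩
  · intro x y hxy
    exact hp.inj (congrArg Prod.fst hxy)
  · rintro ⟨y, z⟩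
    constructor
    · intro hyz
      have hyz' : q y + i z = 0 := hyz
      have h1 : p y = 0 := by
        have := congrArg g hyz'
        rwa [map_add, hq', h.comp_zero, add_zero, map_zero] at this
      obtain ⟨k, rfl⟩ := (hp.exact y).1 h1
      refine ⟨k, Prod.ext rfl (h.inj ?_)⟩
      change i (-s k) = i z
      rw [map_neg, hs]
      exact (eq_neg_of_add_eq_zero_right hyz').symm
    · rintro ⟨k, hk⟩
      rw [← hk]
      change q (a k) + i (-s k) = 0
      rw [map_neg, hs, LinearMap.comp_apply, add_neg_cancel]
  · intro b
    obtain ⟨y, hy⟩ := hp.surj (g b)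
    obtain ⟨z, hz⟩ := (h.exact (b - q y)).1 (by rw [map_sub, hq', hy, sub_self])
    refine ⟨(y, z), ?_⟩
    change q y + i z = b
    rw [hz, add_sub_cancel]

/-- The horseshoe lemma. -/
theorem SES.horseshoe {f : X →ₗ[R] U} {g : U →ₗ[R] V} (h : SES f g) {a : K →ₗ[R] P}
    {p : P →ₗ[R] X} (hp : SES a p) {q : Q →ₗ[R] V} (hq : Function.Surjective q)
    [Module.Projective R Q] :
    ∃ (r : P × Q →ₗ[R] U) (f' : K →ₗ[R] LinearMap.ker r)
      (g' : LinearMap.ker r →ₗ[R] LinearMap.ker q),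
      Function.Surjective r ∧ SES f' g' := by
  obtain ⟨t, ht⟩ := Module.projective_lifting_property g q h.surj
  have ht' : ∀ y, g (t y) = q y := fun y => LinearMap.congr_fun ht y
  have hker : ∀ z : P × Q, ((f ∘ₗ p).coprod t) z = 0 → q z.2 = 0 := by
    rintro ⟨y, z⟩ hyz
    have hyz' : f (p y) + t z = 0 := hyz
    have := congrArg g hyz'
    rwa [map_add, h.comp_zero, zero_add, ht', map_zero] at this
  refine ⟨(f ∘ₗ p).coprod t, LinearMap.codRestrict _ (LinearMap.inl R P Q ∘ₗ a) ?_,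
    LinearMap.codRestrict _ (LinearMap.snd R P Q ∘ₗ Submodule.subtype _) ?_, ?_, ?_, ?_, ?_⟩
  · intro k
    change f (p (a k)) + t 0 = 0
    rw [hp.comp_zero, map_zero, map_zero, add_zero]
  · exact fun z => hker z.1 z.2
  · intro u
    obtain ⟨z, hz⟩ := hq (g u)
    obtain ⟨x, hx⟩ := (h.exact (u - t z)).1 (by rw [map_sub, ht', hz, sub_self])
    obtain ⟨y, rfl⟩ := hp.surj x
    refine ⟨(y, z), ?_⟩
    change f (p y) + t z = u
    rw [hx, sub_add_cancel]
  · intro x y hxy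
    exact hp.inj (congrArg Prod.fst (congrArg Subtype.val hxy))
  · rintro ⟨⟨y, z⟩, hyz⟩
    constructor
    · intro hz
      obtain rfl : z = 0 := congrArg Subtype.val hz
      have h1 : f (p y) + t 0 = 0 := hyz
      rw [map_zero, add_zero] at h1
      obtain ⟨k, hk⟩ := (hp.exact y).1 (h.inj (h1.trans (map_zero f).symm))
      exact ⟨k, Subtype.ext (Prod.ext hk rfl)⟩
    · rintro ⟨k, hk⟩
      apply Subtype.ext
      exact (congrArg Prod.snd (congrArg Subtype.val hk)).symm
  · rintro ⟨z, hz⟩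
    obtain ⟨x, hx⟩ := (h.exact (t z)).1 (by rw [ht']; exact hz)
    obtain ⟨y, hy⟩ := hp.surj (-x)
    refine ⟨⟨(y, z), ?_⟩, rfl⟩
    change f (p y) + t z = 0
    rw [hy, map_neg, hx, neg_add_cancel]

/-- Composing a projective cover of the middle term with the projection. -/
theorem SES.ker_comp {f : X →ₗ[R] U} {g : U →ₗ[R] V} (h : SES f g) {a : K →ₗ[R] P}
    {p : P →ₗ[R] U} (hp : SES a p) :
    ∃ (u : K →ₗ[R] LinearMap.ker (g ∘ₗ p)) (v : LinearMap.ker (g ∘ₗ p) →ₗ[R] X), SES u v := by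
  obtain ⟨v, hv⟩ := h.factor (p ∘ₗ (LinearMap.ker (g ∘ₗ p)).subtype) fun t => t.2
  refine ⟨a.codRestrict _ fun k => by simp [hp.comp_zero], v, ?_, ?_, ?_⟩
  · intro x y hxy
    exact hp.inj (congrArg Subtype.val hxy)
  · intro y
    constructor
    · intro hy
      have h1 : p y = 0 := by
        have := hv y
        rw [hy, map_zero] at this
        exact this.symm
      obtain ⟨k, hk⟩ := (hp.exact _).1 h1
      exact ⟨k, Subtype.ext hk⟩
    · rintro ⟨k, rfl⟩
      exact h.inj ((hv _).trans ((hp.comp_zero k).trans (map_zero f).symm))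
  · intro x
    obtain ⟨y, hy⟩ := hp.surj (f x)
    refine ⟨⟨y, ?_⟩, h.inj ?_⟩
    · rw [LinearMap.mem_ker, LinearMap.comp_apply, hy, h.comp_zero]
    · rw [hv]; exact hy

theorem flat_of_ev (h : ∀ (V : Type u) [AddCommGroup V] [Module R V],
    EV R 1 X (CharacterModule V)) : Module.Flat R X := by
  rw [Module.Flat.iff_lTensor_injective']
  intro I
  exact (SES.ofSub I).ev_one_dual_iff.1 (h (R ⧸ I))

theorem SES.flat {f : X →ₗ[R] U} {g : U →ₗ[R] V} (h : SES f g) [Module.Flat R U]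
    [Module.Flat R V] : Module.Flat R X :=
  flat_of_ev fun _ _ _ => h.ev_left (EV.of_flat 0) (EV.of_flat 1)

end Sequences

section Good

variable {R E : Type u} [CommRing R] [AddCommGroup E] [Module R E]
variable {X Y U V K P : Type u} [AddCommGroup X] [Module R X]
  [AddCommGroup Y] [Module R Y]
  [AddCommGroup U] [Module R U] [AddCommGroup V] [Module R V] [AddCommGroup K] [Module R K]
  [AddCommGroup P] [Module R P]

theorem Bi.congr (e : X ≃ₗ[R] Y) (h : Bi R E X) : Bi R E Y :=
  ⟨fun i => (h.1 i).congr_left e,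
    fun i => (h.2 i).congr_left (LinearEquiv.congrLeft (CharacterModule E) R e)⟩

theorem Bi.ext {f : X →ₗ[R] U} {g : U →ₗ[R] V} (h : SES f g) (hX : Bi R E X) (hV : Bi R E V) :
    Bi R E U :=
  ⟨fun i => h.ev_mid (hX.1 i) (hV.1 i),
    fun i => (h.dg (hV.1 0)).ev_mid (hV.2 i) (hX.2 i)⟩

/-- `X` and its first `n` syzygies are bi-acyclic. -/
def GN (R E : Type u) [CommRing R] [AddCommGroup E] [Module R E] :
    ℕ → (X : Type u) → [AddCommGroup X] → [Module R X] → Prop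
  | 0, X, _, _ => Bi R E X
  | n + 1, X, _, _ => Bi R E X ∧ ∀ (K P : Type u) [AddCommGroup K] [Module R K] [AddCommGroup P]
      [Module R P] (f : K →ₗ[R] P) (g : P →ₗ[R] X), Module.Projective R P → SES f g → GN R E n K

theorem GN.bi {n : ℕ} (h : GN R E n X) : Bi R E X := by
  cases n with
  | zero => exact h
  | succ n => exact h.1

theorem GN.congr {n : ℕ} (e : X ≃ₗ[R] Y) (h : GN R E n X) : GN R E n Y := by
  cases n with
  | zero => exact Bi.congr e h
  | succ n =>
    exact ⟨Bi.congr e h.1, fun K P _ _ _ _ f g hP hs => h.2 K P f _ hP (hs.congr_right e.symm)⟩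

theorem GN.of_flat [IsNoetherianRing R] (hE : Module.Injective R E) (n : ℕ) [Module.Flat R X] :
    GN R E n X := by
  induction n generalizing X with
  | zero => exact Bi.of_flat hE
  | succ n ih =>
    exact ⟨Bi.of_flat hE, fun K P _ _ _ _ f g hP hs => by
      have := hs.flat
      exact ih⟩

/-- Modules all of whose syzygies are bi-acyclic. -/
def Good (R E X : Type u) [CommRing R] [AddCommGroup E] [Module R E] [AddCommGroup X]
    [Module R X] : Prop := ∀ n, GN R E n X

theorem Good.ker {f : K →ₗ[R] P} {g : P →ₗ[R] X} (h : Good R E X) (hP : Module.Projective R P)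
    (hs : SES f g) : Good R E K := fun n => (h (n + 1)).2 _ _ _ _ hP hs

/-- Modules of good dimension at most `n`. -/
def FD (R E : Type u) [CommRing R] [AddCommGroup E] [Module R E] :
    ℕ → (X : Type u) → [AddCommGroup X] → [Module R X] → Prop
  | 0, X, _, _ => Good R E X
  | n + 1, X, _, _ => ∀ (K P : Type u) [AddCommGroup K] [Module R K] [AddCommGroup P]
      [Module R P] (f : K →ₗ[R] P) (g : P →ₗ[R] X), Module.Projective R P → SES f g → FD R E n K

theorem FD.congr {n : ℕ} (e : X ≃ₗ[R] Y) (h : FD R E n X) : FD R E n Y := by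
  cases n with
  | zero => exact fun n => (h n).congr e
  | succ n =>
    exact fun K P _ _ _ _ f g hP hs => h K P f _ hP (hs.congr_right e.symm)

theorem FD.succ {n : ℕ} (h : FD R E n X) : FD R E (n + 1) X := by
  induction n generalizing X with
  | zero => exact fun K P _ _ _ _ f g hP hs => Good.ker h hP hs
  | succ n ih => exact fun K P _ _ _ _ f g hP hs => ih (h K P f g hP hs)

theorem FD.mono {n m : ℕ} (hnm : n ≤ m) (h : FD R E n X) : FD R E m X := by
  induction hnm with
  | refl => exact h
  | step _ ih => exact ih.succ

variable {𝔪 : Ideal R} {ε : E} [IsNoetherianRing R]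

theorem GN.evD_injective (hE : IsHull 𝔪 E ε) (h : GN R E 1 X) : Function.Injective (evD R E X) := by
  have hs := SES.freeCover (R := R) (X := X)
  have hB : Bi R E (LinearMap.ker (freeCover R X)) := h.2 _ _ _ _ inferInstance hs
  have := flat_dg (X := X →₀ R) hE.inj
  have h1 := ((hs.dg (h.bi.1 0)).ev_one_iff_rTensor (EV.of_flat 0)).1 (hB.2 0)
  have h2 : Function.Injective (evD R E (X →₀ R) ∘
    (LinearMap.lcomp R (CharacterModule E) (freeCover R X)).rTensor E) :=
    hE.evD_injective.comp h1
  intro s t hst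
  apply h2
  rw [Function.comp_apply, Function.comp_apply, evD_naturality, evD_naturality, hst]

theorem Bi.of_ker (hE : IsHull 𝔪 E ε) {f : X →ₗ[R] U} {g : U →ₗ[R] V} (h : SES f g)
    (hU : Bi R E U) (hV : GN R E 1 V) : Bi R E X := by
  refine ⟨fun i => h.ev_left (hU.1 i) (hV.bi.1 (i + 1)), ?_⟩
  have h' := h.dg (E := E) (hV.bi.1 0)
  intro i
  cases i with
  | zero =>
    rw [h'.ev_one_iff_rTensor (hU.2 0)]
    exact rTensor_lcomp_injective h.surj (hV.evD_injective hE)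
  | succ i => exact h'.ev_right (hV.bi.2 i) (hU.2 (i + 1))

theorem GN.of_ker (hE : IsHull 𝔪 E ε) {n : ℕ} {f : X →ₗ[R] U} {g : U →ₗ[R] V} (h : SES f g)
    (hU : GN R E n U) (hV : GN R E (n + 1) V) : GN R E n X := by
  induction n generalizing X U V with
  | zero => exact Bi.of_ker hE h hU hV
  | succ n ih =>
    refine ⟨Bi.of_ker hE h hU.bi ⟨hV.bi, fun K P _ _ _ _ f g hP hs => (hV.2 K P f g hP hs).bi⟩,
      fun K P _ _ _ _ a p hP hs => ?_⟩
    obtain ⟨r, f', g', hr, hs'⟩ := h.horseshoe hs (q := freeCover R V) freeCover_surjective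
    exact ih hs' (hU.2 _ _ _ _ inferInstance (SES.ofSurj r hr))
      (hV.2 _ _ _ _ inferInstance SES.freeCover)

theorem GN.ext (hE : IsHull 𝔪 E ε) {n : ℕ} {f : X →ₗ[R] U} {g : U →ₗ[R] V} (h : SES f g)
    (hX : GN R E n X) (hV : GN R E n V) : GN R E n U := by
  induction n generalizing X U V with
  | zero => exact Bi.ext h hX hV
  | succ n ih =>
    refine ⟨Bi.ext h hX.bi hV.bi, fun K P _ _ _ _ a p hP hs => ?_⟩
    obtain ⟨u, v, huv⟩ := h.ker_comp hs
    obtain ⟨u', v', huv'⟩ := huv.schanuel (SES.freeCover (R := R) (X := X))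
    have h1 : GN R E n (LinearMap.ker (g ∘ₗ p)) :=
      hV.2 _ _ _ _ hP (SES.ofSurj (g ∘ₗ p) (h.surj.comp hs.surj))
    have h2 : GN R E n ((X →₀ R) × K) :=
      ih huv' (hX.2 _ _ _ _ inferInstance SES.freeCover) h1
    exact GN.of_ker hE (ses_inr_fst (X := X →₀ R)) h2 (GN.of_flat hE.inj _)

theorem Good.of_flat (hE : Module.Injective R E) [Module.Flat R X] : Good R E X :=
  fun n => GN.of_flat hE n

theorem FD.of_flat (hE : Module.Injective R E) (n : ℕ) [Module.Flat R X] : FD R E n X :=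
  FD.mono (Nat.zero_le n) (Good.of_flat hE)

theorem FD.of_ker (hE : IsHull 𝔪 E ε) {n : ℕ} {f : X →ₗ[R] U} {g : U →ₗ[R] V} (h : SES f g)
    (hU : FD R E n U) (hV : FD R E n V) : FD R E n X := by
  induction n generalizing X U V with
  | zero => exact fun n => GN.of_ker hE h (hU n) (hV (n + 1))
  | succ n ih =>
    intro K P _ _ _ _ a p hP hs
    obtain ⟨r, f', g', hr, hs'⟩ := h.horseshoe hs (q := freeCover R V) freeCover_surjective
    exact ih hs' (hU _ _ _ _ inferInstance (SES.ofSurj r hr))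
      (hV _ _ _ _ inferInstance SES.freeCover)

theorem FD.ext (hE : IsHull 𝔪 E ε) {n : ℕ} {f : X →ₗ[R] U} {g : U →ₗ[R] V} (h : SES f g)
    (hX : FD R E n X) (hV : FD R E n V) : FD R E n U := by
  induction n generalizing X U V with
  | zero => exact fun n => GN.ext hE h (hX n) (hV n)
  | succ n ih =>
    intro K P _ _ _ _ a p hP hs
    obtain ⟨u, v, huv⟩ := h.ker_comp hs
    obtain ⟨u', v', huv'⟩ := huv.schanuel (SES.freeCover (R := R) (X := X))
    have h1 : FD R E n (LinearMap.ker (g ∘ₗ p)) :=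
      hV _ _ _ _ hP (SES.ofSurj (g ∘ₗ p) (h.surj.comp hs.surj))
    have h2 : FD R E n ((X →₀ R) × K) :=
      ih huv' (hX _ _ _ _ inferInstance SES.freeCover) h1
    exact FD.of_ker hE (ses_inr_fst (X := X →₀ R)) h2 (FD.of_flat hE.inj _)

theorem FD.of_coker (hE : IsHull 𝔪 E ε) {n : ℕ} {f : X →ₗ[R] U} {g : U →ₗ[R] V} (h : SES f g)
    (hX : FD R E n X) (hU : FD R E n U) : FD R E (n + 1) V := by
  intro K P _ _ _ _ a p hP hs
  obtain ⟨u, v, huv⟩ := h.schanuel hs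
  exact FD.of_ker hE huv (FD.ext hE ses_inl_snd (FD.of_flat hE.inj n) hX) hU

theorem FD.bi (hE : Module.Injective R E) {n : ℕ} (h : FD R E n X) (hX : Acyc R E X) :
    Good R E X := by
  induction n generalizing X with
  | zero => exact h
  | succ n ih =>
    have key : ∀ (K P : Type u) [AddCommGroup K] [Module R K] [AddCommGroup P]
      [Module R P] (f : K →ₗ[R] P) (g : P →ₗ[R] X), Module.Projective R P → SES f g →
        Good R E K := fun K P _ _ _ _ f g hP hs => ih (h K P f g hP hs) fun i =>
          hs.ev_left (EV.of_projective i) (hX (i + 1))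
    have hB : Bi R E X := by
      have hs := SES.freeCover (R := R) (X := X)
      have hK := key _ _ _ _ inferInstance hs
      have := flat_dg (X := X →₀ R) hE
      exact ⟨hX, fun i => (hs.dg (hX 0)).ev_left (EV.of_flat i) ((hK 0).bi.2 (i + 1))⟩
    intro m
    cases m with
    | zero => exact hB
    | succ m => exact ⟨hB, fun K P _ _ _ _ f g hP hs => key K P f g hP hs m⟩

/-- Cycles in suitable exact complexes of flat modules are good. -/
theorem IsHull.good_cycle [𝔪.IsMaximal] (h : IsHull 𝔪 E ε) {F : ℤ → Type u}
    [∀ i, AddCommGroup (F i)] [∀ i, Module R (F i)] {d : (i : ℤ) → F (i + 1) →ₗ[R] F i}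
    [∀ i, Module.Flat R (F i)] (hd : ∀ i : ℤ, Function.Exact (d (i + 1)) (d i))
    (hE : ∀ i : ℤ, Function.Exact ((d (i + 1)).lTensor E) ((d i).lTensor E)) (i : ℤ) :
    Good R E (LinearMap.range (d i)) := by
  intro n
  induction n generalizing i with
  | zero => exact h.bi_cycle hd hE i
  | succ n ih =>
    refine ⟨h.bi_cycle hd hE i, fun K P _ _ _ _ f g hP hs => ?_⟩
    obtain ⟨u, v, huv⟩ := (ses_cycle hd i).schanuel hs
    exact GN.of_ker h huv (GN.ext h ses_inl_snd (GN.of_flat h.inj n) (ih (i + 1)))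
      (GN.of_flat h.inj (n + 1))

theorem ev_one_symm : EV R 1 X (CharacterModule Y) ↔ EV R 1 Y (CharacterModule X) := by
  rw [(SES.freeCover (R := R) (X := Y)).ev_one_dual_iff,
    (SES.freeCover (R := R) (X := Y)).ev_one_iff_rTensor (EV.of_flat 0),
    LinearMap.lTensor_inj_iff_rTensor_inj]

/-- Modules that are flat with respect to `𝔪`-torsion modules. -/
def TorsFlat (𝔪 : Ideal R) (X : Type u) [AddCommGroup X] [Module R X] : Prop :=
  ∀ (V : Type u) [AddCommGroup V] [Module R V], (∀ v : V, v ∈ Gam 𝔪 V) →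
    ∀ i : ℕ, EV R (i + 1) X (CharacterModule V)

theorem TorsFlat.injective_gam (h : TorsFlat 𝔪 X) :
    Module.Injective R (Gam 𝔪 (CharacterModule X)) := by
  refine injective_Gam_of_extend 𝔪 fun N b φ hφ => ?_
  let b' : Submodule R (R ⧸ 𝔪 ^ N) := Submodule.map (𝔪 ^ N).mkQ b
  have hev : EV R 1 ((R ⧸ 𝔪 ^ N) ⧸ b') (CharacterModule X) := by
    rw [← ev_one_symm]
    refine h _ (fun v => ⟨N, fun a ha => ?_⟩) 0
    obtain ⟨w, rfl⟩ := Submodule.Quotient.mk_surjective _ v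
    obtain ⟨y, rfl⟩ := Submodule.Quotient.mk_surjective _ w
    rw [← Submodule.Quotient.mk_smul, ← Submodule.Quotient.mk_smul, smul_eq_mul,
      (Submodule.Quotient.mk_eq_zero (𝔪 ^ N)).2 (Ideal.mul_mem_right _ _ ha),
      Submodule.Quotient.mk_zero]
  have hb' : ∀ y : b, (𝔪 ^ N).mkQ y.1 ∈ b' := fun y => ⟨y, y.2, rfl⟩
  let q : b →ₗ[R] b' := ((𝔪 ^ N).mkQ ∘ₗ b.subtype).codRestrict b' hb'
  have hq : Function.Surjective q := by
    rintro ⟨_, y, hy, rfl⟩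
    exact ⟨⟨y, hy⟩, rfl⟩
  have hker : LinearMap.ker q ≤ LinearMap.ker φ := by
    intro y hy
    exact hφ y ((Submodule.Quotient.mk_eq_zero (𝔪 ^ N)).1 (congrArg Subtype.val hy))
  let φ' : b' →ₗ[R] CharacterModule X :=
    (LinearMap.ker q).liftQ φ hker ∘ₗ (q.quotKerEquivOfSurjective hq).symm.toLinearMap
  have hφ' : ∀ y, φ' (q y) = φ y := fun y => by
    have : (q.quotKerEquivOfSurjective hq).symm (q y) = Submodule.Quotient.mk y := by
      rw [LinearEquiv.symm_apply_eq]; rfl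
    simp [φ', this]
  obtain ⟨θ, hθ⟩ := (SES.ofSub b').extend hev φ'
  refine ⟨θ, fun y => ?_⟩
  rw [← hφ', ← hθ]
  rfl

theorem TorsFlat.flat_dg (hE : IsHull 𝔪 E ε) (h : TorsFlat 𝔪 X) : Module.Flat R (Dg R E X) := by
  have := flat_hom_injective hE.inj h.injective_gam
  let e : (E →ₗ[R] Gam 𝔪 (CharacterModule X)) ≃ₗ[R] (E →ₗ[R] CharacterModule X) :=
    { toFun := fun φ => (Gam 𝔪 (CharacterModule X)).subtype ∘ₗ φ
      map_add' := fun _ _ => rfl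
      map_smul' := fun _ _ => rfl
      invFun := fun φ => φ.codRestrict _ fun x => map_mem_Gam φ (hE.tors x)
      left_inv := fun _ => rfl
      right_inv := fun _ => rfl }
  exact Module.Flat.of_linearEquiv (dgSwap R E X ≪≫ₗ e.symm)

theorem TorsFlat.good (hE : IsHull 𝔪 E ε) (h : TorsFlat 𝔪 X) : Good R E X := by
  intro n
  induction n generalizing X with
  | zero => exact ⟨fun i => h E hE.tors i, have := h.flat_dg hE; Acyc.of_flat⟩
  | succ n ih =>
    exact ⟨⟨fun i => h E hE.tors i, have := h.flat_dg hE; Acyc.of_flat⟩,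
      fun K P _ _ _ _ f g hP hs => ih fun V _ _ hV i =>
        hs.ev_left (EV.of_projective i) (h V hV (i + 1))⟩

end Good

end GFD

namespace GFD

open TensorProduct

section BaseChange

variable {R R1 : Type u} [CommRing R] [CommRing R1] [Algebra R R1]

theorem SES.baseChange [Module.Flat R R1] {X U V : Type u} [AddCommGroup X] [Module R X]
    [AddCommGroup U] [Module R U] [AddCommGroup V] [Module R V] {f : X →ₗ[R] U} {g : U →ₗ[R] V}
    (h : SES f g) : SES (f.baseChange R1) (g.baseChange R1) where
  inj := Module.Flat.lTensor_preserves_injective_linearMap f h.inj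
  exact := lTensor_exact R1 h.exact h.surj
  surj := LinearMap.lTensor_surjective R1 h.surj

theorem injective_restrict [Module.Flat R R1] {E : Type u} [AddCommGroup E] [Module R E]
    [Module R1 E] [IsScalarTower R R1 E] (hE : Module.Injective R1 E) : Module.Injective R E :=
  ⟨fun X Y _ _ _ _ f hf g => by
    obtain ⟨k, hk⟩ := hE.out (f.baseChange R1)
      (Module.Flat.lTensor_preserves_injective_linearMap f hf)
      (LinearMap.liftBaseChange R1 g)
    refine ⟨(k.restrictScalars R) ∘ₗ (TensorProduct.mk R R1 Y 1), fun x => ?_⟩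
    have := hk (1 ⊗ₜ x)
    simpa using this⟩

theorem exact_cancel {X Y Z E : Type u} [AddCommGroup X] [Module R X] [AddCommGroup Y]
    [Module R Y] [AddCommGroup Z] [Module R Z] [AddCommGroup E] [Module R E] [Module R1 E]
    [IsScalarTower R R1 E] {f : X →ₗ[R] Y} {g : Y →ₗ[R] Z}
    (h : Function.Exact (f.lTensor E) (g.lTensor E)) :
    Function.Exact ((f.baseChange R1).lTensor E) ((g.baseChange R1).lTensor E) := by
  have key : ∀ {X Y : Type u} [AddCommGroup X] [Module R X] [AddCommGroup Y] [Module R Y]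
      (f : X →ₗ[R] Y), ⇑(f.lTensor E) ∘ ⇑(AlgebraTensorModule.cancelBaseChange R R1 R1 E X) =
      ⇑(AlgebraTensorModule.cancelBaseChange R R1 R1 E Y) ∘ ⇑((f.baseChange R1).lTensor E) := by
    intro X Y _ _ _ _ f
    have : (AlgebraTensorModule.lTensor R1 E f) ∘ₗ
        (AlgebraTensorModule.cancelBaseChange R R1 R1 E X).toLinearMap =
      (AlgebraTensorModule.cancelBaseChange R R1 R1 E Y).toLinearMap ∘ₗ
        (f.baseChange R1).lTensor E := by
      ext; simp
    exact congrArg DFunLike.coe this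
  intro y
  have kf := congrFun (key f)
  have kg := congrFun (key g)
  simp only [Function.comp_apply] at kf kg
  have h0 : (g.baseChange R1).lTensor E y = 0 ↔
      (g.lTensor E) (AlgebraTensorModule.cancelBaseChange R R1 R1 E Y y) = 0 := by
    rw [kg, LinearEquiv.map_eq_zero_iff]
  rw [h0, h]
  constructor
  · rintro ⟨t, ht⟩
    refine ⟨(AlgebraTensorModule.cancelBaseChange R R1 R1 E X).symm t, ?_⟩
    apply (AlgebraTensorModule.cancelBaseChange R R1 R1 E Y).injective
    rw [← kf, LinearEquiv.apply_symm_apply, ht]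
  · rintro ⟨t, ht⟩
    exact ⟨AlgebraTensorModule.cancelBaseChange R R1 R1 E X t, by rw [kf, ht]⟩

variable [IsNoetherianRing R1] [Module.Flat R R1] {𝔪 : Ideal R1} [𝔪.IsMaximal] {E : Type u}
  [AddCommGroup E] [Module R1 E] {ε : E}

theorem IsHull.good_baseChange (hE : IsHull 𝔪 E ε) {Q : Type u} [AddCommGroup Q] [Module R Q]
    (hQ : IsGorensteinFlat R Q) : Good R1 E (R1 ⊗[R] Q) := by
  obtain ⟨F, d, hfl, hex, hext, ⟨e⟩⟩ := hQ
  let _ : Module R E := Module.compHom E (algebraMap R R1)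
  have : IsScalarTower R R1 E := ⟨fun a b c => by
    rw [Algebra.smul_def, mul_smul]; rfl⟩
  have := hE.good_cycle (F := fun i => R1 ⊗[R] F i) (d := fun i => (d i).baseChange R1)
    (fun i => Module.Flat.lTensor_exact R1 (hex i))
    (fun i => exact_cancel (hext E (injective_restrict hE.inj) i)) 0
  refine fun n => GN.congr ?_ (this n)
  have h1 : LinearMap.range ((LinearMap.range (d 0)).subtype.baseChange R1) =
      LinearMap.range ((d 0).baseChange R1) := by
    have : (d 0).baseChange R1 =
        (LinearMap.range (d 0)).subtype.baseChange R1 ∘ₗ (d 0).rangeRestrict.baseChange R1 := by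
      rw [← LinearMap.baseChange_comp]; rfl
    rw [this, LinearMap.range_comp_of_range_eq_top]
    exact LinearMap.range_eq_top.mpr
      (LinearMap.lTensor_surjective R1 (d 0).surjective_rangeRestrict)
  have e1 := LinearEquiv.ofInjective ((LinearMap.range (d 0)).subtype.baseChange R1)
    (Module.Flat.lTensor_preserves_injective_linearMap _ (Submodule.subtype_injective _))
  exact (LinearEquiv.ofEq _ _ h1.symm).trans (e1.symm.trans (e.baseChange R R1 _ _).symm)

end BaseChange

/-- After every flat base change, `M` has finite good dimension and its Ext modules into the
dual of the hull vanish above `c`. -/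
def HG (R M : Type u) [CommRing R] [AddCommGroup M] [Module R M] (c : ℕ) : Prop :=
  ∀ (R1 : Type u) [CommRing R1] [IsNoetherianRing R1] [Algebra R R1] [Module.Flat R R1]
    (𝔪 : Ideal R1) [𝔪.IsMaximal] (E : Type u) [AddCommGroup E] [Module R1 E] (ε : E),
    IsHull 𝔪 E ε → (∃ n, FD R1 E n (R1 ⊗[R] M)) ∧
      ∀ i, c < i → EV R1 i (R1 ⊗[R] M) (CharacterModule E)

/-- After every flat base change, the Ext modules of `M` into dual modules vanish above `p`. -/
def HF (R M : Type u) [CommRing R] [AddCommGroup M] [Module R M] (p : ℕ) : Prop :=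
  ∀ (R1 : Type u) [CommRing R1] [Algebra R R1] [Module.Flat R R1]
    (V : Type u) [AddCommGroup V] [Module R1 V],
      ∀ i, p < i → EV R1 i (R1 ⊗[R] M) (CharacterModule V)

section Bounds

variable {R M : Type u} [CommRing R] [AddCommGroup M] [Module R M]

theorem HG.of_gfdLE {c : ℕ} (h : gfdLE R c M) : HG R M c := by
  induction c generalizing M with
  | zero =>
    intro R1 _ _ _ _ 𝔪 _ E _ _ ε hE
    have hg := hE.good_baseChange (R := R) (Q := M) h
    refine ⟨⟨0, hg⟩, fun i hi => ?_⟩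
    obtain ⟨i, rfl⟩ := Nat.exists_eq_succ_of_ne_zero hi.ne'
    exact (hg 0).bi.1 i
  | succ c ih =>
    obtain ⟨⟨Q, π, hQ, hπ⟩, hk⟩ := h
    intro R1 _ _ _ _ 𝔪 _ E _ _ ε hE
    obtain ⟨⟨n, hn⟩, hi⟩ := ih hk R1 𝔪 E ε hE
    have hg := hE.good_baseChange (R := R) (Q := Q) hQ
    have hs := (SES.ofSurj π hπ).baseChange (R1 := R1)
    have hg' : FD R1 E n (R1 ⊗[R] Q) := FD.mono (Nat.zero_le n) (show FD R1 E 0 _ from hg)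
    refine ⟨⟨n + 1, FD.of_coker hE hs hn hg'⟩, fun i hic => ?_⟩
    obtain ⟨i, rfl⟩ := Nat.exists_eq_succ_of_ne_zero (Nat.ne_of_gt (Nat.zero_lt_of_lt hic))
    exact hs.ev_right (hi i (by omega)) ((hg 0).bi.1 i)

theorem HF.of_fdLE {p : ℕ} (h : fdLE R p M) : HF R M p := by
  induction p generalizing M with
  | zero =>
    intro R1 _ _ _ V _ _ i hi
    have : Module.Flat R M := h
    obtain ⟨i, rfl⟩ := Nat.exists_eq_succ_of_ne_zero hi.ne'
    exact EV.of_flat i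
  | succ c ih =>
    obtain ⟨⟨Q, π, hQ, hπ⟩, hk⟩ := h
    intro R1 _ _ _ V _ _ i hic
    obtain ⟨i, rfl⟩ := Nat.exists_eq_succ_of_ne_zero (Nat.ne_of_gt (Nat.zero_lt_of_lt hic))
    exact ((SES.ofSurj π hπ).baseChange (R1 := R1)).ev_right
      (ih hk R1 V i (by omega)) (EV.of_flat i)

end Bounds

end GFD

namespace GFD

open TensorProduct Polynomial

section PolyStep

variable {R M : Type u} [CommRing R] [AddCommGroup M] [Module R M] [Module R[X] M]
  [IsScalarTower R R[X] M]

/-- `X ⊗ 1 - 1 ⊗ X` on `R[X] ⊗ M`. -/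
noncomputable def polyDiff (R M : Type u) [CommRing R] [AddCommGroup M] [Module R M]
    [Module R[X] M] [IsScalarTower R R[X] M] : R[X] ⊗[R] M →ₗ[R[X]] R[X] ⊗[R] M :=
  (X : R[X]) • LinearMap.id - (Algebra.lsmul R R M (X : R[X])).baseChange R[X]

/-- The multiplication map `R[X] ⊗ M → M`. -/
noncomputable def polyEval (R M : Type u) [CommRing R] [AddCommGroup M] [Module R M]
    [Module R[X] M] [IsScalarTower R R[X] M] : R[X] ⊗[R] M →ₗ[R[X]] M :=
  LinearMap.liftBaseChange R[X] LinearMap.id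

/-- The coefficients of an element of `R[X] ⊗ M`. -/
noncomputable def polyCoeff (R M : Type u) [CommRing R] [AddCommGroup M] [Module R M] (i : ℕ) :
    R[X] ⊗[R] M →ₗ[R] M :=
  TensorProduct.lid R M ∘ₗ (lcoeff R i).rTensor M

theorem polyDiff_tmul (p : R[X]) (m : M) :
    polyDiff R M (p ⊗ₜ m) = (X * p) ⊗ₜ m - p ⊗ₜ ((X : R[X]) • m) := by
  simp [polyDiff, smul_tmul']

theorem polyEval_tmul (p : R[X]) (m : M) : polyEval R M (p ⊗ₜ m) = p • m := by
  simp [polyEval]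

theorem polyCoeff_tmul (i : ℕ) (p : R[X]) (m : M) :
    polyCoeff R M i (p ⊗ₜ m) = p.coeff i • m := by
  simp [polyCoeff]

theorem polyCoeff_polyDiff (i : ℕ) (t : R[X] ⊗[R] M) :
    polyCoeff R M (i + 1) (polyDiff R M t) =
      polyCoeff R M i t - (X : R[X]) • polyCoeff R M (i + 1) t := by
  induction t with
  | zero => simp
  | add a b ha hb => rw [map_add, map_add, ha, hb, map_add, map_add, smul_add]; abel
  | tmul p m =>
    rw [polyDiff_tmul, map_sub]
    simp only [polyCoeff_tmul, coeff_X_mul]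
    rw [smul_comm]

theorem exists_polyCoeff_sum (t : R[X] ⊗[R] M) : ∃ N : ℕ, ∀ n, N ≤ n →
    polyCoeff R M n t = 0 ∧ t = ∑ i ∈ Finset.range n, (X ^ i : R[X]) ⊗ₜ[R] polyCoeff R M i t := by
  induction t with
  | zero => exact ⟨0, fun n _ => by simp⟩
  | add a b ha hb =>
    obtain ⟨N, hN⟩ := ha
    obtain ⟨N', hN'⟩ := hb
    refine ⟨max N N', fun n hn => ?_⟩
    obtain ⟨h1, h2⟩ := hN n (le_trans (le_max_left _ _) hn)
    obtain ⟨h3, h4⟩ := hN' n (le_trans (le_max_right _ _) hn)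
    refine ⟨by rw [map_add, h1, h3, add_zero], ?_⟩
    simp only [map_add, tmul_add, Finset.sum_add_distrib]
    rw [← h2, ← h4]
  | tmul p m =>
    refine ⟨p.natDegree + 1, fun n hn => ⟨?_, ?_⟩⟩
    · rw [polyCoeff_tmul, coeff_eq_zero_of_natDegree_lt (by omega), zero_smul]
    · conv_lhs => rw [p.as_sum_range' n (by omega), sum_tmul]
      refine Finset.sum_congr rfl fun i _ => ?_
      rw [polyCoeff_tmul, ← smul_tmul, smul_X_eq_monomial]

theorem ses_poly : SES (polyDiff R M) (polyEval R M) where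
  inj := by
    rw [injective_iff_map_eq_zero]
    intro t ht
    obtain ⟨N, hN⟩ := exists_polyCoeff_sum t
    have hstep : ∀ i, polyCoeff R M i t = (X : R[X]) • polyCoeff R M (i + 1) t := fun i => by
      have := polyCoeff_polyDiff i t
      rw [ht, map_zero] at this
      exact (sub_eq_zero.mp this.symm)
    have hz : ∀ k i, i + k = N → polyCoeff R M i t = 0 := by
      intro k
      induction k with
      | zero => intro i hi; exact (hN i (by omega)).1
      | succ k ih => intro i hi; rw [hstep, ih (i + 1) (by omega), smul_zero]
    rw [(hN N le_rfl).2]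
    refine Finset.sum_eq_zero fun i hi => ?_
    rw [hz (N - i) i (by have := Finset.mem_range.mp hi; omega), tmul_zero]
  exact := by
    intro t
    constructor
    · intro ht
      have key : ∀ t : R[X] ⊗[R] M, ∃ s, polyDiff R M s = t - 1 ⊗ₜ polyEval R M t := by
        intro t
        induction t with
        | zero => exact ⟨0, by simp⟩
        | add a b ha hb =>
          obtain ⟨s, hs⟩ := ha
          obtain ⟨s', hs'⟩ := hb
          exact ⟨s + s', by rw [map_add, hs, hs', map_add, tmul_add]; abel⟩
        | tmul p m =>
          induction p using Polynomial.induction_on generalizing m with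
          | C a => exact ⟨0, by
              rw [map_zero, polyEval_tmul, ← mul_one (C a), ← smul_eq_C_mul, smul_tmul, smul_assoc,
                one_smul, sub_self]⟩
          | add p q hp hq =>
            obtain ⟨s, hs⟩ := hp m
            obtain ⟨s', hs'⟩ := hq m
            exact ⟨s + s', by rw [map_add, hs, hs', add_tmul, map_add, tmul_add]; abel⟩
          | monomial n a ih =>
            obtain ⟨s, hs⟩ := ih ((X : R[X]) • m)
            refine ⟨s + (C a * X ^ n) ⊗ₜ m, ?_⟩
            rw [map_add, hs, polyDiff_tmul, polyEval_tmul, polyEval_tmul, smul_smul,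
              show C a * X ^ (n + 1) = C a * X ^ n * (X : R[X]) by ring, mul_comm X]
            abel
      obtain ⟨s, hs⟩ := key t
      exact ⟨s, by rw [hs, ht, tmul_zero, sub_zero]⟩
    · rintro ⟨s, rfl⟩
      induction s with
      | zero => simp
      | add a b ha hb => rw [map_add, map_add, ha, hb, add_zero]
      | tmul p m =>
        rw [polyDiff_tmul, map_sub, polyEval_tmul, polyEval_tmul, smul_smul, mul_comm, sub_self]
  surj := fun m => ⟨1 ⊗ₜ m, by rw [polyEval_tmul, one_smul]⟩

theorem HG.poly {c : ℕ} (h : HG R M c) : HG R[X] M (c + 1) := by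
  intro R1 _ _ _ _ 𝔪 _ E _ _ ε hE
  let _ : Algebra R R1 := ((algebraMap R[X] R1).comp C).toAlgebra
  have : IsScalarTower R R[X] R1 := IsScalarTower.of_algebraMap_eq fun _ => rfl
  have : Module.Flat R R1 := Module.Flat.trans R R[X] R1
  obtain ⟨⟨n, hn⟩, hi⟩ := h R1 𝔪 E ε hE
  have hs := (ses_poly (R := R) (M := M)).baseChange (R1 := R1)
  have e := (AlgebraTensorModule.cancelBaseChange R R[X] R1 R1 M).symm
  have hn' := FD.congr e hn
  refine ⟨⟨n + 1, FD.of_coker hE hs hn' hn'⟩, fun i hic => ?_⟩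
  obtain ⟨i, rfl⟩ := Nat.exists_eq_succ_of_ne_zero (Nat.ne_of_gt (Nat.zero_lt_of_lt hic))
  exact hs.ev_right ((hi i (by omega)).congr_left e) ((hi (i + 1) (by omega)).congr_left e)

theorem HF.poly {p : ℕ} (h : HF R M p) : HF R[X] M (p + 1) := by
  intro R1 _ _ _ V _ _ i hic
  let _ : Algebra R R1 := ((algebraMap R[X] R1).comp C).toAlgebra
  have : IsScalarTower R R[X] R1 := IsScalarTower.of_algebraMap_eq fun _ => rfl
  have : Module.Flat R R1 := Module.Flat.trans R R[X] R1
  have hi := h R1 V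
  have hs := (ses_poly (R := R) (M := M)).baseChange (R1 := R1)
  have e := (AlgebraTensorModule.cancelBaseChange R R[X] R1 R1 M).symm
  obtain ⟨i, rfl⟩ := Nat.exists_eq_succ_of_ne_zero (Nat.ne_of_gt (Nat.zero_lt_of_lt hic))
  exact hs.ev_right ((hi i (by omega)).congr_left e) ((hi (i + 1) (by omega)).congr_left e)

end PolyStep

end GFD

namespace GFD

open TensorProduct Polynomial IsLocalRing RingTheory.Sequence
open scoped Pointwise

/-- A factorization of `f : R → S` through a polynomial ring over `R`, together with the
homological bounds that it transports. -/
structure Pres {R S : Type u} [CommRing R] [CommRing S] [IsLocalRing R] [IsLocalRing S]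
    (f : R →+* S) (M : Type u) [AddCommGroup M] [Module S M] (ss : List S) (c p N : ℕ) where
  R0 : Type u
  [ring : CommRing R0]
  [noeth : IsNoetherianRing R0]
  [alg : Algebra R R0]
  [alg' : Algebra R0 S]
  comp : (algebraMap R0 S).comp (algebraMap R R0) = f
  flat : Module.Flat R R0
  zs : List R0
  map_zs : zs.map (algebraMap R0 S) = ss
  surj : ∀ a : R0, ∃ r : R, a - algebraMap R R0 r ∈ Ideal.ofList zs
  reg : IsWeaklyRegular (R0 ⊗[R] ResidueField R) zs
  cot : ∃ φ : ((maximalIdeal S).comap (algebraMap R0 S)) →ₗ[R0]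
    (Fin N → R0 ⧸ (maximalIdeal S).comap (algebraMap R0 S)), Function.Surjective φ
  hg : letI := Module.compHom M (algebraMap R0 S); HG R0 M c
  hf : HF R0 S p

section

variable {R Y : Type u} [CommRing R] [AddCommGroup Y] [Module R Y]

theorem isWeaklyRegular_poly {zs : List R} (h : IsWeaklyRegular Y zs) :
    IsWeaklyRegular (R[X] ⊗[R] Y) ((X : R[X]) :: zs.map C) := by
  let _ : Module R[X] Y := Module.compHom Y (constantCoeff (R := R))
  have hX : ∀ y : Y, (X : R[X]) • y = 0 := fun y => by
    change (constantCoeff (X : R[X])) • y = 0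
    simp
  have : IsScalarTower R R[X] Y := ⟨fun a b y => by
    change constantCoeff (a • b) • y = a • (constantCoeff b • y)
    simp [mul_smul]⟩
  have hd : ∀ t : R[X] ⊗[R] Y, polyDiff R Y t = (X : R[X]) • t := by
    intro t
    induction t with
    | zero => simp
    | add a b ha hb => rw [map_add, ha, hb, smul_add]
    | tmul p m => rw [polyDiff_tmul, hX, tmul_zero, sub_zero, smul_tmul', smul_eq_mul]
  have hs := ses_poly (R := R) (M := Y)
  refine IsWeaklyRegular.cons (fun a b hab => hs.inj (by rw [hd, hd]; exact hab)) ?_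
  have hle : (X : R[X]) • (⊤ : Submodule R[X] (R[X] ⊗[R] Y)) = LinearMap.ker (polyEval R Y) := by
    ext t
    rw [LinearMap.mem_ker, hs.exact t, Submodule.mem_smul_pointwise_iff_exists]
    simp [hd]
  have e : QuotSMulTop (X : R[X]) (R[X] ⊗[R] Y) ≃ₗ[R[X]] Y :=
    (Submodule.quotEquivOfEq _ _ hle).trans (LinearMap.quotKerEquivOfSurjective _ hs.surj)
  rw [e.isWeaklyRegular_congr, ← algebraMap_eq, isWeaklyRegular_map_algebraMap_iff]
  exact h

end

variable {R S : Type u} [CommRing R] [CommRing S] [IsLocalRing R] [IsLocalRing S]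
  {f : R →+* S} {M : Type u} [AddCommGroup M] [Module S M]

theorem nonempty_pres_nil [IsNoetherianRing R] (hloc : IsLocalHom f) {c p : ℕ}
    (hg : letI := Module.compHom M f; HG R M c) (hf : letI := f.toModule; HF R S p) :
    Nonempty (Pres f M [] c p (embDim R)) := by
  let _ : Algebra R S := f.toAlgebra
  have hm : (maximalIdeal S).comap (algebraMap R S) = maximalIdeal R :=
    ((local_hom_TFAE f).out 0 4).mp hloc
  refine ⟨{ R0 := R
            comp := rfl
            flat := inferInstance
            zs := []
            map_zs := rfl
            surj := fun a => ⟨a, by simp⟩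
            reg := by simp
            cot := ?_
            hg := hg
            hf := hf }⟩
  rw [hm]
  let b := Module.finBasis (ResidueField R) (CotangentSpace R)
  refine ⟨((b.equivFun.toLinearMap).restrictScalars R) ∘ₗ (maximalIdeal R).toCotangent,
    b.equivFun.surjective.comp (Ideal.toCotangent_surjective _)⟩

theorem Pres.cons {ss : List S} {c p N : ℕ} (P : Pres f M ss c p N) {s : S}
    (hs : s ∈ maximalIdeal S) : Nonempty (Pres f M (s :: ss) (c + 1) (p + 1) (N + 1)) := by
  obtain ⟨R0, comp, flat, zs, map_zs, surj, reg, ⟨φ, hφ⟩, hg, hf⟩ := P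
  let 𝔪 := (maximalIdeal S).comap (algebraMap R0 S)
  let h : R0[X] →+* S := eval₂RingHom (algebraMap R0 S) s
  let _ : Algebra R0[X] S := h.toAlgebra
  have hC : ∀ a : R0, algebraMap R0[X] S (C a) = algebraMap R0 S a := fun a => eval₂_C _ _
  have hXs : algebraMap R0[X] S X = s := eval₂_X _ _
  have tow : IsScalarTower R0 R0[X] S := IsScalarTower.of_algebraMap_eq fun a => (hC a).symm
  have hmem : ∀ q : R0[X], q ∈ (maximalIdeal S).comap (algebraMap R0[X] S) ↔ q.coeff 0 ∈ 𝔪 := by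
    intro q
    rw [Ideal.mem_comap, Ideal.mem_comap, ← divX_mul_X_add q, map_add, map_mul, hXs, hC]
    simp only [coeff_add, mul_coeff_zero, coeff_X_zero, mul_zero, coeff_C_zero, zero_add]
    exact Ideal.add_mem_iff_right _ (Ideal.mul_mem_left _ _ hs)
  refine ⟨{ R0 := R0[X]
            comp := ?_
            flat := Module.Flat.trans R R0 R0[X]
            zs := X :: zs.map C
            map_zs := ?_
            surj := ?_
            reg := ?_
            cot := ?_
            hg := ?_
            hf := hf.poly }⟩
  · ext r
    rw [← comp]
    exact hC _
  · simp [hXs, ← map_zs, Function.comp_def, hC]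
  · intro q
    obtain ⟨r, hr⟩ := surj (q.coeff 0)
    refine ⟨r, ?_⟩
    rw [Ideal.ofList_cons, ← Ideal.map_ofList]
    have : q - algebraMap R R0[X] r = q.divX * X + C (q.coeff 0 - algebraMap R R0 r) := by
      conv_lhs => rw [← divX_mul_X_add q]
      rw [C_sub]; exact add_sub_assoc _ _ _
    rw [this]
    exact Submodule.add_mem_sup (Ideal.mul_mem_left _ _ (Ideal.mem_span_singleton_self _))
      (Ideal.mem_map_of_mem _ hr)
  · exact ((AlgebraTensorModule.cancelBaseChange R R0 R0[X] R0[X] (ResidueField R)).symm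
      |>.isWeaklyRegular_congr _).mpr (isWeaklyRegular_poly reg)
  · let 𝔪' := (maximalIdeal S).comap (algebraMap R0[X] S)
    let q : (R0 ⧸ 𝔪) →+ (R0[X] ⧸ 𝔪') := (Ideal.quotientMap 𝔪' C (fun a ha => by
      rw [Ideal.mem_comap, hmem, coeff_C_zero]; exact ha)).toAddMonoidHom
    have hq : ∀ a, q (Ideal.Quotient.mk 𝔪 a) = Ideal.Quotient.mk 𝔪' (C a) := fun a => rfl
    have hmk : ∀ r : R0[X], Ideal.Quotient.mk 𝔪' r = Ideal.Quotient.mk 𝔪' (C (r.coeff 0)) := by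
      intro r
      rw [Ideal.Quotient.eq, hmem]
      simp
    have hqs : Function.Surjective q := by
      intro b
      obtain ⟨r, rfl⟩ := Ideal.Quotient.mk_surjective b
      exact ⟨Ideal.Quotient.mk 𝔪 (r.coeff 0), by rw [hq, ← hmk]⟩
    have hqsmul : ∀ (r : R0[X]) (b : R0 ⧸ 𝔪), q (r.coeff 0 • b) = r • q b := by
      intro r b
      obtain ⟨b, rfl⟩ := Ideal.Quotient.mk_surjective b
      rw [Algebra.smul_def, Algebra.smul_def]
      change q (Ideal.Quotient.mk 𝔪 (r.coeff 0 * b)) = Ideal.Quotient.mk 𝔪' r * _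
      rw [hmk r, hq, hq, C_mul, map_mul]
    refine ⟨{ toFun := fun t => Fin.cons (Ideal.Quotient.mk 𝔪' (C (t.1.coeff 1)))
                (fun i => q (φ ⟨t.1.coeff 0, (hmem _).mp t.2⟩ i))
              map_add' := ?_
              map_smul' := ?_ }, ?_⟩
    · intro a b
      funext i
      refine Fin.cases ?_ (fun j => ?_) i
      · simp
      · have : (⟨(a + b).1.coeff 0, (hmem _).mp (a + b).2⟩ : 𝔪) =
          ⟨a.1.coeff 0, (hmem _).mp a.2⟩ + ⟨b.1.coeff 0, (hmem _).mp b.2⟩ := by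
          ext; simp
        simp only [Fin.cons_succ, Pi.add_apply]
        rw [this, map_add, Pi.add_apply, map_add]
    · intro r a
      funext i
      refine Fin.cases ?_ (fun j => ?_) i
      · simp only [Fin.cons_zero, RingHom.id_apply, Pi.smul_apply]
        rw [Algebra.smul_def]
        change _ = Ideal.Quotient.mk 𝔪' r * _
        rw [hmk r, ← map_mul, ← C_mul, Ideal.Quotient.eq, hmem, ← C_sub, coeff_C_zero]
        have : (r • a).1.coeff 1 - r.coeff 0 * a.1.coeff 1 = r.coeff 1 * a.1.coeff 0 := by
          change (r * a.1).coeff 1 - _ = _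
          rw [mul_coeff_one]; ring
        rw [this]
        exact Ideal.mul_mem_left _ _ ((hmem _).mp a.2)
      · have : (⟨(r • a).1.coeff 0, (hmem _).mp (r • a).2⟩ : 𝔪) =
          r.coeff 0 • ⟨a.1.coeff 0, (hmem _).mp a.2⟩ := by
          ext
          change (r * a.1).coeff 0 = _
          rw [mul_coeff_zero]; rfl
        simp only [Fin.cons_succ, Pi.smul_apply, RingHom.id_apply]
        rw [this, map_smul, Pi.smul_apply, hqsmul]
    · intro v
      obtain ⟨a, ha⟩ := Ideal.Quotient.mk_surjective (v 0)
      choose w hw using fun i : Fin N => hqs (v i.succ)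
      obtain ⟨t, ht⟩ := hφ w
      have h0 : (C t.1 + C (a.coeff 0) * X).coeff 0 = t.1 := by simp
      refine ⟨⟨C t.1 + C (a.coeff 0) * X, (hmem _).mpr (by rw [h0]; exact t.2)⟩, ?_⟩
      funext i
      refine Fin.cases ?_ (fun j => ?_) i
      · simp only [LinearMap.coe_mk, AddHom.coe_mk, Fin.cons_zero]
        rw [← ha, hmk a]
        simp
      · simp only [LinearMap.coe_mk, AddHom.coe_mk, Fin.cons_succ]
        rw [← hw, ← ht]
        congr
        simp
  · let _ : Module R0 M := Module.compHom M (algebraMap R0 S)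
    let _ : Module R0[X] M := Module.compHom M (algebraMap R0[X] S)
    have : IsScalarTower R0 R0[X] M := ⟨fun a b m => by
      change algebraMap R0[X] S (a • b) • m = algebraMap R0 S a • (algebraMap R0[X] S b • m)
      rw [smul_eq_C_mul, map_mul, hC, mul_smul]⟩
    exact HG.poly hg

theorem nonempty_pres [IsNoetherianRing R] (hloc : IsLocalHom f) {c p : ℕ}
    (hg : letI := Module.compHom M f; HG R M c) (hf : letI := f.toModule; HF R S p)
    (ss : List S) (hss : ∀ s ∈ ss, s ∈ maximalIdeal S) :
    Nonempty (Pres f M ss (c + ss.length) (p + ss.length) (embDim R + ss.length)) := by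
  induction ss with
  | nil => exact nonempty_pres_nil hloc hg hf
  | cons s ss ih =>
    obtain ⟨P⟩ := ih fun t ht => hss t (List.mem_cons_of_mem _ ht)
    exact P.cons (hss s List.mem_cons_self)

end GFD

namespace GFD

open IsLocalRing

section Lifting

variable {R S : Type u} [CommRing R] [CommRing S] [IsLocalRing S] [Algebra R S]

/-- The `R`-algebra map sending the variables indexed by `W` to their residues and fixing the
others. -/
noncomputable def partialResidue (R : Type u) {S : Type u} [CommRing R] [CommRing S]
    [IsLocalRing S] [Algebra R S] (W : Set S) :
    MvPolynomial S R →ₐ[R] MvPolynomial S (ResidueField S) :=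
  open Classical in
  MvPolynomial.aeval fun s => if s ∈ W then MvPolynomial.C (residue S s) else MvPolynomial.X s

theorem partialResidue_X_mem {W : Set S} {s : S} (hs : s ∈ W) :
    partialResidue R W (MvPolynomial.X s) = MvPolynomial.C (residue S s) := by
  simp [partialResidue, hs]

theorem partialResidue_X_notMem {W : Set S} {s : S} (hs : s ∉ W) :
    partialResidue R W (MvPolynomial.X s) = MvPolynomial.X s := by
  simp [partialResidue, hs]

theorem partialResidue_C (W : Set S) (r : R) :
    partialResidue R W (MvPolynomial.C r) = MvPolynomial.C (residue S (algebraMap R S r)) := by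
  rw [← MvPolynomial.algebraMap_eq, AlgHom.commutes]; rfl

/-- The extension of an ideal to the polynomial ring. -/
noncomputable abbrev polyIdeal (S : Type u) (𝔪 : Ideal R) : Ideal (MvPolynomial S R) :=
  𝔪.map (MvPolynomial.C (σ := S))

/-- The property maintained while relations are adjoined to the polynomial ring on `S`. -/
structure LiftInv (𝔪 : Ideal R) (W : Set S) (𝔠 : Ideal (MvPolynomial S R)) : Prop where
  le_ker : ∀ p ∈ 𝔠, MvPolynomial.aeval (R := R) (id : S → S) p = 0
  ker_iff : ∀ p, partialResidue R W p = 0 ↔ p ∈ 𝔠 ⊔ polyIdeal S 𝔪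
  inf_le : 𝔠 ⊓ polyIdeal S 𝔪 ≤ polyIdeal S 𝔪 * 𝔠

variable {𝔪 : Ideal R}

theorem LiftInv.bot (hm : 𝔪 = (maximalIdeal S).comap (algebraMap R S)) :
    LiftInv (S := S) 𝔪 ∅ ⊥ where
  le_ker := by simp
  ker_iff := by
    intro p
    have h1 : partialResidue R (∅ : Set S) p =
        MvPolynomial.map ((residue S).comp (algebraMap R S)) p := by
      have : partialResidue R (∅ : Set S) =
          MvPolynomial.mapAlgHom (Algebra.ofId R (ResidueField S)) := by
        ext s
        rw [partialResidue_X_notMem (Set.notMem_empty s)]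
        simp
      rw [this]; rfl
    rw [h1, bot_sup_eq, MvPolynomial.mem_map_C_iff, MvPolynomial.ext_iff]
    simp [MvPolynomial.coeff_map, hm]
  inf_le := by simp

theorem eval_partialResidue (W : Set S) (p : MvPolynomial S R) :
    MvPolynomial.eval (residue S) (partialResidue R W p) =
      residue S (MvPolynomial.aeval (R := R) (id : S → S) p) := by
  have : (MvPolynomial.eval (residue S)).comp (partialResidue R W).toRingHom =
      (residue S).comp (MvPolynomial.aeval (R := R) (id : S → S)).toRingHom := by
    refine MvPolynomial.ringHom_ext (fun r => ?_) fun s => ?_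
    · simp; rfl
    · by_cases h : s ∈ W
      · simp [partialResidue_X_mem h]
      · simp [partialResidue_X_notMem h]
  exact RingHom.congr_fun this p

theorem exists_mem_polyIdeal (hn : maximalIdeal S = 𝔪.map (algebraMap R S)) {a : S}
    (ha : a ∈ maximalIdeal S) :
    ∃ z ∈ polyIdeal S 𝔪, MvPolynomial.aeval (R := R) (id : S → S) z = a := by
  rw [hn, Ideal.map] at ha
  induction ha using Submodule.span_induction with
  | mem x hx =>
    obtain ⟨r, hr, rfl⟩ := hx
    exact ⟨MvPolynomial.C r, Ideal.mem_map_of_mem _ hr, by simp⟩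
  | zero => exact ⟨0, zero_mem _, by simp⟩
  | add x y _ _ hx hy =>
    obtain ⟨z, hz, rfl⟩ := hx
    obtain ⟨w, hw, rfl⟩ := hy
    exact ⟨z + w, add_mem hz hw, by simp⟩
  | smul b x _ hx =>
    obtain ⟨z, hz, rfl⟩ := hx
    exact ⟨MvPolynomial.X b * z, Ideal.mul_mem_left _ _ hz, by simp⟩

theorem exists_principal_ker {K : Type u} [Field K] [Algebra R K] (L : Subalgebra R K) :
    (∀ s : K, ∃ f : Polynomial L, RingHom.ker (Polynomial.eval₂RingHom (L.val : L →+* K) s) =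
      Ideal.span {f}) ∨ ∃ s ∉ L, ∃ f : Polynomial L,
        RingHom.ker (Polynomial.eval₂RingHom (L.val : L →+* K) s) = Ideal.span {f} := by
  classical
  by_cases hL : IsField L
  · left
    intro s
    let _ := hL.toField
    have := IsPrincipalIdealRing.principal
      (RingHom.ker (Polynomial.eval₂RingHom (L.val : L →+* K) s))
    obtain ⟨f, hf⟩ := this
    exact ⟨f, hf⟩
  · right
    obtain ⟨a, ha0, ha⟩ : ∃ a : L, a ≠ 0 ∧ ∀ b : L, a * b ≠ 1 := by
      by_contra! h
      exact hL ⟨⟨0, 1, zero_ne_one⟩, mul_comm, fun {a} ha => h a ha⟩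
    have ha' : (a : K) ≠ 0 := fun h => ha0 (Subtype.ext h)
    refine ⟨(a : K)⁻¹, fun h => ha ⟨_, h⟩ (Subtype.ext (mul_inv_cancel₀ ha')),
      Polynomial.C a * Polynomial.X - 1, le_antisymm (fun h hh => ?_) ?_⟩
    · rw [Ideal.mem_span_singleton]
      have key : ∀ h : Polynomial L, ∃ (n : ℕ) (b : L),
          (Polynomial.C a * Polynomial.X - 1) ∣ Polynomial.C a ^ n * h - Polynomial.C b := by
        intro h
        induction h using Polynomial.induction_on' with
        | add p q hp hq =>
          obtain ⟨n, b, hb⟩ := hp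
          obtain ⟨n', b', hb'⟩ := hq
          refine ⟨n + n', a ^ n' * b + a ^ n * b', ?_⟩
          have := (hb.mul_left (Polynomial.C a ^ n')).add (hb'.mul_left (Polynomial.C a ^ n))
          convert this using 1
          simp only [map_add, map_mul, map_pow]
          ring
        | monomial k c =>
          refine ⟨k, c, ?_⟩
          have := (sub_dvd_pow_sub_pow (Polynomial.C a * Polynomial.X) 1 k).mul_left
            (Polynomial.C c)
          convert this using 1
          rw [← Polynomial.C_mul_X_pow_eq_monomial]
          ring
      obtain ⟨n, b, hb⟩ := key h
      have hz : (Polynomial.eval₂RingHom (L.val : L →+* K) (a : K)⁻¹)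
          (Polynomial.C a * Polynomial.X - 1) = 0 := by simp [ha']
      have hb0 : b = 0 := by
        obtain ⟨q, hq⟩ := hb
        have := congrArg (Polynomial.eval₂RingHom (L.val : L →+* K) (a : K)⁻¹) hq
        rw [map_mul, hz, map_sub, map_mul, (RingHom.mem_ker).1 hh] at this
        simpa using this
      rw [hb0, map_zero, sub_zero] at hb
      refine IsCoprime.dvd_of_dvd_mul_left ?_ hb
      exact IsCoprime.pow_right ⟨-1, Polynomial.X, by ring⟩
    · rw [Ideal.span_le, Set.singleton_subset_iff]
      simp [RingHom.mem_ker, ha']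

theorem C_mem_range_partialResidue (W : Set S) {a : ResidueField S}
    (ha : a ∈ Algebra.adjoin R (residue S '' W)) :
    MvPolynomial.C a ∈ (partialResidue R W).range := by
  let c : ResidueField S →ₐ[R] MvPolynomial S (ResidueField S) :=
    IsScalarTower.toAlgHom R (ResidueField S) (MvPolynomial S (ResidueField S))
  have : Algebra.adjoin R (residue S '' W) ≤ (partialResidue R W).range.comap c := by
    refine Algebra.adjoin_le ?_
    rintro _ ⟨w, hw, rfl⟩
    exact ⟨MvPolynomial.X w, partialResidue_X_mem hw⟩
  exact this ha

theorem exists_partialResidue_insert {W : Set S} {s : S} (hs : s ∉ W) :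
    ∃ τ : MvPolynomial S (ResidueField S) →+* MvPolynomial S (ResidueField S),
      (∀ a, τ (MvPolynomial.C a) = MvPolynomial.C a) ∧
      τ (MvPolynomial.X s) = MvPolynomial.C (residue S s) ∧
      ∀ p, τ (partialResidue R W p) = partialResidue R (insert s W) p := by
  classical
  let τ : MvPolynomial S (ResidueField S) →+* MvPolynomial S (ResidueField S) :=
    MvPolynomial.eval₂Hom MvPolynomial.C
      fun t => if t = s then MvPolynomial.C (residue S s) else MvPolynomial.X t
  refine ⟨τ, by simp [τ], by simp [τ], fun p => ?_⟩
  have : τ.comp (partialResidue R W).toRingHom =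
      (partialResidue R (insert s W)).toRingHom := by
    refine MvPolynomial.ringHom_ext (fun r => ?_) fun t => ?_
    · change τ (partialResidue R W _) = partialResidue R _ _
      simp only [partialResidue_C]
      simp [τ]
    · by_cases h : t ∈ W
      · simp [τ, partialResidue_X_mem h, partialResidue_X_mem (Set.mem_insert_of_mem s h)]
      · by_cases hts : t = s
        · subst hts
          simp [τ, partialResidue_X_notMem h, partialResidue_X_mem (Set.mem_insert t W)]
        · have h' : t ∉ insert s W := by simp [h, hts]
          simp [τ, hts, partialResidue_X_notMem h, partialResidue_X_notMem h']
  exact RingHom.congr_fun this p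

theorem exists_factor_partialResidue {W : Set S} {s : S} (hs : s ∉ W)
    {f : Polynomial (Algebra.adjoin R (residue S '' W))}
    (hf : RingHom.ker (Polynomial.eval₂RingHom
      ((Algebra.adjoin R (residue S '' W)).val : _ →+* ResidueField S) (residue S s)) =
        Ideal.span {f}) :
    ∃ y : MvPolynomial S R, partialResidue R (insert s W) y = 0 ∧
      ∀ p, partialResidue R (insert s W) p = 0 →
        ∃ q, partialResidue R W p = partialResidue R W (y * q) := by
  classical
  generalize hL : Algebra.adjoin R (residue S '' W) = L at f hf
  let ρ : MvPolynomial S R →ₐ[R] MvPolynomial S (Polynomial L) :=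
    MvPolynomial.aeval fun t => if h : t ∈ W then
      MvPolynomial.C (Polynomial.C ⟨residue S t, hL ▸ Algebra.subset_adjoin ⟨t, h, rfl⟩⟩)
      else if t = s then MvPolynomial.C Polynomial.X else MvPolynomial.X t
  let σ : MvPolynomial S (Polynomial L) →+* MvPolynomial S (ResidueField S) :=
    MvPolynomial.eval₂Hom (Polynomial.eval₂RingHom
      ((MvPolynomial.C : ResidueField S →+* MvPolynomial S (ResidueField S)).comp
        (L.val : L →+* ResidueField S)) (MvPolynomial.X s))
      fun t => partialResidue R W (MvPolynomial.X t)
  let μ : MvPolynomial S (Polynomial L) →+* MvPolynomial S (ResidueField S) :=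
    MvPolynomial.map (Polynomial.eval₂RingHom (L.val : L →+* ResidueField S) (residue S s))
  have hσρ : ∀ p, σ (ρ p) = partialResidue R W p := by
    intro p
    have : σ.comp ρ.toRingHom = (partialResidue R W).toRingHom := by
      refine MvPolynomial.ringHom_ext (fun r => ?_) fun t => ?_
      · simp [σ, ρ, MvPolynomial.algebraMap_eq,
          IsScalarTower.algebraMap_apply R (Polynomial L) (MvPolynomial S (Polynomial L)),
          IsScalarTower.algebraMap_apply R L (Polynomial L)]
      · by_cases h : t ∈ W
        · simp [σ, ρ, h, partialResidue_X_mem h]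
        · by_cases hts : t = s
          · subst hts; simp [σ, ρ, h, partialResidue_X_notMem h]
          · simp [σ, ρ, h, hts]
    exact RingHom.congr_fun this p
  have hμρ : ∀ p, μ (ρ p) = partialResidue R (insert s W) p := by
    intro p
    have : μ.comp ρ.toRingHom = (partialResidue R (insert s W)).toRingHom := by
      refine MvPolynomial.ringHom_ext (fun r => ?_) fun t => ?_
      · simp [μ, ρ, MvPolynomial.algebraMap_eq,
          IsScalarTower.algebraMap_apply R (Polynomial L) (MvPolynomial S (Polynomial L)),
          IsScalarTower.algebraMap_apply R L (Polynomial L)]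
      · by_cases h : t ∈ W
        · simp [μ, ρ, h, partialResidue_X_mem (Set.mem_insert_of_mem s h)]
        · by_cases hts : t = s
          · subst hts; simp [μ, ρ, h, partialResidue_X_mem (Set.mem_insert t W)]
          · have : t ∉ insert s W := by simp [h, hts]
            simp [μ, ρ, h, hts, partialResidue_X_notMem this]
    exact RingHom.congr_fun this p
  obtain ⟨τ, hτC, hτX, hτ⟩ := exists_partialResidue_insert (R := R) hs
  have hσ : ∀ G, σ G ∈ (partialResidue R W).range := by
    intro G
    induction G using MvPolynomial.induction_on with
    | C a =>
      simp only [σ, MvPolynomial.eval₂Hom_C]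
      induction a using Polynomial.induction_on' with
      | add p q hp hq => rw [map_add]; exact add_mem hp hq
      | monomial n c =>
        simp only [Polynomial.coe_eval₂RingHom, Polynomial.eval₂_monomial]
        refine mul_mem (C_mem_range_partialResidue W (hL ▸ c.2)) (pow_mem ?_ n)
        exact ⟨MvPolynomial.X s, partialResidue_X_notMem hs⟩
    | add p q hp hq => rw [map_add]; exact add_mem hp hq
    | mul_X p t hp =>
      rw [map_mul]
      refine mul_mem hp ⟨MvPolynomial.X t, ?_⟩
      simp [σ]
  obtain ⟨y, hy⟩ := hσ (MvPolynomial.C f)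
  change partialResidue R W y = _ at hy
  have hτσ : ∀ a : Polynomial L, τ (σ (MvPolynomial.C a)) = μ (MvPolynomial.C a) := by
    intro a
    simp only [σ, μ, MvPolynomial.eval₂Hom_C, MvPolynomial.map_C]
    induction a using Polynomial.induction_on' with
    | add p q hp hq => simp only [map_add, hp, hq]
    | monomial n c => simp [hτC, hτX, Polynomial.eval₂_monomial]
  refine ⟨y, ?_, fun p hp => ?_⟩
  · rw [← hτ, hy, hτσ]
    have : f ∈ RingHom.ker (Polynomial.eval₂RingHom (L.val : L →+* ResidueField S)
      (residue S s)) := hf ▸ Ideal.mem_span_singleton_self f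
    simp only [μ, MvPolynomial.map_C, (RingHom.mem_ker).1 this, map_zero]
  · rw [← hμρ, ← RingHom.mem_ker, MvPolynomial.ker_map, hf, Ideal.map_span,
      Set.image_singleton, Ideal.mem_span_singleton] at hp
    obtain ⟨G, hG⟩ := hp
    obtain ⟨q, hq⟩ := hσ G
    refine ⟨q, ?_⟩
    change partialResidue R W q = _ at hq
    rw [← hσρ p, hG, map_mul, map_mul, hy, hq]

theorem LiftInv.adjoin (hn : maximalIdeal S = 𝔪.map (algebraMap R S)) {W : Set S}
    {𝔠 : Ideal (MvPolynomial S R)} (h : LiftInv 𝔪 W 𝔠) {s : S} (hs : s ∉ W)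
    {f : Polynomial (Algebra.adjoin R (residue S '' W))}
    (hf : RingHom.ker (Polynomial.eval₂RingHom
      ((Algebra.adjoin R (residue S '' W)).val : _ →+* ResidueField S) (residue S s)) =
        Ideal.span {f}) :
    ∃ 𝔠', 𝔠 ≤ 𝔠' ∧ LiftInv 𝔪 (insert s W) 𝔠' := by
  have hle : ∀ p, partialResidue R W p = 0 → partialResidue R (insert s W) p = 0 := by
    intro p hp
    obtain ⟨τ, -, -, hτ⟩ := exists_partialResidue_insert (R := R) hs
    rw [← hτ, hp, map_zero]
  obtain ⟨y₀, hy₀, hfac⟩ := exists_factor_partialResidue hs hf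
  have hmem : MvPolynomial.aeval (R := R) (id : S → S) y₀ ∈ maximalIdeal S := by
    rw [← residue_eq_zero_iff, ← eval_partialResidue (insert s W), hy₀, map_zero]
  obtain ⟨z, hz, hzy⟩ := exists_mem_polyIdeal hn hmem
  have hz0 : ∀ z ∈ polyIdeal S 𝔪, partialResidue R W z = 0 := fun z hz =>
    (h.ker_iff z).2 (Ideal.mem_sup_right hz)
  have hc0 : ∀ z ∈ 𝔠, partialResidue R W z = 0 := fun z hz =>
    (h.ker_iff z).2 (Ideal.mem_sup_left hz)
  set y := y₀ - z with hy
  have hWy : partialResidue R W y = partialResidue R W y₀ := by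
    rw [hy, map_sub, hz0 z hz, sub_zero]
  by_cases hy0 : partialResidue R W y = 0
  · refine ⟨𝔠, le_rfl, h.le_ker, fun p => ⟨fun hp => ?_, fun hp => hle p ((h.ker_iff p).2 hp)⟩,
      h.inf_le⟩
    obtain ⟨q, hq⟩ := hfac p hp
    rw [← h.ker_iff, hq, map_mul, ← hWy, hy0, zero_mul]
  refine ⟨𝔠 ⊔ Ideal.span {y}, le_sup_left, ?_, fun p => ⟨fun hp => ?_, fun hp => ?_⟩, ?_⟩
  · intro p hp
    obtain ⟨c, hc, q, hq, rfl⟩ := Submodule.mem_sup.1 hp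
    obtain ⟨q, rfl⟩ := Ideal.mem_span_singleton.1 hq
    rw [map_add, h.le_ker c hc, map_mul, hy, map_sub, hzy, sub_self, zero_mul, add_zero]
  · obtain ⟨q, hq⟩ := hfac p hp
    have h1 : p - y * q ∈ 𝔠 ⊔ polyIdeal S 𝔪 := by
      rw [← h.ker_iff, map_sub, hq, map_mul, map_mul, hWy, sub_self]
    have h2 : y * q ∈ Ideal.span {y} := Ideal.mul_mem_right _ _ (Ideal.mem_span_singleton_self y)
    rw [← sub_add_cancel p (y * q)]
    have hsup : 𝔠 ⊔ polyIdeal S 𝔪 ≤ 𝔠 ⊔ Ideal.span {y} ⊔ polyIdeal S 𝔪 :=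
      sup_le_sup_right le_sup_left _
    refine add_mem (hsup h1) (Ideal.mem_sup_left (Ideal.mem_sup_right h2))
  · have hle' : 𝔠 ⊔ Ideal.span {y} ⊔ polyIdeal S 𝔪 ≤
        RingHom.ker (partialResidue R (insert s W)) := by
      refine sup_le (sup_le (fun c hc => hle c (hc0 c hc)) ?_) fun c hc => hle c (hz0 c hc)
      rw [Ideal.span_le, Set.singleton_subset_iff]
      change partialResidue R (insert s W) y = 0
      rw [hy, map_sub, hy₀, hle z (hz0 z hz), sub_zero]
    exact hle' hp
  · rintro x ⟨hx, hxm⟩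
    obtain ⟨c, hc, q, hq, rfl⟩ := Submodule.mem_sup.1 hx
    obtain ⟨q, rfl⟩ := Ideal.mem_span_singleton.1 hq
    have h1 : partialResidue R W q = 0 := by
      have := hz0 _ hxm
      rw [map_add, hc0 c hc, zero_add, map_mul] at this
      exact (mul_eq_zero.1 this).resolve_left hy0
    obtain ⟨c₁, hc₁, m₁, hm₁, rfl⟩ := Submodule.mem_sup.1 ((h.ker_iff q).1 h1)
    have h2 : y * m₁ ∈ polyIdeal S 𝔪 * (𝔠 ⊔ Ideal.span {y}) := by
      rw [mul_comm y]
      exact Ideal.mul_mem_mul hm₁ (Ideal.mem_sup_right (Ideal.mem_span_singleton_self y))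
    have h3 : c + y * c₁ ∈ 𝔠 ⊓ polyIdeal S 𝔪 := by
      refine ⟨add_mem hc (Ideal.mul_mem_left _ _ hc₁), ?_⟩
      have := sub_mem hxm (Ideal.mul_mem_left _ y hm₁)
      rwa [mul_add, ← add_assoc, add_sub_cancel_right] at this
    have hsup : polyIdeal S 𝔪 * 𝔠 ≤ polyIdeal S 𝔪 * (𝔠 ⊔ Ideal.span {y}) :=
      Ideal.mul_mono_right le_sup_left
    have h4 := hsup (h.inf_le h3)
    rw [mul_add, ← add_assoc]
    exact add_mem h4 h2

theorem LiftInv.chain {c : Set (Set S × Ideal (MvPolynomial S R))} (hc : IsChain (· ≤ ·) c)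
    (hne : c.Nonempty) (h : ∀ x ∈ c, LiftInv 𝔪 x.1 x.2) :
    LiftInv 𝔪 (⋃ x ∈ c, x.1) (sSup (Prod.snd '' c)) := by
  set W : Set S := ⋃ x ∈ c, x.1 with hW
  have hdir : DirectedOn (· ≤ ·) (Prod.snd '' c) := by
    rintro _ ⟨x, hx, rfl⟩ _ ⟨y, hy, rfl⟩
    obtain ⟨z, hz, hxz, hyz⟩ := hc.directedOn x hx y hy
    exact ⟨z.2, ⟨z, hz, rfl⟩, hxz.2, hyz.2⟩
  have hmem : ∀ p, p ∈ sSup (Prod.snd '' c) ↔ ∃ x ∈ c, p ∈ x.2 := by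
    intro p
    rw [Submodule.mem_sSup_of_directed (hne.image _) hdir]
    simp only [Set.exists_mem_image]
  have hle : ∀ x ∈ c, x.2 ≤ sSup (Prod.snd '' c) := fun x hx => le_sSup ⟨x, hx, rfl⟩
  have hev : ∀ p, ∃ x ∈ c, ∀ y ∈ c, x ≤ y → partialResidue R W p = partialResidue R y.1 p := by
    intro p
    induction p using MvPolynomial.induction_on with
    | C a =>
      obtain ⟨x, hx⟩ := hne
      exact ⟨x, hx, fun y _ _ => by rw [partialResidue_C, partialResidue_C]⟩
    | add p q hp hq =>
      obtain ⟨x, hx, hxp⟩ := hp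
      obtain ⟨y, hy, hyq⟩ := hq
      obtain ⟨z, hz, hxz, hyz⟩ := hc.directedOn x hx y hy
      exact ⟨z, hz, fun w hw hzw => by
        rw [map_add, map_add, hxp w hw (hxz.trans hzw), hyq w hw (hyz.trans hzw)]⟩
    | mul_X p t hp =>
      obtain ⟨x, hx, hxp⟩ := hp
      by_cases ht : t ∈ W
      · obtain ⟨y, hy, hty⟩ : ∃ y ∈ c, t ∈ y.1 := by simpa [hW] using ht
        obtain ⟨z, hz, hxz, hyz⟩ := hc.directedOn x hx y hy
        exact ⟨z, hz, fun w hw hzw => by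
          rw [map_mul, map_mul, hxp w hw (hxz.trans hzw), partialResidue_X_mem ht,
            partialResidue_X_mem ((hyz.trans hzw).1 hty)]⟩
      · exact ⟨x, hx, fun w hw hxw => by
          rw [map_mul, map_mul, hxp w hw hxw, partialResidue_X_notMem ht,
            partialResidue_X_notMem fun h => ht (Set.mem_biUnion hw h)]⟩
  refine ⟨fun p hp => ?_, fun p => ⟨fun hp => ?_, fun hp => ?_⟩, ?_⟩
  · obtain ⟨x, hx, hpx⟩ := (hmem p).1 hp
    exact (h x hx).le_ker p hpx
  · obtain ⟨x, hx, hxp⟩ := hev p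
    have := ((h x hx).ker_iff p).1 (by rw [← hxp x hx le_rfl, hp])
    have hsup : x.2 ⊔ polyIdeal S 𝔪 ≤ sSup (Prod.snd '' c) ⊔ polyIdeal S 𝔪 :=
      sup_le_sup_right (hle x hx) _
    exact hsup this
  · obtain ⟨a, ha, b, hb, rfl⟩ := Submodule.mem_sup.1 hp
    obtain ⟨x, hx, hax⟩ := (hmem a).1 ha
    obtain ⟨y, hy, hyp⟩ := hev (a + b)
    obtain ⟨z, hz, hxz, hyz⟩ := hc.directedOn x hx y hy
    rw [hyp z hz hyz, (h z hz).ker_iff]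
    exact add_mem (Ideal.mem_sup_left (hxz.2 hax)) (Ideal.mem_sup_right hb)
  · rintro a ⟨ha, hb⟩
    obtain ⟨x, hx, hax⟩ := (hmem a).1 ha
    have hsup : polyIdeal S 𝔪 * x.2 ≤ polyIdeal S 𝔪 * sSup (Prod.snd '' c) :=
      Ideal.mul_mono_right (hle x hx)
    exact hsup ((h x hx).inf_le ⟨hax, hb⟩)

/-- There are relations on the polynomial ring on `S` whose quotient is flat modulo powers of `𝔪`
with residue ring the residue field of `S`. -/
theorem exists_liftInv_univ (hm : 𝔪 = (maximalIdeal S).comap (algebraMap R S))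
    (hn : maximalIdeal S = 𝔪.map (algebraMap R S)) :
    ∃ 𝔠 : Ideal (MvPolynomial S R), LiftInv 𝔪 (Set.univ : Set S) 𝔠 := by
  obtain ⟨⟨W, 𝔠⟩, -, hmax⟩ := zorn_le_nonempty₀
    {x : Set S × Ideal (MvPolynomial S R) | LiftInv 𝔪 x.1 x.2}
    (fun c hc hchain y hy => ⟨(⋃ x ∈ c, x.1, sSup (Prod.snd '' c)),
      LiftInv.chain hchain ⟨y, hy⟩ hc, fun z hz => ⟨Set.subset_biUnion_of_mem (u := Prod.fst) hz,
        le_sSup ⟨z, hz, rfl⟩⟩⟩) (∅, ⊥) (LiftInv.bot hm)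
  have h : LiftInv 𝔪 W 𝔠 := hmax.1
  have hstep : ∀ s ∉ W, ∀ f : Polynomial (Algebra.adjoin R (residue S '' W)),
      RingHom.ker (Polynomial.eval₂RingHom
      ((Algebra.adjoin R (residue S '' W)).val : _ →+* ResidueField S) (residue S s)) ≠
        Ideal.span {f} := by
    intro s hs f hf
    obtain ⟨𝔠', hle, h'⟩ := h.adjoin hn hs hf
    have := hmax.2 (y := (insert s W, 𝔠')) h' ⟨Set.subset_insert s W, hle⟩
    exact hs (this.1 (Set.mem_insert s W))
  suffices hW : W = Set.univ by subst hW; exact ⟨𝔠, h⟩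
  by_contra hW
  obtain ⟨s, hs⟩ := (Set.ne_univ_iff_exists_notMem W).1 hW
  rcases exists_principal_ker (Algebra.adjoin R (residue S '' W)) with h1 | ⟨a, ha, f, hf⟩
  · obtain ⟨f, hf⟩ := h1 (residue S s)
    exact hstep s hs f hf
  · obtain ⟨t, rfl⟩ := residue_surjective a
    exact hstep t (fun ht => ha (Algebra.subset_adjoin ⟨t, ht, rfl⟩)) f hf

end Lifting

end GFD

namespace GFD

open MvPolynomial

section Noetherian

variable {A : Type u} [CommRing A] {J : Ideal A}

theorem exists_homogeneousComponent_mul {σ k : Type u} [CommRing k] (q b : MvPolynomial σ k)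
    {i : ℕ} (hb : b.IsHomogeneous i) (n : ℕ) :
    ∃ q' : MvPolynomial σ k, q'.IsHomogeneous (n - i) ∧ (i ≤ n ∨ q' = 0) ∧
      homogeneousComponent n (q * b) = q' * b := by
  classical
  let _ : GradedAlgebra (homogeneousSubmodule σ k) := MvPolynomial.gradedAlgebra
  have h := DirectSum.coe_decompose_mul_of_right_mem (homogeneousSubmodule σ k) (a := q) n
    ((mem_homogeneousSubmodule i b).2 hb)
  have e : ∀ (p : MvPolynomial σ k) m, ((DirectSum.decompose (homogeneousSubmodule σ k) p m :
      homogeneousSubmodule σ k m) : MvPolynomial σ k) = homogeneousComponent m p :=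
    fun p m => decomposition.decompose'_apply p m
  rw [e, e] at h
  split_ifs at h with hi
  · exact ⟨_, homogeneousComponent_isHomogeneous _ _, Or.inl hi, h⟩
  · exact ⟨0, isHomogeneous_zero _ _ _, Or.inr rfl, by rw [h, zero_mul]⟩

theorem eval_mem_pow {σ : Type u} {a : σ → A} (ha : ∀ i, a i ∈ J)
    {p : MvPolynomial σ A} {n : ℕ} (hp : p.IsHomogeneous n) : eval a p ∈ J ^ n := by
  have h : eval a p ∈ Ideal.span (Set.range a) ^ n :=
    (Ideal.mem_span_pow_iff_exists_isHomogeneous a _).2 ⟨p, hp, rfl⟩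
  refine Ideal.pow_right_mono (Ideal.span_le.2 ?_) n h
  rintro _ ⟨i, rfl⟩
  exact ha i

theorem eval_mem_pow_succ {σ : Type u} {a : σ → A} (ha : ∀ i, a i ∈ J)
    {p : MvPolynomial σ A} {n : ℕ} (hp : p.IsHomogeneous n)
    (h : MvPolynomial.map (Ideal.Quotient.mk J) p = 0) : eval a p ∈ J ^ (n + 1) := by
  rw [eval_eq]
  refine Ideal.sum_mem _ fun d hd => ?_
  rw [pow_succ']
  refine Ideal.mul_mem_mul ?_ ?_
  · have := congrArg (coeff d) h
    rwa [coeff_map, coeff_zero, Ideal.Quotient.eq_zero_iff_mem] at this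
  · have h1 : (monomial d (1 : A)).IsHomogeneous n :=
      isHomogeneous_monomial 1 (by
        rw [Finsupp.degree_eq_weight_one]; exact hp (mem_support_iff.1 hd))
    simpa [eval_monomial, Finsupp.prod] using eval_mem_pow ha h1

theorem exists_homogeneous_lift {σ : Type u} {q : MvPolynomial σ (A ⧸ J)} {n : ℕ}
    (hq : q.IsHomogeneous n) : ∃ p : MvPolynomial σ A, p.IsHomogeneous n ∧
      MvPolynomial.map (Ideal.Quotient.mk J) p = q := by
  obtain ⟨p, rfl⟩ := MvPolynomial.map_surjective _ Ideal.Quotient.mk_surjective q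
  refine ⟨homogeneousComponent n p, homogeneousComponent_isHomogeneous _ _, ?_⟩
  conv_rhs => rw [← homogeneousComponent_eq_self hq]
  ext d
  simp only [coeff_map, coeff_homogeneousComponent]
  split_ifs <;> simp

theorem exists_approx (hJ : J.FG) [IsNoetherianRing (A ⧸ J)] (𝔞 : Ideal A) :
    ∃ (ι : Type u) (_ : Fintype ι) (x : ι → A) (d : ι → ℕ), (∀ i, x i ∈ 𝔞) ∧
      ∀ (n : ℕ), ∀ y ∈ 𝔞, y ∈ J ^ n → ∃ c : ι → A, (∀ i, c i ∈ J ^ (n - d i)) ∧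
        y - ∑ i, c i * x i ∈ J ^ (n + 1) := by
  classical
  obtain ⟨s, hs⟩ := hJ
  let σ : Type u := s
  let a : σ → A := Subtype.val
  have hspan : Ideal.span (Set.range a) = J := by
    rw [← hs]; congr 1; exact Subtype.range_coe
  have haJ : ∀ i, a i ∈ J := fun i => hspan ▸ Ideal.subset_span ⟨i, rfl⟩
  let π := MvPolynomial.map (σ := σ) (Ideal.Quotient.mk J)
  let B : Set (MvPolynomial σ (A ⧸ J)) := {b | ∃ (n : ℕ) (p : MvPolynomial σ A) (x : A),
    p.IsHomogeneous n ∧ π p = b ∧ x ∈ 𝔞 ∧ x - eval a p ∈ J ^ (n + 1)}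
  obtain ⟨t, htB, ht⟩ := (Submodule.fg_span_iff_fg_span_finset_subset B).1
    ((isNoetherian_def.1 (inferInstance : IsNoetherianRing (MvPolynomial σ (A ⧸ J))))
      (Submodule.span (MvPolynomial σ (A ⧸ J)) B))
  choose d P x hP hPb hx hxP using fun b : t => htB b.2
  refine ⟨t, inferInstance, x, d, hx, fun n y hy hyn => ?_⟩
  rw [← hspan, Ideal.mem_span_pow_iff_exists_isHomogeneous] at hyn
  obtain ⟨p, hp, hpy⟩ := hyn
  have hpB : π p ∈ Submodule.span (MvPolynomial σ (A ⧸ J)) B :=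
    Submodule.subset_span ⟨n, p, y, hp, rfl, hy, by rw [hpy, sub_self]; exact zero_mem _⟩
  rw [ht] at hpB
  obtain ⟨q, hq⟩ := Submodule.mem_span_finset'.1 hpB
  have hb : ∀ b : t, (b : MvPolynomial σ (A ⧸ J)).IsHomogeneous (d b) := fun b =>
    hPb b ▸ (hP b).map _
  choose q' hq' hn' hqq' using fun b : t => exists_homogeneousComponent_mul (q b) b (hb b) n
  have hlift : ∀ b : t, ∃ Q : MvPolynomial σ A, Q.IsHomogeneous (n - d b) ∧ π Q = q' b ∧
      (d b ≤ n ∨ Q = 0) := fun b => by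
    rcases hn' b with h | h
    · obtain ⟨Q, h1, h2⟩ := exists_homogeneous_lift (hq' b)
      exact ⟨Q, h1, h2, Or.inl h⟩
    · exact ⟨0, isHomogeneous_zero _ _ _, by rw [h, map_zero], Or.inr rfl⟩
  choose Q hQ hQq hQn using hlift
  have hsum : π p = ∑ b : t, q' b * b := by
    have : homogeneousComponent n (π p) = π p :=
      homogeneousComponent_eq_self (hp.map (Ideal.Quotient.mk J))
    rw [← this, ← hq, map_sum]
    exact Finset.sum_congr rfl fun b _ => hqq' b
  refine ⟨fun b => eval a (Q b), fun b => eval_mem_pow haJ (hQ b), ?_⟩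
  have hhom : (p - ∑ b : t, Q b * P b).IsHomogeneous n := by
    refine hp.sub (IsHomogeneous.sum _ _ _ fun b _ => ?_)
    rcases hQn b with h | h
    · have := (hQ b).mul (hP b)
      rwa [Nat.sub_add_cancel h] at this
    · rw [h, zero_mul]
      exact isHomogeneous_zero _ _ _
  have h1 := eval_mem_pow_succ haJ hhom (by
    change π _ = 0
    rw [map_sub, hsum, map_sum, sub_eq_zero]
    exact Finset.sum_congr rfl fun b _ => by rw [map_mul, hQq, hPb])
  have h2 : ∑ b : t, eval a (Q b) * (x b - eval a (P b)) ∈ J ^ (n + 1) := by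
    refine Ideal.sum_mem _ fun b _ => ?_
    rcases hQn b with h | h
    · have := Ideal.mul_mem_mul (eval_mem_pow haJ (hQ b)) (hxP b)
      rw [← pow_add] at this
      convert this using 2
      omega
    · rw [h, map_zero, zero_mul]; exact zero_mem _
  have h3 := sub_mem h1 h2
  convert h3 using 1
  simp only [map_sub, map_sum, map_mul, hpy, mul_sub, Finset.sum_sub_distrib]
  ring

theorem isNoetherianRing_of_isAdicComplete [IsAdicComplete J A] (hJ : J.FG)
    [IsNoetherianRing (A ⧸ J)] : IsNoetherianRing A := by
  classical
  refine ⟨fun 𝔞 => ?_⟩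
  obtain ⟨ι, _, x, d, hx, happ⟩ := exists_approx hJ 𝔞
  suffices h : 𝔞 = Ideal.span (Set.range x) by
    rw [h]; exact ⟨Finset.univ.image x, by simp⟩
  refine le_antisymm (fun y hy => ?_) (Ideal.span_le.2 (by rintro _ ⟨i, rfl⟩; exact hx i))
  choose! c hc hcy using happ
  let Y : ℕ → A := fun n => Nat.rec y (fun n z => z - ∑ i, c n z i * x i) n
  have hYs : ∀ n, Y (n + 1) = Y n - ∑ i, c n (Y n) i * x i := fun n => rfl
  have hY : ∀ n, Y n ∈ 𝔞 ∧ Y n ∈ J ^ n := by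
    intro n
    induction n with
    | zero => exact ⟨hy, by simp⟩
    | succ n ih =>
      exact ⟨sub_mem ih.1 (Ideal.sum_mem _ fun i _ => Ideal.mul_mem_left _ _ (hx i)),
        hcy n _ ih.1 ih.2⟩
  let s : ι → ℕ → A := fun i n => ∑ m ∈ Finset.range n, c m (Y m) i
  have hsY : ∀ n, y - ∑ i, s i n * x i = Y n := by
    intro n
    induction n with
    | zero => simp [s, Y]
    | succ n ih =>
      have : ∀ i, s i (n + 1) * x i = s i n * x i + c n (Y n) i * x i := fun i => by
        simp only [s, Finset.sum_range_succ, add_mul]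
      rw [hYs, Finset.sum_congr rfl fun i _ => this i, Finset.sum_add_distrib, ← sub_sub, ih]
  have hcau : ∀ i m n, m ≤ n → s i n - s i m ∈ J ^ (m - d i) := by
    intro i m n hmn
    induction n, hmn using Nat.le_induction with
    | base => simp
    | succ n hmn ih =>
      have : s i (n + 1) - s i m = (s i n - s i m) + c n (Y n) i := by
        simp only [s, Finset.sum_range_succ]; ring
      rw [this]
      exact add_mem ih (Ideal.pow_le_pow_right (by omega) (hc n _ (hY n).1 (hY n).2 i))
  have hlim : ∀ i, ∃ L : A, ∀ n, s i (n + d i) - L ∈ J ^ n := by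
    intro i
    obtain ⟨L, hL⟩ := IsPrecomplete.prec' (I := J) (M := A) (fun n => s i (n + d i)) (by
      intro m n hmn
      rw [SModEq.sub_mem, smul_eq_mul, Ideal.mul_top, ← neg_sub]
      refine neg_mem ?_
      have := hcau i (m + d i) (n + d i) (by omega)
      rwa [Nat.add_sub_cancel] at this)
    refine ⟨L, fun n => ?_⟩
    have := hL n
    rwa [SModEq.sub_mem, smul_eq_mul, Ideal.mul_top] at this
  choose L hL using hlim
  have hz : y - ∑ i, L i * x i = 0 := by
    refine IsHausdorff.haus' (I := J) (M := A) _ fun n => ?_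
    rw [SModEq.zero, smul_eq_mul, Ideal.mul_top]
    set D := ∑ i, d i
    have hD : ∀ i, d i ≤ D := fun i => Finset.single_le_sum (fun _ _ => Nat.zero_le _)
      (Finset.mem_univ i)
    have h1 : ∀ i, s i (n + D) - L i ∈ J ^ n := fun i => by
      have := hL i (n + D - d i)
      rw [Nat.sub_add_cancel ((hD i).trans (Nat.le_add_left _ _))] at this
      exact Ideal.pow_le_pow_right (by have := hD i; omega) this
    have h2 : Y (n + D) + ∑ i, (s i (n + D) - L i) * x i ∈ J ^ n :=
      add_mem (Ideal.pow_le_pow_right (by omega) (hY (n + D)).2)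
        (Ideal.sum_mem _ fun i _ => Ideal.mul_mem_right _ _ (h1 i))
    rw [← hsY] at h2
    convert h2 using 1
    simp only [sub_mul, Finset.sum_sub_distrib]
    ring
  rw [sub_eq_zero.1 hz]
  exact Ideal.sum_mem _ fun i _ => Ideal.mul_mem_left _ _ (Ideal.subset_span ⟨i, rfl⟩)

end Noetherian

end GFD

namespace GFD

open TensorProduct IsLocalRing

section Killed

variable {R : Type u} [CommRing R] {𝔪 : Ideal R}

theorem exists_extend_of_killed [𝔪.IsMaximal] {P C Y : Type u} [AddCommGroup P] [Module R P]
    [AddCommGroup C] [Module R C] [AddCommGroup Y] [Module R Y] (f : C →ₗ[R] P)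
    (φ : C →ₗ[R] Y) (h : ∀ c, f c ∈ 𝔪 • (⊤ : Submodule R P) → φ c = 0) :
    ∃ ψ : P →ₗ[R] Y, ψ ∘ₗ f = φ := by
  let _ : Field (R ⧸ 𝔪) := Ideal.Quotient.field 𝔪
  let Q := P ⧸ (𝔪 • ⊤ : Submodule R P)
  let u : C →ₗ[R] Q := Submodule.mkQ _ ∘ₗ f
  let U : Submodule (R ⧸ 𝔪) Q :=
    { LinearMap.range u with
      smul_mem' := fun c x hx => by
        obtain ⟨r, rfl⟩ := Ideal.Quotient.mk_surjective c
        exact (LinearMap.range u).smul_mem r hx }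
  obtain ⟨g, hg⟩ := LinearMap.exists_extend (LinearMap.id : U →ₗ[R ⧸ 𝔪] U)
  let q : C →ₗ[R] U :=
    { toFun := fun c => ⟨u c, ⟨c, rfl⟩⟩
      map_add' := fun a b => Subtype.ext (map_add u a b)
      map_smul' := fun r a => Subtype.ext (map_smul u r a) }
  have hq : Function.Surjective q := by
    rintro ⟨_, c, rfl⟩
    exact ⟨c, rfl⟩
  have hker : LinearMap.ker q ≤ LinearMap.ker φ := by
    intro c hc
    refine h c ?_
    have : u c = 0 := congrArg Subtype.val (LinearMap.mem_ker.1 hc)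
    exact (Submodule.Quotient.mk_eq_zero _).1 this
  refine ⟨(LinearMap.ker q).liftQ φ hker ∘ₗ (q.quotKerEquivOfSurjective hq).symm.toLinearMap ∘ₗ
    g.restrictScalars R ∘ₗ Submodule.mkQ _, ?_⟩
  ext c
  have h1 : g (u c) = q c := LinearMap.congr_fun hg (q c)
  have h2 : (q.quotKerEquivOfSurjective hq).symm (q c) = (LinearMap.ker q).mkQ c := by
    rw [LinearEquiv.symm_apply_eq]; rfl
  change (LinearMap.ker q).liftQ φ hker ((q.quotKerEquivOfSurjective hq).symm (g (u c))) = φ c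
  rw [h1, h2]
  rfl

theorem ev_one_quotient_of_killed [𝔪.IsMaximal] {P : Type u} [CommRing P] [Algebra R P]
    [Module.Projective R P] {𝔠 : Ideal P}
    (hc : 𝔠 ⊓ 𝔪.map (algebraMap R P) ≤ 𝔪.map (algebraMap R P) * 𝔠) (n : ℕ)
    {Y : Type u} [AddCommGroup Y] [Module R Y] (hY : ∀ r ∈ 𝔪 ^ n, ∀ y : Y, r • y = 0) :
    EV R 1 (P ⧸ 𝔠) Y := by
  induction n generalizing Y with
  | zero =>
    have : Subsingleton Y := ⟨fun a b => by
      rw [← one_smul R a, ← one_smul R b, hY 1 (by simp), hY 1 (by simp)]⟩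
    exact EV.of_subsingleton_right
  | succ n ih =>
    let N : Submodule R Y := 𝔪 • ⊤
    refine (SES.ofSub N).ev_mid' (ih fun r hr y => ?_) ?_
    · refine Subtype.ext ?_
      change r • (y : Y) = 0
      refine Submodule.smul_induction_on y.2 (fun a ha z _ => ?_) fun a b ha hb => ?_
      · rw [← mul_smul]
        exact hY _ (by rw [pow_succ]; exact Ideal.mul_mem_mul hr ha) z
      · rw [smul_add, ha, hb, add_zero]
    · let f : 𝔠 →ₗ[R] P := (Submodule.subtype 𝔠).restrictScalars R
      have hs : SES f (Ideal.Quotient.mkₐ R 𝔠).toLinearMap :=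
        ⟨Subtype.val_injective, fun x => by
          simp only [AlgHom.toLinearMap_apply, Ideal.Quotient.mkₐ_eq_mk,
            Ideal.Quotient.eq_zero_iff_mem]
          exact ⟨fun h => ⟨⟨x, h⟩, rfl⟩, by rintro ⟨⟨x, h⟩, rfl⟩; exact h⟩,
          Ideal.Quotient.mk_surjective⟩
      refine hs.ev_one (EV.of_projective 0) fun φ => exists_extend_of_killed (𝔪 := 𝔪) f φ ?_
      intro c hfc
      have h1 : (c : P) ∈ 𝔪.map (algebraMap R P) := by
        have : (c : P) ∈ (𝔪 • ⊤ : Submodule R P) := hfc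
        rwa [Ideal.smul_top_eq_map] at this
      have h2 : ((c : P)) ∈ 𝔪.map (algebraMap R P) * 𝔠 := hc ⟨c.2, h1⟩
      have h3 : (c : P) ∈ Submodule.map f (𝔪 • ⊤ : Submodule R 𝔠) := by
        refine Submodule.mul_induction_on h2 (fun a ha b hb => ?_) fun a b ha hb => add_mem ha hb
        rw [Ideal.map] at ha
        induction ha using Submodule.span_induction generalizing b with
        | mem x hx =>
          obtain ⟨r, hr, rfl⟩ := hx
          refine ⟨r • ⟨b, hb⟩, Submodule.smul_mem_smul hr trivial, ?_⟩
          change r • b = _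
          rw [Algebra.smul_def]
        | zero => rw [zero_mul]; exact zero_mem _
        | add x y _ _ hx hy => rw [add_mul]; exact add_mem (hx b hb) (hy b hb)
        | smul p x _ hx =>
          rw [smul_eq_mul, mul_comm p, mul_assoc]
          exact hx _ (Ideal.mul_mem_left _ _ hb)
      obtain ⟨c', hc', hcc'⟩ := h3
      obtain rfl : c' = c := Subtype.ext hcc'
      refine Submodule.smul_induction_on hc' (fun r hr z _ => ?_) fun a b ha hb => ?_
      · rw [map_smul]
        obtain ⟨w, hw⟩ := Submodule.mkQ_surjective _ (φ z)
        rw [← hw, ← map_smul, Submodule.mkQ_apply, Submodule.Quotient.mk_eq_zero]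
        exact Submodule.smul_mem_smul hr trivial
      · rw [map_add, ha, hb, add_zero]

/-- `T` has no torsion against modules killed by a power of `𝔪`. -/
def PowFlat (𝔪 : Ideal R) (T : Type u) [AddCommGroup T] [Module R T] : Prop :=
  ∀ (n : ℕ) (Y : Type u) [AddCommGroup Y] [Module R Y] (_ : ∀ r ∈ 𝔪 ^ n, ∀ y : Y, r • y = 0)
    (N : Submodule R Y), Function.Injective (N.subtype.lTensor T)

theorem PowFlat.quotient [𝔪.IsMaximal] {P : Type u} [CommRing P] [Algebra R P]
    [Module.Projective R P] {𝔠 : Ideal P}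
    (hc : 𝔠 ⊓ 𝔪.map (algebraMap R P) ≤ 𝔪.map (algebraMap R P) * 𝔠) :
    PowFlat 𝔪 (P ⧸ 𝔠) := by
  intro n Y _ _ hY N
  rw [← lift_dual_iff_lTensor]
  refine (SES.ofSub N).dual.lift (ev_one_quotient_of_killed hc n fun r hr y => ?_)
  ext z
  rw [CharacterModule.smul_apply]
  obtain ⟨w, rfl⟩ := Submodule.mkQ_surjective _ z
  rw [← map_smul, hY r hr, map_zero, map_zero]
  rfl

theorem exists_factor_of_dense {T A : Type u} {Z : Type v} [AddCommGroup T] [Module R T] [AddCommGroup A]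
    [Module R A] [AddCommGroup Z] [Module R Z] (ι : T →ₗ[R] A) (I : Submodule R A)
    (hI : ∀ a : A, ∃ t : T, a - ι t ∈ I) (φ : T →ₗ[R] Z) (hφ : ∀ t, ι t ∈ I → φ t = 0) :
    ∃ b : A →ₗ[R] Z, ∀ t, b (ι t) = φ t := by
  have hκ : Function.Surjective (I.mkQ ∘ₗ ι) := by
    intro x
    obtain ⟨a, rfl⟩ := I.mkQ_surjective x
    obtain ⟨t, ht⟩ := hI a
    refine ⟨t, ?_⟩
    symm
    rw [← sub_eq_zero, LinearMap.comp_apply, ← map_sub]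
    exact (Submodule.Quotient.mk_eq_zero _).2 ht
  have hle : LinearMap.ker (I.mkQ ∘ₗ ι) ≤ LinearMap.ker φ := fun t ht =>
    hφ t ((Submodule.Quotient.mk_eq_zero _).1 (LinearMap.mem_ker.1 ht))
  refine ⟨(LinearMap.ker (I.mkQ ∘ₗ ι)).liftQ φ hle ∘ₗ
    ((I.mkQ ∘ₗ ι).quotKerEquivOfSurjective hκ).symm.toLinearMap ∘ₗ I.mkQ, fun t => ?_⟩
  have h2 : ((I.mkQ ∘ₗ ι).quotKerEquivOfSurjective hκ).symm (I.mkQ (ι t)) =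
      (LinearMap.ker (I.mkQ ∘ₗ ι)).mkQ t := by
    rw [LinearEquiv.symm_apply_eq]; rfl
  rw [LinearMap.comp_apply, LinearMap.comp_apply, LinearEquiv.coe_coe, h2]
  rfl

theorem PowFlat.of_adic {T A : Type u} [CommRing T] [CommRing A] [Algebra R T] [Algebra R A]
    (ι : T →ₐ[R] A) (hT : PowFlat 𝔪 T)
    (hsurj : ∀ n, ∀ a : A, ∃ t : T, a - ι t ∈ (𝔪 ^ n).map (algebraMap R A))
    (hinj : ∀ n, ∀ t : T, ι t ∈ (𝔪 ^ n).map (algebraMap R A) → t ∈ (𝔪 ^ n).map (algebraMap R T)) :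
    PowFlat 𝔪 A := by
  intro n Y _ _ hY N
  have hkill : ∀ (B : Type u) [CommRing B] [Algebra R B] (Z : Type u) [AddCommGroup Z] [Module R Z]
      (_ : ∀ r ∈ 𝔪 ^ n, ∀ y : Z, r • y = 0) (b : B) (z : Z),
      b ∈ (𝔪 ^ n).map (algebraMap R B) → b ⊗ₜ[R] z = 0 := by
    intro B _ _ Z _ _ hZ b z hb
    have : b ∈ ((𝔪 ^ n) • ⊤ : Submodule R B) := by
      rw [Ideal.smul_top_eq_map]; exact hb
    refine Submodule.smul_induction_on this (fun r hr c _ => ?_) fun a b ha hb => ?_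
    · rw [smul_tmul, hZ r hr, tmul_zero]
    · rw [add_tmul, ha, hb, add_zero]
  have hsur : ∀ (Z : Type u) [AddCommGroup Z] [Module R Z]
      (_ : ∀ r ∈ 𝔪 ^ n, ∀ y : Z, r • y = 0),
      Function.Surjective (ι.toLinearMap.rTensor Z) := by
    intro Z _ _ hZ w
    induction w with
    | zero => exact ⟨0, map_zero _⟩
    | add a b ha hb =>
      obtain ⟨a, rfl⟩ := ha
      obtain ⟨b, rfl⟩ := hb
      exact ⟨a + b, map_add _ _ _⟩
    | tmul a z =>
      obtain ⟨t, ht⟩ := hsurj n a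
      refine ⟨t ⊗ₜ z, ?_⟩
      have := hkill A Z hZ _ z ht
      rw [sub_tmul, sub_eq_zero] at this
      rw [this]; rfl
  have hin : Function.Injective (ι.toLinearMap.rTensor Y) := by
    obtain ⟨b, hb⟩ := exists_factor_of_dense (Z := Y →ₗ[R] T ⊗[R] Y) ι.toLinearMap
      (((𝔪 ^ n).map (algebraMap R A)).restrictScalars R) (hsurj n) (TensorProduct.mk R T Y)
      (fun t ht => LinearMap.ext fun y => by exact hkill T Y hY t y (hinj n t ht))
    have hl : (TensorProduct.lift b) ∘ₗ (ι.toLinearMap.rTensor Y) = LinearMap.id := by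
      refine TensorProduct.ext' fun t y => ?_
      rw [LinearMap.comp_apply, LinearMap.rTensor_tmul, TensorProduct.lift.tmul, hb]
      rfl
    exact Function.LeftInverse.injective (LinearMap.congr_fun hl)
  rw [injective_iff_map_eq_zero]
  intro z hz
  obtain ⟨w, rfl⟩ := hsur N (fun r hr y => Subtype.ext (hY r hr y)) z
  have h1 : ι.toLinearMap.rTensor Y (N.subtype.lTensor T w) = 0 := by
    rw [← LinearMap.comp_apply, LinearMap.rTensor_comp_lTensor, ← LinearMap.lTensor_comp_rTensor]
    exact hz
  have h2 := hin (h1.trans (map_zero _).symm)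
  rw [hT n Y hY N (h2.trans (map_zero _).symm), map_zero]

end Killed

end GFD

namespace GFD

open TensorProduct IsLocalRing

section LiftOfAlgebra

theorem exists_powFlat_cover {R S : Type u} [CommRing R] [CommRing S] [IsLocalRing S] [Algebra R S]
    {𝔪 : Ideal R} [𝔪.IsMaximal] (hm : 𝔪 = (maximalIdeal S).comap (algebraMap R S))
    (hn : maximalIdeal S = 𝔪.map (algebraMap R S)) :
    ∃ (T : Type u) (_ : CommRing T) (_ : Algebra R T) (φ : T →ₐ[R] S),
      (𝔪.map (algebraMap R T)).IsMaximal ∧ PowFlat 𝔪 T ∧ Function.Surjective φ := by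
  obtain ⟨𝔠, h𝔠⟩ := exists_liftInv_univ hm hn
  let ev : MvPolynomial S R →ₐ[R] S := MvPolynomial.aeval (R := R) (id : S → S)
  let φ : (MvPolynomial S R ⧸ 𝔠) →ₐ[R] S := Ideal.Quotient.liftₐ 𝔠 ev h𝔠.le_ker
  have hφ : Function.Surjective φ := fun s =>
    ⟨Ideal.Quotient.mk 𝔠 (MvPolynomial.X s), by
      change ev (MvPolynomial.X s) = s
      simp [ev]⟩
  have hker : ∀ p, residue S (ev p) = 0 ↔ p ∈ 𝔠 ⊔ polyIdeal S 𝔪 := by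
    intro p
    rw [← h𝔠.ker_iff]
    have : partialResidue R (Set.univ : Set S) p = MvPolynomial.C (residue S (ev p)) := by
      have h1 : (partialResidue R (Set.univ : Set S)).toRingHom =
          (MvPolynomial.C.comp (residue S)).comp ev.toRingHom := by
        refine MvPolynomial.ringHom_ext (fun r => ?_) fun s => ?_
        · change partialResidue R (Set.univ : Set S) (MvPolynomial.C r) = _
          rw [partialResidue_C]
          simp [ev]
        · change partialResidue R (Set.univ : Set S) (MvPolynomial.X s) = _
          rw [partialResidue_X_mem (Set.mem_univ s)]
          simp [ev]
      exact RingHom.congr_fun h1 p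
    rw [this, MvPolynomial.C_eq_zero]
  refine ⟨MvPolynomial S R ⧸ 𝔠, inferInstance, inferInstance, φ, ?_, ?_, hφ⟩
  · have h1 : 𝔪.map (algebraMap R (MvPolynomial S R ⧸ 𝔠)) =
        RingHom.ker ((residue S).comp φ.toRingHom) := by
      ext x
      obtain ⟨p, rfl⟩ := Ideal.Quotient.mk_surjective x
      rw [RingHom.mem_ker]
      change _ ↔ residue S (ev p) = 0
      rw [hker, IsScalarTower.algebraMap_eq R (MvPolynomial S R) (MvPolynomial S R ⧸ 𝔠),
        ← Ideal.map_map, MvPolynomial.algebraMap_eq]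
      change Ideal.Quotient.mk 𝔠 p ∈ (polyIdeal S 𝔪).map (Ideal.Quotient.mk 𝔠) ↔ _
      rw [← Ideal.mem_comap, Ideal.comap_map_of_surjective _ Ideal.Quotient.mk_surjective,
        ← RingHom.ker_eq_comap_bot, Ideal.mk_ker, sup_comm]
    rw [h1]
    exact RingHom.ker_isMaximal_of_surjective _ (residue_surjective.comp hφ)
  · exact PowFlat.quotient h𝔠.inf_le

theorem exists_lift_completion {T : Type u} {C : Type v} [CommRing T] [CommRing C] (I : Ideal T)
    (J : Ideal C) [IsAdicComplete J C] (φ : T →+* C) (hφ : I.map φ ≤ J) :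
    ∃ h : AdicCompletion I T →+* C, ∀ t, h (algebraMap T _ t) = φ t := by
  have hn : ∀ n, ∀ a ∈ I ^ n, (Ideal.Quotient.mk (J ^ n)).comp φ a = 0 := by
    intro n a ha
    refine Ideal.Quotient.eq_zero_iff_mem.2 (Ideal.pow_right_mono hφ n ?_)
    rw [← Ideal.map_pow]
    exact Ideal.mem_map_of_mem φ ha
  let f : (n : ℕ) → AdicCompletion I T →+* C ⧸ J ^ n := fun n =>
    (Ideal.Quotient.lift (I ^ n) ((Ideal.Quotient.mk (J ^ n)).comp φ) (hn n)).comp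
      (AdicCompletion.evalₐ I n).toRingHom
  have hf : ∀ n t, f n (algebraMap T _ t) = Ideal.Quotient.mk (J ^ n) (φ t) := by
    intro n t
    change Ideal.Quotient.lift (I ^ n) _ (hn n) (AdicCompletion.evalₐ I n (algebraMap T _ t)) = _
    rw [AlgHom.commutes]
    rfl
  have hc : ∀ {m n : ℕ} (hle : m ≤ n), (Ideal.Quotient.factorPow J hle).comp (f n) = f m := by
    intro m n hle
    ext x
    obtain ⟨x, rfl⟩ := AdicCompletion.mk_surjective I T x
    change Ideal.Quotient.factorPow J hle (Ideal.Quotient.lift (I ^ n) _ (hn n)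
      (AdicCompletion.evalₐ I n (AdicCompletion.mk I T x))) = Ideal.Quotient.lift (I ^ m) _ (hn m)
      (AdicCompletion.evalₐ I m (AdicCompletion.mk I T x))
    rw [AdicCompletion.evalₐ_mk, AdicCompletion.evalₐ_mk, Ideal.Quotient.lift_mk,
      Ideal.Quotient.lift_mk]
    change Ideal.Quotient.mk (J ^ m) (φ (x n)) = Ideal.Quotient.mk (J ^ m) (φ (x m))
    have := AdicCompletion.Ideal.mk_eq_mk I hle x
    rw [Ideal.Quotient.eq] at this ⊢
    rw [← map_sub]
    exact Ideal.Quotient.eq_zero_iff_mem.1 (hn m _ this)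
  refine ⟨IsAdicComplete.liftRingHom J f hc, fun t => ?_⟩
  rw [← sub_eq_zero]
  refine IsHausdorff.haus (I := J) inferInstance _ fun n => ?_
  rw [SModEq.zero, smul_eq_mul, Ideal.mul_top, ← Ideal.Quotient.eq_zero_iff_mem, map_sub,
    IsAdicComplete.mk_liftRingHom, hf, sub_self]

theorem PowFlat.flat {R A : Type u} [CommRing R] [IsNoetherianRing R] [CommRing A]
    [IsNoetherianRing A] [IsLocalRing A] [Algebra R A] {𝔪 : Ideal R}
    (hm : 𝔪.map (algebraMap R A) ≤ maximalIdeal A) (h : PowFlat 𝔪 A) : Module.Flat R A := by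
  rw [Module.Flat.iff_lTensor_injective']
  intro 𝔞
  rw [injective_iff_map_eq_zero]
  intro z hz
  have hmem : z ∈ (⨅ n : ℕ, maximalIdeal A ^ n • ⊤ : Submodule A (A ⊗[R] 𝔞)) := by
    rw [Submodule.mem_iInf]
    intro n
    obtain ⟨k, hk⟩ := Ideal.exists_pow_inf_eq_pow_smul 𝔪 (𝔞 : Submodule R R)
    let Y := R ⧸ 𝔪 ^ (n + k)
    let q : 𝔞 →ₗ[R] Y := (𝔪 ^ (n + k)).mkQ ∘ₗ 𝔞.subtype
    have hY : ∀ r ∈ 𝔪 ^ (n + k), ∀ y : Y, r • y = 0 := by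
      intro r hr y
      obtain ⟨s, rfl⟩ := Ideal.Quotient.mk_surjective y
      exact Ideal.Quotient.eq_zero_iff_mem.2 (Ideal.mul_mem_right _ _ hr)
    have h1 : (LinearMap.range q).subtype.lTensor A (q.rangeRestrict.lTensor A z) = 0 := by
      rw [← LinearMap.comp_apply, ← LinearMap.lTensor_comp]
      change ((𝔪 ^ (n + k)).mkQ ∘ₗ 𝔞.subtype).lTensor A z = 0
      rw [LinearMap.lTensor_comp, LinearMap.comp_apply, hz, map_zero]
    have h2 := h _ Y hY (LinearMap.range q) (h1.trans (map_zero _).symm)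
    have h3 := (lTensor_exact A (LinearMap.exact_subtype_ker_map q.rangeRestrict)
      q.surjective_rangeRestrict z).1 h2
    obtain ⟨w, rfl⟩ := h3
    have h4 : ∀ x : LinearMap.ker q.rangeRestrict, (x : 𝔞) ∈ (𝔪 ^ n • ⊤ : Submodule R 𝔞) := by
      rintro ⟨x, hx⟩
      have hx1 : (x : R) ∈ 𝔪 ^ (n + k) := by
        rw [LinearMap.ker_rangeRestrict] at hx
        exact (Submodule.Quotient.mk_eq_zero _).1 (LinearMap.mem_ker.1 hx)
      have hx2 : (x : R) ∈ (𝔪 ^ (n + k) • ⊤ ⊓ 𝔞 : Submodule R R) :=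
        ⟨by rw [smul_eq_mul, Ideal.mul_top]; exact hx1, x.2⟩
      rw [hk (n + k) (Nat.le_add_left _ _), Nat.add_sub_cancel] at hx2
      have hx3 : (x : R) ∈ (𝔪 ^ n • ⊤ : Submodule R 𝔞).map 𝔞.subtype := by
        rw [Submodule.map_smul'', Submodule.map_top, Submodule.range_subtype]
        exact Submodule.smul_mono le_rfl inf_le_right hx2
      obtain ⟨y, hy, hyx⟩ := hx3
      obtain rfl : y = x := Subtype.ext hyx
      exact hy
    have h5 : ∀ (a : A) (x : 𝔞), x ∈ (𝔪 ^ n • ⊤ : Submodule R 𝔞) →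
        a ⊗ₜ[R] x ∈ (maximalIdeal A ^ n • ⊤ : Submodule A (A ⊗[R] 𝔞)) := by
      intro a x hx
      refine Submodule.smul_induction_on hx (fun r hr y _ => ?_) fun x y hx hy => ?_
      · rw [← smul_tmul, Algebra.smul_def, ← smul_eq_mul, ← smul_tmul']
        refine Submodule.smul_mem_smul (Ideal.pow_right_mono hm n ?_) trivial
        rw [← Ideal.map_pow]
        exact Ideal.mem_map_of_mem _ hr
      · rw [tmul_add]; exact add_mem hx hy
    clear hz h1 h2
    induction w with
    | zero => rw [map_zero]; exact zero_mem _
    | add a b ha hb => rw [map_add]; exact add_mem ha hb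
    | tmul a x => exact h5 a x (h4 x)
  rwa [Ideal.iInf_pow_smul_eq_bot_of_isLocalRing _ (maximalIdeal.isMaximal A).ne_top,
    Submodule.mem_bot] at hmem

theorem mem_map_pow_iff_evalₐ {T : Type u} [CommRing T] {I : Ideal T} (hI : I.FG) (n : ℕ)
    (x : AdicCompletion I T) :
    x ∈ (I ^ n).map (algebraMap T (AdicCompletion I T)) ↔ AdicCompletion.evalₐ I n x = 0 := by
  have h1 : (I ^ n • ⊤ : Submodule T (AdicCompletion I T)) = LinearMap.ker (AdicCompletion.eval I T n) :=
    AdicCompletion.pow_smul_top_eq_ker_eval hI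
  have h2 : x ∈ (I ^ n).map (algebraMap T (AdicCompletion I T)) ↔
      x ∈ (I ^ n • ⊤ : Submodule T (AdicCompletion I T)) := by
    rw [Ideal.smul_top_eq_map]; rfl
  rw [h2, h1, LinearMap.mem_ker]
  obtain ⟨x, rfl⟩ := AdicCompletion.mk_surjective I T x
  rw [AdicCompletion.evalₐ_mk, Ideal.Quotient.eq_zero_iff_mem]
  change Submodule.Quotient.mk (x n) = 0 ↔ _
  rw [Submodule.Quotient.mk_eq_zero, smul_eq_mul, Ideal.mul_top]

theorem exists_completionHom_sub_mem (S : Type u) [CommRing S] [IsLocalRing S] [IsNoetherianRing S]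
    (c : AdicCompletion (maximalIdeal S) S) :
    ∃ s, completionHom S s - c ∈ maximalIdeal (AdicCompletion (maximalIdeal S) S) := by
  obtain ⟨s, hs⟩ := Ideal.Quotient.mk_surjective (AdicCompletion.evalₐ (maximalIdeal S) 1 c)
  refine ⟨s, ?_⟩
  rw [AdicCompletion.maximalIdeal_eq_map]
  have := mem_map_pow_iff_evalₐ (IsNoetherian.noetherian (maximalIdeal S)) 1 (completionHom S s - c)
  refine Ideal.map_mono (Ideal.pow_le_self one_ne_zero) (this.2 ?_)
  rw [map_sub, ← hs, sub_eq_zero]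
  exact AlgHom.commutes (AdicCompletion.evalₐ (maximalIdeal S) 1) s

/-- A local algebra whose maximal ideal is extended from the base is, after completion, a quotient
of a flat complete local algebra with the same extended maximal ideal. -/
theorem exists_flat_complete_cover {R S : Type u} [CommRing R] [IsNoetherianRing R] [CommRing S]
    [IsLocalRing S] [IsNoetherianRing S] [Algebra R S] {𝔪 : Ideal R} [𝔪.IsMaximal]
    (hm : 𝔪 = (maximalIdeal S).comap (algebraMap R S))
    (hn : maximalIdeal S = 𝔪.map (algebraMap R S)) :
    ∃ (A : Type u) (_ : CommRing A) (_ : Algebra R A) (_ : IsNoetherianRing A)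
      (_ : IsLocalRing A), Module.Flat R A ∧ 𝔪.map (algebraMap R A) = maximalIdeal A ∧
      IsAdicComplete (maximalIdeal A) A ∧
      ∃ h : A →+* AdicCompletion (maximalIdeal S) S, Function.Surjective h ∧
        ∀ r, h (algebraMap R A r) = completionHom S (algebraMap R S r) := by
  obtain ⟨T, _, _, φ, hmax, hflat, hφ⟩ := exists_powFlat_cover hm hn
  set I := 𝔪.map (algebraMap R T) with hI
  have hfg : I.FG := Ideal.FG.map (IsNoetherian.noetherian 𝔪) _
  let A := AdicCompletion I T
  have hIA : ∀ n, (𝔪 ^ n).map (algebraMap R A) = (I ^ n).map (algebraMap T A) := by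
    intro n
    have : I ^ n = (𝔪 ^ n).map (algebraMap R T) := (Ideal.map_pow _ _ _).symm
    rw [this, Ideal.map_map, ← IsScalarTower.algebraMap_eq]
  have hIA1 : 𝔪.map (algebraMap R A) = I.map (algebraMap T A) := by
    have := hIA 1
    rwa [pow_one, pow_one] at this
  have hAm : (I.map (algebraMap T A)).IsMaximal :=
    AdicCompletion.isMaximal_map_of_le I I le_rfl hfg
  have hAc : IsAdicComplete (I.map (algebraMap T A)) A := AdicCompletion.isAdicComplete_self I hfg
  have hAl : IsLocalRing A := isLocalRing_of_isAdicComplete_maximal (I.map (algebraMap T A))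
  have hAe : I.map (algebraMap T A) = maximalIdeal A := eq_maximalIdeal hAm
  have hAn : IsNoetherianRing A := by
    let _ : Field (A ⧸ I.map (algebraMap T A)) := Ideal.Quotient.field _
    exact isNoetherianRing_of_isAdicComplete (J := I.map (algebraMap T A)) (Ideal.FG.map hfg _)
  have hPF : PowFlat 𝔪 A := by
    refine PowFlat.of_adic (IsScalarTower.toAlgHom R T A) hflat (fun n a => ?_) fun n t ht => ?_
    · obtain ⟨t, ht⟩ := Ideal.Quotient.mk_surjective (AdicCompletion.evalₐ I n a)
      refine ⟨t, ?_⟩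
      rw [hIA, mem_map_pow_iff_evalₐ hfg, map_sub, ← ht, sub_eq_zero]
      exact (AlgHom.commutes (AdicCompletion.evalₐ I n) t).symm
    · rw [hIA, mem_map_pow_iff_evalₐ hfg] at ht
      have h1 : AdicCompletion.evalₐ I n (algebraMap T A t) = 0 := ht
      rw [AlgHom.commutes] at h1
      have h2 : t ∈ I ^ n := Ideal.Quotient.eq_zero_iff_mem.1 h1
      rwa [hI, ← Ideal.map_pow] at h2
  let C := AdicCompletion (maximalIdeal S) S
  have hIS : I.map φ.toRingHom = maximalIdeal S := by
    rw [hI, Ideal.map_map, hn]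
    congr 1
    exact φ.comp_algebraMap
  have hIC : I.map ((completionHom S).comp φ.toRingHom) = maximalIdeal C := by
    rw [← Ideal.map_map, hIS]
    exact (AdicCompletion.maximalIdeal_eq_map (R := S)).symm
  obtain ⟨h, hh⟩ := exists_lift_completion I (maximalIdeal C) ((completionHom S).comp φ.toRingHom)
    hIC.le
  have hmap : (I.map (algebraMap T A)).map h = maximalIdeal C := by
    rw [Ideal.map_map, ← hIC]
    congr 1
    exact RingHom.ext hh
  refine ⟨A, inferInstance, inferInstance, hAn, hAl, hPF.flat (hIA1.trans hAe).le,
    hIA1.trans hAe, hAe ▸ hAc, h, ?_, fun r => ?_⟩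
  · have : IsHausdorff ((I.map (algebraMap T A)).map h) C := by
      rw [hmap]; infer_instance
    refine surjective_of_mk_map_comp_surjective (I := I.map (algebraMap T A)) h ?_
    intro x
    obtain ⟨c, rfl⟩ := Ideal.Quotient.mk_surjective x
    obtain ⟨s, hs⟩ := exists_completionHom_sub_mem S c
    obtain ⟨t, rfl⟩ := hφ s
    refine ⟨algebraMap T A t, ?_⟩
    rw [RingHom.comp_apply, hh, Ideal.Quotient.eq, hmap]
    exact hs
  · rw [IsScalarTower.algebraMap_apply R T A, hh]
    change completionHom S (φ (algebraMap R T r)) = _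
    rw [AlgHom.commutes]

end LiftOfAlgebra

end GFD

namespace GFD

open TensorProduct IsLocalRing

section RestrictScalars

variable {R A : Type u} [CommRing R] [CommRing A] [Algebra R A]

theorem SES.restrict {X U V : Type u} [AddCommGroup X] [Module R X] [Module A X]
    [IsScalarTower R A X] [AddCommGroup U] [Module R U] [Module A U] [IsScalarTower R A U]
    [AddCommGroup V] [Module R V] [Module A V] [IsScalarTower R A V] {f : X →ₗ[A] U}
    {g : U →ₗ[A] V} (h : SES f g) : SES (f.restrictScalars R) (g.restrictScalars R) :=
  ⟨h.inj, h.exact, h.surj⟩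

theorem injective_rTensor_cancel_iff {X U V : Type u} [AddCommGroup X] [Module R X] [Module A X]
    [IsScalarTower R A X] [AddCommGroup U] [Module R U] [Module A U] [IsScalarTower R A U]
    [AddCommGroup V] [Module R V] (f : X →ₗ[A] U) :
    Function.Injective (f.rTensor (A ⊗[R] V)) ↔
      Function.Injective ((f.restrictScalars R).rTensor V) := by
  have key : ⇑((f.restrictScalars R).rTensor V) ∘
      ⇑(AlgebraTensorModule.cancelBaseChange R A A X V) =
      ⇑(AlgebraTensorModule.cancelBaseChange R A A U V) ∘ ⇑(f.rTensor (A ⊗[R] V)) := by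
    have : (AlgebraTensorModule.rTensor R V f) ∘ₗ
        (AlgebraTensorModule.cancelBaseChange R A A X V).toLinearMap =
      (AlgebraTensorModule.cancelBaseChange R A A U V).toLinearMap ∘ₗ f.rTensor (A ⊗[R] V) := by
      ext; simp
    exact congrArg DFunLike.coe this
  rw [← Function.Injective.of_comp_iff' _
    (AlgebraTensorModule.cancelBaseChange R A A X V).bijective, key,
    Function.Injective.of_comp_iff (AlgebraTensorModule.cancelBaseChange R A A U V).injective]

theorem SES.ev_changeRing [Module.Flat R A] {X U Y V : Type u} [AddCommGroup X] [Module R X]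
    [Module A X] [IsScalarTower R A X] [AddCommGroup U] [Module R U] [Module A U]
    [IsScalarTower R A U] [AddCommGroup Y] [Module R Y] [Module A Y] [IsScalarTower R A Y]
    [AddCommGroup V] [Module R V] {f : X →ₗ[A] U} {g : U →ₗ[A] Y} (h : SES f g)
    [Module.Flat A U] :
    (EV R 1 Y (CharacterModule V) ↔ EV A 1 Y (CharacterModule (A ⊗[R] V))) ∧
    ∀ i, (EV R (i + 1) X (CharacterModule V) ↔ EV A (i + 1) X (CharacterModule (A ⊗[R] V))) →
      (EV R (i + 2) Y (CharacterModule V) ↔ EV A (i + 2) Y (CharacterModule (A ⊗[R] V))) := by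
  have := Module.Flat.trans R A U
  have h' := h.restrict (R := R)
  refine ⟨?_, fun i hi => ?_⟩
  · rw [h.ev_one_iff_rTensor (EV.of_flat 0), h'.ev_one_iff_rTensor (EV.of_flat 0)]
    exact (injective_rTensor_cancel_iff f).symm
  · rw [h.ev_shift (fun i => EV.of_flat i), h'.ev_shift (fun i => EV.of_flat i), hi]

/-- Change of rings for Ext into character modules along a flat algebra. -/
theorem ev_changeRing [Module.Flat R A] {V : Type u} [AddCommGroup V] [Module R V] (i : ℕ)
    {Y : Type u} [AddCommGroup Y] [Module R Y] [Module A Y] [IsScalarTower R A Y] :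
    EV R (i + 1) Y (CharacterModule V) ↔ EV A (i + 1) Y (CharacterModule (A ⊗[R] V)) := by
  induction i generalizing Y with
  | zero => exact (SES.freeCover (R := A) (X := Y)).ev_changeRing.1
  | succ i ih => exact (SES.freeCover (R := A) (X := Y)).ev_changeRing.2 i ih

end RestrictScalars

section InjectiveBaseChange

variable {R A : Type u} [CommRing R] [CommRing A] [Algebra R A] {E : Type u} [AddCommGroup E]
  [Module R E]

theorem ev_one_quotient_map [IsNoetherianRing R] [Module.Flat R A] (hE : Module.Injective R E)
    (𝔪 : Ideal R) : EV A 1 (A ⧸ 𝔪.map (algebraMap R A)) (A ⊗[R] E) := by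
  classical
  refine (SES.ofSub (𝔪.map (algebraMap R A) : Submodule A A)).ev_one (EV.of_projective 0)
    fun φ => ?_
  obtain ⟨n, f, hf⟩ := Submodule.fg_iff_exists_fin_generating_family.1 (IsNoetherian.noetherian 𝔪)
  obtain ⟨q, a, ha, ha'⟩ := exists_relations (R := R) f
  let α : E →ₗ[R] (Fin n → E) := LinearMap.pi fun i => f i • LinearMap.id
  let β : (Fin n → E) →ₗ[R] (Fin q → E) := LinearMap.pi fun k => ∑ i, a k i • LinearMap.proj i
  have hαβ : Function.Exact α β := by
    intro e
    constructor
    · intro he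
      have he' : ∀ k, ∑ i, a k i • e i = 0 := fun k => by
        have := congrFun he k
        simpa [β] using this
      obtain ⟨e₀, h₀⟩ := injective_solve hE f e (by
        intro y hy
        obtain ⟨b, hb⟩ := ha' y (by simpa using hy)
        simp_rw [hb, Finset.sum_smul, mul_smul]
        rw [Finset.sum_comm]
        simp_rw [← Finset.smul_sum, he', smul_zero, Finset.sum_const_zero])
      exact ⟨e₀, funext fun i => h₀ i⟩
    · rintro ⟨e₀, rfl⟩
      ext k
      have := congrArg (· • e₀) (ha k)
      simpa [β, α, Finset.sum_smul, mul_smul] using this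
  have hex := Module.Flat.lTensor_exact A hαβ
  have hmem : ∀ i, algebraMap R A (f i) ∈ 𝔪.map (algebraMap R A) := fun i =>
    Ideal.mem_map_of_mem _ (hf ▸ Submodule.subset_span ⟨i, rfl⟩)
  let x : Fin n → 𝔪.map (algebraMap R A) := fun i => ⟨_, hmem i⟩
  let e1 := TensorProduct.piRight R R A (fun _ : Fin n => E)
  let e2 := TensorProduct.piRight R R A (fun _ : Fin q => E)
  let w : A ⊗[R] (Fin n → E) := e1.symm fun i => φ (x i)
  have hα : ∀ t : A ⊗[R] E, ∀ i, e1 (α.lTensor A t) i = f i • t := by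
    intro t i
    induction t using TensorProduct.induction_on with
    | zero => simp
    | tmul b e => simp [e1, α, TensorProduct.tmul_smul]
    | add s t hs ht => rw [map_add, map_add, Pi.add_apply, hs, ht, smul_add]
  have hβ : ∀ t : A ⊗[R] (Fin n → E), ∀ k, e2 (β.lTensor A t) k = ∑ i, a k i • e1 t i := by
    intro t k
    induction t using TensorProduct.induction_on with
    | zero => simp
    | tmul b e => simp [e1, e2, β, TensorProduct.tmul_smul, TensorProduct.tmul_sum]
    | add s t hs ht =>
      rw [map_add, map_add, Pi.add_apply, hs, ht, ← Finset.sum_add_distrib]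
      simp [smul_add]
  have hw : β.lTensor A w = 0 := by
    apply e2.injective
    ext k
    rw [hβ, map_zero, Pi.zero_apply]
    simp only [w, LinearEquiv.apply_symm_apply]
    have h1 : ∑ i, algebraMap R A (a k i) • x i = 0 := by
      apply Subtype.ext
      have := congrArg (algebraMap R A) (ha k)
      simpa [x, Algebra.smul_def] using this
    have := congrArg φ h1
    simpa using this
  obtain ⟨t, ht⟩ := (hex w).1 hw
  refine ⟨LinearMap.toSpanSingleton A _ t, ?_⟩
  have hspan : Submodule.span A (Set.range x) = ⊤ := by
    apply Submodule.map_injective_of_injective (Submodule.subtype_injective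
      (𝔪.map (algebraMap R A) : Submodule A A))
    have hf' : 𝔪 = Ideal.span (Set.range f) := hf.symm
    rw [Submodule.map_span, Submodule.map_top, Submodule.range_subtype, ← Set.range_comp]
    conv_rhs => rw [hf', Ideal.map_span, ← Set.range_comp]
    rfl
  refine LinearMap.ext_on hspan ?_
  rintro _ ⟨i, rfl⟩
  have := hα t i
  rw [ht] at this
  simp only [w, LinearEquiv.apply_symm_apply] at this
  rw [this]
  simp [x]

theorem ev_one_of_pow_killed [IsNoetherianRing A] {𝔫 : Ideal A} [h𝔫 : 𝔫.IsMaximal] {W : Type u}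
    [AddCommGroup W] [Module A W] (hW : EV A 1 (A ⧸ 𝔫) W) (N : ℕ) {Y : Type u} [AddCommGroup Y]
    [Module A Y] [hY : Module.Finite A Y] (hk : ∀ a ∈ 𝔫 ^ N, ∀ y : Y, a • y = 0) : EV A 1 Y W := by
  revert hk
  induction hY using IsNoetherianRing.induction_on_isQuotientEquivQuotientPrime A with
  | subsingleton Y => exact fun _ => EV.of_subsingleton_left
  | quotient Y p e =>
    intro hk
    have : p.1 = 𝔫 := by
      refine (h𝔫.eq_of_le p.2.ne_top ?_).symm
      refine p.2.le_of_pow_le (n := N) fun a ha => ?_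
      have := hk a ha (e.symm (Ideal.Quotient.mk _ 1))
      rw [← map_smul, LinearEquiv.map_eq_zero_iff] at this
      rw [← Ideal.Quotient.eq_zero_iff_mem, ← this, Algebra.smul_def]
      simp
    rw [← this] at hW
    exact hW.congr_left e.symm
  | exact Y₁ Y₂ Y₃ f g hf hg hfg h₁ h₃ =>
    intro hk
    exact SES.ev_mid ⟨hf, hfg, hg⟩
      (h₁ fun a ha y => hf (by rw [map_smul, hk a ha, map_zero]))
      (h₃ fun a ha y => by obtain ⟨y, rfl⟩ := hg y; rw [← map_smul, hk a ha, map_zero])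

theorem smul_tmul_eq_zero {I : Ideal R} {e : E} (he : ∀ r ∈ I, r • e = 0) (b : A) {a : A}
    (ha : a ∈ I.map (algebraMap R A)) : a • b ⊗ₜ[R] e = 0 := by
  refine Submodule.span_induction (p := fun a _ => a • b ⊗ₜ[R] e = 0) ?_ ?_ ?_ ?_ ha
  · rintro _ ⟨r, hr, rfl⟩
    rw [algebraMap_smul, ← TensorProduct.tmul_smul, he r hr, TensorProduct.tmul_zero]
  · simp
  · intro x y _ _ hx hy
    rw [add_smul, hx, hy, add_zero]
  · intro c x _ hx
    rw [smul_assoc, hx, smul_zero]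

theorem injective_baseChange [IsNoetherianRing R] [IsNoetherianRing A] [Module.Flat R A]
    {𝔪 : Ideal R} (h𝔪 : (𝔪.map (algebraMap R A)).IsMaximal) {ε : E} (hE : IsHull 𝔪 E ε) :
    Module.Injective A (A ⊗[R] E) := by
  have hG : Gam (𝔪.map (algebraMap R A)) (A ⊗[R] E) = ⊤ := by
    rw [eq_top_iff]
    rintro t -
    induction t using TensorProduct.induction_on with
    | zero => exact zero_mem _
    | tmul b e =>
      obtain ⟨n, hn⟩ := hE.tors e
      refine ⟨n, fun a ha => ?_⟩
      rw [← Ideal.map_pow] at ha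
      exact smul_tmul_eq_zero hn b ha
    | add s t hs ht => exact add_mem hs ht
  have hi : Module.Injective A (Gam (𝔪.map (algebraMap R A)) (A ⊗[R] E)) := by
    refine injective_Gam_of_extend _ fun N b φ hφ => ?_
    set 𝔫 := 𝔪.map (algebraMap R A)
    let K : Submodule A (A ⧸ 𝔫 ^ N) := LinearMap.range ((𝔫 ^ N).mkQ ∘ₗ b.subtype)
    have hev : EV A 1 ((A ⧸ 𝔫 ^ N) ⧸ K) (A ⊗[R] E) := by
      refine ev_one_of_pow_killed (ev_one_quotient_map hE.inj 𝔪) N fun a ha y => ?_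
      obtain ⟨y, rfl⟩ := Submodule.mkQ_surjective _ y
      obtain ⟨y, rfl⟩ := Submodule.mkQ_surjective _ y
      rw [← map_smul, ← map_smul]
      have : (𝔫 ^ N).mkQ (a • y) = 0 := by
        rw [Submodule.mkQ_apply, Submodule.Quotient.mk_eq_zero]
        exact Ideal.mul_mem_right _ _ ha
      rw [this, map_zero]
    have hker : LinearMap.ker ((𝔫 ^ N).mkQ ∘ₗ b.subtype) ≤ LinearMap.ker φ := by
      intro y hy
      refine hφ y ?_
      rwa [LinearMap.mem_ker, LinearMap.comp_apply, Submodule.mkQ_apply,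
        Submodule.Quotient.mk_eq_zero] at hy
    let φ' : K →ₗ[A] A ⊗[R] E := (LinearMap.ker ((𝔫 ^ N).mkQ ∘ₗ b.subtype)).liftQ φ hker ∘ₗ
      ((𝔫 ^ N).mkQ ∘ₗ b.subtype).quotKerEquivRange.symm.toLinearMap
    obtain ⟨θ, hθ⟩ := (SES.ofSub K).extend hev φ'
    refine ⟨θ, fun y => ?_⟩
    have h1 := LinearMap.congr_fun hθ ⟨_, y, rfl⟩
    have h2 : ((𝔫 ^ N).mkQ ∘ₗ b.subtype).quotKerEquivRange.symm ⟨_, y, rfl⟩ =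
        Submodule.Quotient.mk y := by
      rw [LinearEquiv.symm_apply_eq]; rfl
    refine h1.trans ((congrArg _ h2).trans ?_)
    rfl
  rw [hG] at hi
  exact injective_of_retract (I := (⊤ : Submodule A (A ⊗[R] E))) hi
    (Submodule.topEquiv.symm.toLinearMap) (Submodule.topEquiv.toLinearMap)
    (fun x => Submodule.topEquiv.apply_symm_apply x)

theorem faithfullyFlat_characterModule [IsNoetherianRing R] [IsNoetherianRing A] [IsLocalRing A]
    [Module.Flat R A] {𝔪 : Ideal R} [hmR : 𝔪.IsMaximal]
    (h𝔪 : 𝔪.map (algebraMap R A) = maximalIdeal A) {ε : E}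
    (hE : IsHull 𝔪 E ε) : Module.FaithfullyFlat A (CharacterModule (A ⊗[R] E)) := by
  have hmax : (𝔪.map (algebraMap R A)).IsMaximal := h𝔪 ▸ inferInstance
  have : Module.Flat A (CharacterModule (A ⊗[R] E)) :=
    flat_characterModule (injective_baseChange hmax hE)
  refine ⟨fun {𝔫} hm h => ?_⟩
  obtain rfl := eq_maximalIdeal hm
  have hne : (1 : A) ⊗ₜ[R] ε ≠ 0 := by
    intro h0
    let j : (R ⧸ 𝔪) →ₗ[R] E := Submodule.liftQ 𝔪 (LinearMap.toSpanSingleton R E ε) fun a ha => by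
      simpa using hE.ann a ha
    have hj : Function.Injective j := by
      rw [← LinearMap.ker_eq_bot, LinearMap.ker_eq_bot']
      intro x hx
      obtain ⟨r, rfl⟩ := Ideal.Quotient.mk_surjective x
      have hr : r • ε = 0 := hx
      by_contra hr0
      obtain ⟨s, m, hm, hs⟩ := hmR.exists_inv fun h => hr0 (Ideal.Quotient.eq_zero_iff_mem.2 h)
      apply hE.ne
      rw [← one_smul R ε, ← hs, add_smul, mul_smul, hr, smul_zero, hE.ann m hm, add_zero]
    have h1 : (1 : A) ⊗ₜ[R] (1 : R ⧸ 𝔪) = 0 := by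
      apply Module.Flat.lTensor_preserves_injective_linearMap (M := A) j hj
      rw [map_zero, LinearMap.lTensor_tmul, show j 1 = (1 : R) • ε from rfl, one_smul, h0]
    let q : A →ₐ[R] (A ⧸ 𝔪.map (algebraMap R A)) := Ideal.Quotient.mkₐ R _
    let p : (R ⧸ 𝔪) →ₐ[R] (A ⧸ 𝔪.map (algebraMap R A)) :=
      Ideal.Quotient.liftₐ 𝔪 (Algebra.ofId R _) fun a ha =>
        Ideal.Quotient.eq_zero_iff_mem.2 (Ideal.mem_map_of_mem _ ha)
    have h2 := congrArg (Algebra.TensorProduct.lift q p fun _ _ => Commute.all _ _) h1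
    rw [← Algebra.TensorProduct.one_def, map_one, map_zero] at h2
    have : Nontrivial (A ⧸ 𝔪.map (algebraMap R A)) := Ideal.Quotient.nontrivial_iff.2 hmax.ne_top
    exact one_ne_zero h2
  refine hne (CharacterModule.eq_zero_of_character_apply fun c => ?_)
  have hc : c ∈ maximalIdeal A • (⊤ : Submodule A (CharacterModule (A ⊗[R] E))) := by
    rw [h]
    trivial
  induction hc using Submodule.smul_induction_on' with
  | smul a ha c _ =>
    rw [← h𝔪] at ha
    rw [CharacterModule.smul_apply, smul_tmul_eq_zero hE.ann 1 ha, map_zero]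
  | add c _ d _ hc hd => exact (congrArg₂ (· + ·) hc hd).trans (add_zero 0)

end InjectiveBaseChange

end GFD

namespace GFD

open TensorProduct IsLocalRing

section FlatCoefficients

variable {B : Type u} [CommRing B] {X U Y Θ : Type u} [AddCommGroup X] [Module B X]
  [AddCommGroup U] [Module B U] [AddCommGroup Y] [Module B Y] [AddCommGroup Θ] [Module B Θ]

theorem extend_of_flat [Module.Flat B Θ] [Module.FinitePresentation B X] {f : X →ₗ[B] U}
    (h : ∀ φ : X →ₗ[B] B, ∃ ψ : U →ₗ[B] B, ψ ∘ₗ f = φ) (φ : X →ₗ[B] Θ) :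
    ∃ ψ : U →ₗ[B] Θ, ψ ∘ₗ f = φ := by
  obtain ⟨k, h₁, h₂, rfl⟩ := Module.Flat.exists_factorization_of_finitePresentation φ
  choose ψ hψ using fun j => h (Finsupp.lapply j ∘ₗ h₁)
  refine ⟨h₂ ∘ₗ (Finsupp.linearEquivFunOnFinite B B (Fin k)).symm.toLinearMap ∘ₗ LinearMap.pi ψ, ?_⟩
  rw [LinearMap.comp_assoc]
  congr 1
  ext x j
  exact LinearMap.congr_fun (hψ j) x

theorem extend_of_faithfullyFlat [Module.FaithfullyFlat B Θ] [Module.Finite B X] {n : ℕ}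
    {f : X →ₗ[B] (Fin n → B)}
    (h : ∀ φ : X →ₗ[B] Θ, ∃ ψ : (Fin n → B) →ₗ[B] Θ, ψ ∘ₗ f = φ) (φ : X →ₗ[B] B) :
    ∃ ψ : (Fin n → B) →ₗ[B] B, ψ ∘ₗ f = φ := by
  obtain ⟨m, p, hp⟩ := Module.Finite.exists_fin' B X
  let k : Fin m → X := fun j => p (Pi.single j 1)
  have hk : Submodule.span B (Set.range k) = ⊤ := by
    rw [← LinearMap.range_eq_top.2 hp, ← Submodule.map_top, ← (Pi.basisFun B (Fin m)).span_eq,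
      Submodule.map_span, ← Set.range_comp]
    congr 2
    ext j
    simp [k]
  let ρ : ((Fin n → B) →ₗ[B] B) →ₗ[B] (Fin m → B) :=
    LinearMap.pi fun j => LinearMap.applyₗ (f (k j))
  let w : Fin m → B := fun j => φ (k j)
  have hw : (LinearMap.range ρ).mkQ ∘ₗ LinearMap.toSpanSingleton B (Fin m → B) w = 0 := by
    rw [Module.FaithfullyFlat.zero_iff_rTensor_zero B Θ]
    ext θ
    obtain ⟨Ψ, hΨ⟩ := h (LinearMap.toSpanSingleton B Θ θ ∘ₗ φ)
    have hsum : w ⊗ₜ[B] θ = ∑ i : Fin n, ρ (LinearMap.proj i) ⊗ₜ[B] Ψ (Pi.single i 1) := by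
      apply ((TensorProduct.comm B _ _).trans (TensorProduct.piScalarRight B B Θ (Fin m))).injective
      ext j
      have h1 := LinearMap.congr_fun hΨ (k j)
      simp only [LinearMap.comp_apply, LinearMap.toSpanSingleton_apply] at h1
      simp only [LinearEquiv.trans_apply, map_sum, TensorProduct.comm_tmul,
        TensorProduct.piScalarRight_apply, TensorProduct.piScalarRightHom_tmul, Finset.sum_apply]
      refine h1.symm.trans ?_
      conv_lhs => rw [pi_eq_sum_univ' (f (k j))]
      rw [map_sum]
      refine Finset.sum_congr rfl fun i _ => ?_
      rw [map_smul]
      congr 2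
    have h2 := congrArg ((LinearMap.range ρ).mkQ.rTensor Θ) hsum
    simp only [map_sum, LinearMap.rTensor_tmul] at h2
    have h3 : ∀ i, (LinearMap.range ρ).mkQ (ρ (LinearMap.proj i)) = 0 := fun i => by
      rw [Submodule.mkQ_apply, Submodule.Quotient.mk_eq_zero]
      exact ⟨_, rfl⟩
    simp only [h3, TensorProduct.zero_tmul, Finset.sum_const_zero] at h2
    simpa using h2
  have hw' : w ∈ LinearMap.range ρ := by
    have := LinearMap.congr_fun hw 1
    simpa [Submodule.Quotient.mk_eq_zero] using this
  obtain ⟨ψ, hψ⟩ := hw'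
  refine ⟨ψ, LinearMap.ext_on hk ?_⟩
  rintro _ ⟨j, rfl⟩
  exact congrFun hψ j

theorem ev_faithfullyFlat_iff [IsNoetherianRing B] [Module.FaithfullyFlat B Θ] (i : ℕ)
    [Module.Finite B X] : EV B (i + 1) X Θ ↔ EV B (i + 1) X B := by
  induction i generalizing X with
  | zero =>
    obtain ⟨n, g, hg⟩ := Module.Finite.exists_fin' B X
    have h := SES.ofSurj g hg
    have := Module.finitePresentation_of_finite B (LinearMap.ker g)
    exact ⟨fun h1 => h.ev_one (EV.of_projective 0) (extend_of_faithfullyFlat fun φ => h.extend h1 φ),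
      fun h1 => h.ev_one (EV.of_projective 0) (extend_of_flat fun φ => h.extend h1 φ)⟩
  | succ i ih =>
    obtain ⟨n, g, hg⟩ := Module.Finite.exists_fin' B X
    have h := SES.ofSurj g hg
    rw [h.ev_shift fun i => EV.of_projective i, h.ev_shift fun i => EV.of_projective i, ih]

theorem EV.of_tensor_faithfullyFlat [Module.FaithfullyFlat B Θ] (i : ℕ)
    (h : EV B (i + 1) (Θ ⊗[B] X) (CharacterModule Y)) : EV B (i + 1) X (CharacterModule Y) := by
  induction i generalizing Y with
  | zero =>
    rw [(SES.freeCover (R := B) (X := Y)).ev_one_dual_iff] at h ⊢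
    rw [LinearMap.lTensor_tensor] at h
    rw [← Module.FaithfullyFlat.lTensor_injective_iff_injective B Θ]
    have h1 := ((TensorProduct.assoc B Θ X (Y →₀ B)).symm.injective.of_comp_iff _).1 h
    exact (Function.Injective.of_comp_iff' _ (TensorProduct.assoc B Θ X _).bijective).1 h1
  | succ i ih =>
    rw [(SES.freeCover (R := B) (X := Y)).ev_dual_shift] at h ⊢
    exact ih h

end FlatCoefficients

section FlatBaseChange

variable {B B' : Type u} [CommRing B] [CommRing B'] [Algebra B B'] [Module.Flat B B']

theorem ev_baseChange_iff {Y : Type u} [AddCommGroup Y] [Module B Y] [Module B' Y]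
    [IsScalarTower B B' Y] (i : ℕ) {Z : Type u} [AddCommGroup Z] [Module B Z] :
    EV B (i + 1) Z Y ↔ EV B' (i + 1) (B' ⊗[B] Z) Y := by
  induction i generalizing Z with
  | zero =>
    have h := SES.freeCover (R := B) (X := Z)
    have h' := h.baseChange (R1 := B')
    constructor
    · intro h1
      refine h'.ev_one (EV.of_projective 0) fun φ => ?_
      obtain ⟨ψ, hψ⟩ := h.extend h1 ((LinearMap.liftBaseChangeEquiv B').symm φ)
      refine ⟨LinearMap.liftBaseChange B' ψ, ?_⟩
      ext x
      simpa using LinearMap.congr_fun hψ x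
    · intro h1
      refine h.ev_one (EV.of_projective 0) fun φ => ?_
      obtain ⟨ψ, hψ⟩ := h'.extend h1 (LinearMap.liftBaseChange B' φ)
      refine ⟨(LinearMap.liftBaseChangeEquiv B').symm ψ, ?_⟩
      ext x
      simpa using LinearMap.congr_fun hψ (1 ⊗ₜ x)
  | succ i ih =>
    have h := SES.freeCover (R := B) (X := Z)
    have h' := h.baseChange (R1 := B')
    rw [h.ev_shift fun i => EV.of_projective i, h'.ev_shift fun i => EV.of_projective i, ih]

end FlatBaseChange

end GFD

namespace GFD

open TensorProduct IsLocalRing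

section Completion

variable {R S : Type u} [CommRing R] [CommRing S] [Algebra R S]

/-- The multiplication by `r` on `V` factors through the canonical free cover. -/
def FreeFactor (r : R) (V : Type u) [AddCommGroup V] [Module R V] : Prop :=
  ∃ a : V →ₗ[R] (V →₀ R), ∀ v, freeCover R V (a v) = r • v

theorem FreeFactor.retract {r : R} {V : Type u} [AddCommGroup V] [Module R V]
    (h : FreeFactor r V) : ∃ s : (V →₀ R) →ₗ[R] Syz R V, ∀ z : Syz R V, s z = r • z := by
  obtain ⟨a, ha⟩ := h
  refine ⟨LinearMap.codRestrict _ (r • LinearMap.id - a ∘ₗ freeCover R V) fun p => ?_, fun z => ?_⟩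
  · simp [ha]
  · ext1
    have hz : freeCover R V z = 0 := z.2
    simp [hz]

theorem FreeFactor.syz {r : R} {V : Type u} [AddCommGroup V] [Module R V]
    (h : FreeFactor r V) : FreeFactor r (Syz R V) := by
  obtain ⟨s, hs⟩ := h.retract
  obtain ⟨t, ht⟩ := Module.projective_lifting_property (freeCover R (Syz R V)) s
    freeCover_surjective
  refine ⟨t ∘ₗ (LinearMap.ker (freeCover R V)).subtype, fun v => ?_⟩
  rw [← hs]
  exact LinearMap.congr_fun ht v

variable {D X : Type u} [AddCommGroup D] [Module R D] [Module S D] [IsScalarTower R S D]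
  [AddCommGroup X] [Module R X] [Module S X] [IsScalarTower R S X]

theorem injective_lTensor_of_divisible [Module.Flat S D] {J : Ideal R}
    (hD : J • (⊤ : Submodule R D) = ⊤) {U F : Type u} [AddCommGroup U] [Module R U]
    [AddCommGroup F] [Module R F] (f : U →ₗ[R] F)
    (hf : ∀ r ∈ J, ∃ s : F →ₗ[R] U, ∀ z, s (f z) = r • z) :
    Function.Injective (f.lTensor (D ⊗[S] X)) := by
  let g := AlgebraTensorModule.lTensor S X f
  have hK : ∀ r ∈ J, ∀ z, g z = 0 → r • z = 0 := by
    intro r hr z hz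
    obtain ⟨s, hs⟩ := hf r hr
    have h1 : s ∘ₗ f = r • LinearMap.id := LinearMap.ext hs
    have h2 : (s.lTensor X) ((f.lTensor X) z) = r • z := by
      rw [← LinearMap.lTensor_comp_apply, h1, LinearMap.lTensor_smul]
      simp
    rw [← h2]
    exact (congrArg _ hz).trans (map_zero _)
  have hex := Module.Flat.lTensor_exact D (LinearMap.exact_subtype_ker_map g)
  have hinj : Function.Injective (g.lTensor D) := by
    rw [injective_iff_map_eq_zero]
    intro z hz
    obtain ⟨w, rfl⟩ := (hex z).1 hz
    suffices h : w = 0 by rw [h, map_zero]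
    clear hz
    induction w with
    | zero => rfl
    | add a b ha hb => rw [ha, hb, add_zero]
    | tmul d k =>
      have hd : d ∈ J • (⊤ : Submodule R D) := by rw [hD]; trivial
      induction hd using Submodule.smul_induction_on' with
      | smul r hr d _ =>
        rw [← algebraMap_smul S r d, TensorProduct.smul_tmul]
        have : algebraMap R S r • k = 0 := by
          ext1
          simpa using hK r hr k.1 k.2
        rw [this, TensorProduct.tmul_zero]
      | add x _ y _ hx hy => rw [TensorProduct.add_tmul, hx, hy, add_zero]
  have hcomp : ∀ t, AlgebraTensorModule.assoc R S S D X F (f.lTensor (D ⊗[S] X) t) =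
      g.lTensor D (AlgebraTensorModule.assoc R S S D X U t) := by
    intro t
    induction t with
    | zero => simp
    | add a b ha hb => simp only [map_add, ha, hb]
    | tmul t u =>
      induction t with
      | zero => simp
      | add a b ha hb => simp only [map_add, TensorProduct.add_tmul, ha, hb]
      | tmul d x => rfl
  intro a b hab
  apply (AlgebraTensorModule.assoc R S S D X U).injective
  apply hinj
  rw [← hcomp, ← hcomp, hab]

theorem SES.ev_one_of_divisible [Module.Flat S D] {J : Ideal R}
    (hD : J • (⊤ : Submodule R D) = ⊤) {U F V : Type u} [AddCommGroup U] [Module R U]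
    [AddCommGroup F] [Module R F] [Module.Flat R F] [AddCommGroup V] [Module R V] {f : U →ₗ[R] F}
    {g : F →ₗ[R] V} (h : SES f g) (hf : ∀ r ∈ J, ∃ s : F →ₗ[R] U, ∀ z, s (f z) = r • z) :
    EV R 1 (D ⊗[S] X) (CharacterModule V) :=
  h.ev_one_dual_iff.2 (injective_lTensor_of_divisible hD f hf)

theorem ev_of_divisible [Module.Flat S D] {J : Ideal R} (hD : J • (⊤ : Submodule R D) = ⊤)
    (i : ℕ) {V : Type u} [AddCommGroup V] [Module R V] (hV : ∀ r ∈ J, FreeFactor r V) :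
    EV R (i + 1) (D ⊗[S] X) (CharacterModule V) := by
  induction i generalizing V with
  | zero => exact (SES.freeCover (R := R) (X := V)).ev_one_of_divisible hD fun r hr => (hV r hr).retract
  | succ i ih =>
    rw [(SES.freeCover (R := R) (X := V)).ev_dual_shift]
    exact ih fun r hr => (hV r hr).syz

end Completion

section Torsion

variable {R : Type u} [CommRing R] {𝔪 : Ideal R}

theorem exists_pow_killed {V : Type u} [AddCommGroup V] [Module R V]
    (hV : ∀ v : V, v ∈ Gam 𝔪 V) {V' : Submodule R V} (h : V'.FG) :
    ∃ n : ℕ, ∀ a ∈ 𝔪 ^ n, ∀ v ∈ V', a • v = 0 := by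
  obtain ⟨s, rfl⟩ := h
  choose n hn using hV
  refine ⟨s.sup n, fun a ha v hv => ?_⟩
  induction hv using Submodule.span_induction with
  | mem x hx => exact hn x a (Ideal.pow_le_pow_right (Finset.le_sup hx) ha)
  | zero => simp
  | add x y _ _ hx hy => rw [smul_add, hx, hy, add_zero]
  | smul r x _ hx => rw [smul_comm, hx, smul_zero]

theorem SES.ev_torsion_of_killed {U P Y : Type u} [AddCommGroup U] [Module R U] [AddCommGroup P]
    [Module R P] [AddCommGroup Y] [Module R Y] {f : U →ₗ[R] P} {g : P →ₗ[R] Y} (h : SES f g)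
    [Module.Projective R P]
    (hY : ∀ (V : Type u) [AddCommGroup V] [Module R V] (k : ℕ),
      (∀ a ∈ 𝔪 ^ k, ∀ v : V, a • v = 0) → EV R 1 Y (CharacterModule V))
    {V : Type u} [AddCommGroup V] [Module R V] (hV : ∀ v : V, v ∈ Gam 𝔪 V) :
    EV R 1 Y (CharacterModule V) := by
  rw [h.ev_one_iff_rTensor (EV.of_projective 0), injective_iff_map_eq_zero]
  intro z hz
  obtain ⟨V', hfg, hz'⟩ := TensorProduct.exists_finite_submodule_right_of_setFinite
    ({z} : Set (U ⊗[R] V)) (Set.finite_singleton z)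
  obtain ⟨z', rfl⟩ := hz' rfl
  obtain ⟨n, hn⟩ := exists_pow_killed hV (Module.Finite.iff_fg.1 hfg)
  have h1 : EV R 1 Y (CharacterModule V') := hY V' n fun a ha v => by
    ext1
    exact hn a ha v v.2
  rw [h.ev_one_iff_rTensor (EV.of_projective 0)] at h1
  have h2 : V'.subtype.lTensor P (f.rTensor V' z') = 0 := by
    rw [← hz, ← LinearMap.comp_apply, ← LinearMap.comp_apply, LinearMap.lTensor_comp_rTensor,
      LinearMap.rTensor_comp_lTensor]
  have h3 := Module.Flat.lTensor_preserves_injective_linearMap (M := P) V'.subtype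
    V'.subtype_injective
  rw [h1 ((h3 (h2.trans (map_zero _).symm)).trans (map_zero _).symm), map_zero]

theorem ev_torsion_of_killed (i : ℕ) {Y : Type u} [AddCommGroup Y] [Module R Y]
    (hY : ∀ (V : Type u) [AddCommGroup V] [Module R V] (k : ℕ),
      (∀ a ∈ 𝔪 ^ k, ∀ v : V, a • v = 0) → EV R (i + 1) Y (CharacterModule V))
    {V : Type u} [AddCommGroup V] [Module R V] (hV : ∀ v : V, v ∈ Gam 𝔪 V) :
    EV R (i + 1) Y (CharacterModule V) := by
  induction i generalizing Y with
  | zero => exact (SES.freeCover (R := R) (X := Y)).ev_torsion_of_killed hY hV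
  | succ i ih =>
    have h := SES.freeCover (R := R) (X := Y)
    rw [h.ev_shift fun i => EV.of_projective i]
    refine ih fun V _ _ k hk => ?_
    rw [← h.ev_shift fun i => EV.of_projective i]
    exact hY V k hk

theorem torsFlat_of_divisible {S : Type u} [CommRing S] [Algebra R S]
    {D X : Type u} [AddCommGroup D] [Module R D] [Module S D] [IsScalarTower R S D]
    [AddCommGroup X] [Module R X] [Module S X] [IsScalarTower R S X] [Module.Flat S D]
    (hD : 𝔪 • (⊤ : Submodule R D) = ⊤) : TorsFlat 𝔪 (D ⊗[S] X) := by
  have hD' : ∀ k : ℕ, 𝔪 ^ k • (⊤ : Submodule R D) = ⊤ := by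
    intro k
    induction k with
    | zero => simp
    | succ k ih => rw [pow_succ, Submodule.mul_smul, hD, ih]
  intro V _ _ hV i
  refine ev_torsion_of_killed i (fun V _ _ k hk => ?_) hV
  exact ev_of_divisible (hD' k) i fun r hr => ⟨0, fun v => by simp [hk r hr v]⟩

end Torsion

end GFD

namespace GFD

open TensorProduct IsLocalRing

section Rees

variable {B B' : Type u} [CommRing B] [CommRing B'] [Algebra B B']

theorem SES.descend {X U V Y : Type u} [AddCommGroup X] [Module B X] [AddCommGroup U] [Module B U]
    [AddCommGroup V] [Module B V] [AddCommGroup Y] [Module B Y] {f : X →ₗ[B] U} {g : U →ₗ[B] V}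
    (h : SES f g) (φ : U →ₗ[B] Y) (hφ : ∀ t, φ (f t) = 0) :
    ∃ ψ : V →ₗ[B] Y, ∀ u, ψ (g u) = φ u := by
  refine ⟨(LinearMap.ker g).liftQ φ (fun u hu => ?_) ∘ₗ
    (g.quotKerEquivOfSurjective h.surj).symm.toLinearMap, fun u => ?_⟩
  · obtain ⟨t, rfl⟩ := (h.exact u).1 hu
    exact hφ t
  · have : (g.quotKerEquivOfSurjective h.surj).symm (g u) = (LinearMap.ker g).mkQ u := by
      rw [LinearEquiv.symm_apply_eq]
      rfl
    simp [this]

variable {x : B} {Y₀ Y₁ : Type u} [AddCommGroup Y₀] [Module B Y₀] [AddCommGroup Y₁] [Module B Y₁]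
  {q : Y₀ →ₗ[B] Y₁}

theorem SES.smul_eq_zero (hq : SES (LinearMap.lsmul B Y₀ x) q) (y : Y₁) : x • y = 0 := by
  obtain ⟨y, rfl⟩ := hq.surj y
  rw [← map_smul]
  exact hq.comp_zero y

theorem SES.smul_factor {x : B} {L G Y : Type u} [AddCommGroup L]
    [Module B L] [AddCommGroup G] [Module B G] [AddCommGroup Y] [Module B Y] {ι : L →ₗ[B] G}
    {g : G →ₗ[B] Y} (h : SES ι g) (hY : ∀ y : Y, x • y = 0) :
    ∃ u : G →ₗ[B] L, (∀ t, ι (u t) = x • t) ∧ ∀ l, u (ι l) = x • l := by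
  obtain ⟨u, hu⟩ := h.factor (LinearMap.lsmul B G x) fun t => by simp [hY]
  refine ⟨u, fun t => hu t, fun l => h.inj ?_⟩
  rw [hu, map_smul]
  rfl

/-- If `x` kills `Y`, then `Ext²(Y, Y₀) = 0` amounts to lifting maps from a syzygy of `Y`
along `Y₀ → Y₀/xY₀`. -/
theorem ev_two_iff_lift (hq : SES (LinearMap.lsmul B Y₀ x) q) {L G Y : Type u} [AddCommGroup L]
    [Module B L] [AddCommGroup G] [Module B G] [Module.Projective B G] [AddCommGroup Y] [Module B Y]
    {ι : L →ₗ[B] G} {g : G →ₗ[B] Y} (h : SES ι g) (hY : ∀ y : Y, x • y = 0) :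
    EV B 2 Y Y₀ ↔ ∀ φ : L →ₗ[B] Y₁, ∃ ψ : L →ₗ[B] Y₀, q ∘ₗ ψ = φ := by
  rw [h.ev_shift fun i => EV.of_projective i]
  refine ⟨fun h1 φ => hq.lift h1 φ, fun hl => ?_⟩
  refine (SES.freeCover (R := B) (X := L)).ev_one (EV.of_projective 0) fun φ => ?_
  obtain ⟨u, hu, hu'⟩ := h.smul_factor hY
  obtain ⟨s, hs⟩ := Module.projective_lifting_property (freeCover B L) u freeCover_surjective
  obtain ⟨κ, hκ⟩ := (SES.freeCover (R := B) (X := L)).factor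
    (LinearMap.lsmul B _ x - s ∘ₗ ι ∘ₗ freeCover B L) fun t => by
      have := LinearMap.congr_fun hs (ι (freeCover B L t))
      simp only [LinearMap.comp_apply] at this
      simp [this, hu']
  have hκ' : ∀ z : Syz B L, κ z = x • z := fun z => by
    ext1
    have hz : freeCover B L z = 0 := z.2
    have := hκ z
    simp only [Submodule.subtype_apply] at this
    simp [this, hz]
  obtain ⟨χ, hχ⟩ := (SES.freeCover (R := B) (X := L)).descend (q ∘ₗ φ ∘ₗ κ) fun z => by
    simp only [LinearMap.comp_apply, Submodule.subtype_apply, hκ', map_smul]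
    exact hq.smul_eq_zero _
  obtain ⟨lam, hlam⟩ := hl χ
  obtain ⟨μ, hμ⟩ := hq.factor (φ ∘ₗ κ - lam ∘ₗ freeCover B L) fun t => by
    have h1 := hχ t
    have h2 := LinearMap.congr_fun hlam (freeCover B L t)
    simp only [LinearMap.comp_apply] at h1 h2
    simp [h1, h2]
  refine ⟨μ, LinearMap.ext fun z => hq.inj ?_⟩
  have hz : freeCover B L z = 0 := z.2
  simp only [LinearMap.comp_apply, Submodule.subtype_apply, hμ, LinearMap.sub_apply, hκ', hz]
  simp

variable [Module B' Y₁] [IsScalarTower B B' Y₁]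

theorem ev_one_iff_lift (hs : Function.Surjective (algebraMap B B'))
    (hq : SES (LinearMap.lsmul B Y₀ x) q) {L G K F Y : Type u}
    [AddCommGroup L] [Module B L] [AddCommGroup G] [Module B G] [Module.Projective B G]
    [AddCommGroup K] [Module B K] [Module B' K] [IsScalarTower B B' K]
    [AddCommGroup F] [Module B F] [Module B' F] [IsScalarTower B B' F] [Module.Projective B' F]
    [AddCommGroup Y] [Module B Y] [Module B' Y] [IsScalarTower B B' Y]
    {j : K →ₗ[B'] F} {p : F →ₗ[B'] Y} (hp : SES j p) {r : G →ₗ[B] F}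
    (hr : SES (LinearMap.lsmul B G x) r) {ι : L →ₗ[B] G}
    (h : SES ι (p.restrictScalars B ∘ₗ r)) :
    EV B' 1 Y Y₁ ↔ ∀ φ : L →ₗ[B] Y₁, ∃ ψ : L →ₗ[B] Y₀, q ∘ₗ ψ = φ := by
  have hF := hr.smul_eq_zero
  have hY : ∀ y : Y, x • y = 0 := fun y => by
    obtain ⟨y, rfl⟩ := hp.surj y
    rw [← LinearMap.map_smul_of_tower, hF, map_zero]
  obtain ⟨u, hu, hu'⟩ := h.smul_factor hY
  obtain ⟨t, ht⟩ := (hp.restrict (R := B)).factor (r ∘ₗ ι) fun l => h.comp_zero l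
  have ht' : ∀ l, j (t l) = r (ι l) := ht
  have hut : SES u t := by
    refine ⟨fun a b hab => hr.inj ?_, fun l => ⟨fun hl => ?_, ?_⟩, fun k => ?_⟩
    · simpa [hu] using congrArg ι hab
    · obtain ⟨g, hg⟩ := (hr.exact (ι l)).1 (by rw [← ht', hl, map_zero])
      exact ⟨g, h.inj (by rw [hu]; exact hg)⟩
    · rintro ⟨g, rfl⟩
      apply hp.inj
      rw [ht', hu, map_zero, map_smul]
      exact hF _
    · obtain ⟨g, hg⟩ := hr.surj (j k)
      obtain ⟨l, rfl⟩ := (h.exact g).1 (by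
        simp only [LinearMap.comp_apply, hg]
        exact hp.comp_zero k)
      exact ⟨l, hp.inj (by rw [ht', hg])⟩
  have hinj : ∀ a b : Y₀, x • a = x • b → a = b := fun a b hab => hq.inj hab
  constructor
  · intro h1 φ
    obtain ⟨θ, hθ⟩ := Module.projective_lifting_property q (φ ∘ₗ u) hq.surj
    replace hθ : ∀ g, q (θ g) = φ (u g) := fun g => LinearMap.congr_fun hθ g
    obtain ⟨lam, hlam⟩ := hq.factor (θ ∘ₗ ι) fun l => by
      rw [LinearMap.comp_apply, hθ, hu', map_smul, hq.smul_eq_zero]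
    replace hlam : ∀ l, x • lam l = θ (ι l) := hlam
    have hlu : ∀ g, lam (u g) = θ g := fun g => hinj _ _ (by rw [hlam, hu, map_smul])
    obtain ⟨η₀, hη₀⟩ := hut.descend (φ - q ∘ₗ lam) fun g => by simp [hlu, hθ]
    obtain ⟨η, hη⟩ := hp.extend h1 (η₀.extendScalarsOfSurjective hs)
    obtain ⟨ω, hω⟩ := Module.projective_lifting_property q (η.restrictScalars B ∘ₗ r) hq.surj
    refine ⟨ω ∘ₗ ι + lam, LinearMap.ext fun l => ?_⟩
    have e1 := LinearMap.congr_fun hω (ι l)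
    have e2 := LinearMap.congr_fun hη (t l)
    have e3 := hη₀ l
    simp only [LinearMap.comp_apply, LinearMap.restrictScalars_apply, ht'] at e1 e2
    simp only [LinearMap.comp_apply, LinearMap.add_apply, map_add, e1, e2]
    simp [e3]
  · intro hl
    refine hp.ev_one (EV.of_projective 0) fun φ => ?_
    obtain ⟨lam, hlam⟩ := hl (φ.restrictScalars B ∘ₗ t)
    replace hlam : ∀ l, q (lam l) = φ (t l) := fun l => LinearMap.congr_fun hlam l
    obtain ⟨μ, hμ⟩ := hq.factor (lam ∘ₗ u) fun g => by
      rw [LinearMap.comp_apply, hlam, hut.comp_zero, map_zero]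
    replace hμ : ∀ g, x • μ g = lam (u g) := hμ
    have hμι : ∀ l, μ (ι l) = lam l := fun l => hinj _ _ (by rw [hμ, hu', map_smul])
    obtain ⟨η, hη⟩ := hr.descend (q ∘ₗ μ) fun g => by
      simp [hq.smul_eq_zero]
    refine ⟨η.extendScalarsOfSurjective hs, LinearMap.ext fun k => ?_⟩
    obtain ⟨l, rfl⟩ := hut.surj k
    have : η (j (t l)) = φ (t l) := by
      rw [ht', hη, LinearMap.comp_apply, hμι, hlam]
    exact this

theorem SES.finsupp {X U V : Type u} [AddCommGroup X] [Module B X] [AddCommGroup U] [Module B U]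
    [AddCommGroup V] [Module B V] {f : X →ₗ[B] U} {g : U →ₗ[B] V} (h : SES f g) (I : Type u) :
    SES (Finsupp.mapRange.linearMap f : (I →₀ X) →ₗ[B] (I →₀ U))
      (Finsupp.mapRange.linearMap g) := by
  refine ⟨Finsupp.mapRange_injective f (map_zero f) h.inj, ?_,
    Finsupp.mapRange_surjective g (map_zero g) h.surj⟩
  rw [LinearMap.exact_iff, Finsupp.ker_mapRange, h.exact.linearMap_ker_eq,
    Finsupp.range_mapRange_linearMap f (LinearMap.ker_eq_bot.2 h.inj)]

theorem ses_quotient_finsupp (hB : SES (LinearMap.lsmul B B x) (Algebra.linearMap B B'))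
    (I : Type u) : SES (LinearMap.lsmul B (I →₀ B) x)
      (Finsupp.mapRange.linearMap (Algebra.linearMap B B') : (I →₀ B) →ₗ[B] (I →₀ B')) := by
  convert hB.finsupp I
  ext i j
  simp

theorem ev_succ_of_ses_smul {F G : Type u} [AddCommGroup G] [Module B G] [Module.Projective B G]
    [AddCommGroup F] [Module B F] {r : G →ₗ[B] F} (hr : SES (LinearMap.lsmul B G x) r) (i : ℕ) :
    EV B (i + 2) F Y₀ :=
  hr.ev_right (EV.of_projective i) (EV.of_projective (i + 1))

theorem ev_rees_shift (hB : SES (LinearMap.lsmul B B x) (Algebra.linearMap B B'))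
    {Y K I : Type u} [AddCommGroup Y] [Module B Y]
    [Module B' Y] [IsScalarTower B B' Y] [AddCommGroup K] [Module B K]
    [Module B' K] [IsScalarTower B B' K] {j : K →ₗ[B'] (I →₀ B')} {p : (I →₀ B') →ₗ[B'] Y}
    (hp : SES j p) (i : ℕ) : EV B (i + 3) Y Y₀ ↔ EV B (i + 2) K Y₀ :=
  ⟨fun h => (hp.restrict (R := B)).ev_left (ev_succ_of_ses_smul (ses_quotient_finsupp hB I) i) h,
    fun h => (hp.restrict (R := B)).ev_right h
      (ev_succ_of_ses_smul (ses_quotient_finsupp hB I) (i + 1))⟩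

/-- Rees' change of rings theorem. -/
theorem ev_rees (hB : SES (LinearMap.lsmul B B x) (Algebra.linearMap B B'))
    (hq : SES (LinearMap.lsmul B Y₀ x) q) (i : ℕ) {Y : Type u} [AddCommGroup Y] [Module B Y]
    [Module B' Y] [IsScalarTower B B' Y] : EV B' (i + 1) Y Y₁ ↔ EV B (i + 2) Y Y₀ := by
  induction i generalizing Y with
  | zero =>
    have hr := ses_quotient_finsupp hB Y
    have hp := SES.freeCover (R := B') (X := Y)
    have h := SES.ofSurj ((freeCover B' Y).restrictScalars B ∘ₗ
      (Finsupp.mapRange.linearMap (Algebra.linearMap B B') : (Y →₀ B) →ₗ[B] (Y →₀ B')))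
      (hp.surj.comp hr.surj)
    refine (ev_one_iff_lift hB.surj hq hp hr h).trans (ev_two_iff_lift hq h fun y => ?_).symm
    have : algebraMap B B' x = 0 := by
      simpa using hB.comp_zero (1 : B)
    rw [← algebraMap_smul B' x y, this, zero_smul]
  | succ i ih =>
    have hp := SES.freeCover (R := B') (X := Y)
    exact (hp.ev_shift (fun i => EV.of_projective i) i).trans
      (ih.trans (ev_rees_shift hB hp i).symm)

end Rees

end GFD

namespace GFD

open TensorProduct IsLocalRing

section CompletionSequence

variable {R S C : Type u} [CommRing R] [CommRing S] [CommRing C] [Algebra R S] [Algebra S C]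
  [Algebra R C] [IsScalarTower R S C]

theorem rTensor_linearMap_injective [Module.FaithfullyFlat S C] (V : Type u) [AddCommGroup V]
    [Module S V] : Function.Injective ((Algebra.linearMap S C).rTensor V) := by
  have h := Module.FaithfullyFlat.tensorProduct_mk_injective (A := S) (B := C) V
  have : ⇑((Algebra.linearMap S C).rTensor V) =
      TensorProduct.mk S C V 1 ∘ TensorProduct.lid S V := by
    rw [← LinearEquiv.coe_coe, ← LinearMap.coe_comp]
    congr 1
    ext v
    simp
  rw [this]
  exact h.comp (TensorProduct.lid S V).injective

theorem ses_linearMap [Module.FaithfullyFlat S C] :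
    SES (Algebra.linearMap S C) (LinearMap.range (Algebra.linearMap S C)).mkQ :=
  SES.ofInj _ (FaithfulSMul.algebraMap_injective S C)

theorem flat_quotient_range [Module.FaithfullyFlat S C] :
    Module.Flat S (C ⧸ LinearMap.range (Algebra.linearMap S C)) :=
  flat_of_ev fun V _ _ => (ses_linearMap.ev_one_iff_rTensor (EV.of_flat 0)).2
    (rTensor_linearMap_injective V)

theorem ses_tensor_completion [Module.FaithfullyFlat S C] (X : Type u) [AddCommGroup X]
    [Module S X] : SES (TensorProduct.mk S C X 1)
      ((LinearMap.range (Algebra.linearMap S C)).mkQ.rTensor X) := by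
  refine ⟨Module.FaithfullyFlat.tensorProduct_mk_injective X, ?_,
    LinearMap.rTensor_surjective _ (Submodule.mkQ_surjective _)⟩
  have h := rTensor_exact X ses_linearMap.exact (Submodule.mkQ_surjective
    (LinearMap.range (Algebra.linearMap S C)))
  have h2 : (Algebra.linearMap S C).rTensor X ∘ₗ (TensorProduct.lid S X).symm.toLinearMap =
      TensorProduct.mk S C X 1 := by
    ext v
    simp
  intro z
  rw [h z, ← h2]
  constructor
  · rintro ⟨w, rfl⟩
    exact ⟨TensorProduct.lid S X w, by simp⟩
  · rintro ⟨w, rfl⟩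
    exact ⟨(TensorProduct.lid S X).symm w, rfl⟩

theorem exists_ses_torsFlat [Module.FaithfullyFlat S C] {𝔪 : Ideal R}
    (hC : ∀ c : C, ∃ s : S, c - algebraMap S C s ∈ 𝔪.map (algebraMap R C))
    (X : Type u) [AddCommGroup X] [Module R X] [Module S X] [IsScalarTower R S X] :
    ∃ (T : Type u) (_ : AddCommGroup T) (_ : Module R T) (g : C ⊗[S] X →ₗ[R] T),
      SES ((TensorProduct.mk S C X 1).restrictScalars R) g ∧ TorsFlat 𝔪 T := by
  have := flat_quotient_range (S := S) (C := C)
  refine ⟨(C ⧸ LinearMap.range (Algebra.linearMap S C)) ⊗[S] X, inferInstance, inferInstance,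
    _, (ses_tensor_completion X).restrict, torsFlat_of_divisible ?_⟩
  rw [eq_top_iff]
  rintro d -
  obtain ⟨c, rfl⟩ := Submodule.mkQ_surjective _ d
  obtain ⟨s, hs⟩ := hC c
  have h1 : (LinearMap.range (Algebra.linearMap S C)).mkQ c =
      (LinearMap.range (Algebra.linearMap S C)).mkQ (c - algebraMap S C s) := by
    rw [map_sub, eq_comm, sub_eq_self, Submodule.mkQ_apply, Submodule.Quotient.mk_eq_zero]
    exact ⟨s, rfl⟩
  rw [h1]
  generalize c - algebraMap S C s = e at hs
  have hs' : e ∈ 𝔪 • (⊤ : Submodule R C) := by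
    rw [Ideal.smul_top_eq_map]
    exact hs
  clear hs h1
  induction hs' using Submodule.smul_induction_on' with
  | smul r hr x _ =>
    rw [LinearMap.map_smul_of_tower]
    exact Submodule.smul_mem_smul hr trivial
  | add x _ y _ hx hy => rw [map_add]; exact add_mem hx hy

end CompletionSequence

section ResidueField

variable {A : Type u} [CommRing A] [IsLocalRing A]

/-- The residue field is a direct summand of its character module. -/
theorem exists_retract_character : ∃ (f : ResidueField A →ₗ[A] CharacterModule (ResidueField A))
    (g : CharacterModule (ResidueField A) →ₗ[A] ResidueField A), ∀ x, g (f x) = x := by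
  obtain ⟨χ, hχ⟩ := CharacterModule.exists_character_apply_ne_zero_of_ne_zero
    (one_ne_zero : (1 : ResidueField A) ≠ 0)
  have hχ' : χ ≠ 0 := fun h => hχ (by rw [h]; rfl)
  obtain ⟨g, hg⟩ := LinearMap.exists_leftInverse_of_injective
    (LinearMap.toSpanSingleton (ResidueField A) (CharacterModule (ResidueField A)) χ)
    (LinearMap.ker_toSpanSingleton (ResidueField A) hχ')
  let e := LinearMap.toSpanSingleton (ResidueField A) (CharacterModule (ResidueField A)) χ
  have ht : IsScalarTower A (ResidueField A) (CharacterModule (ResidueField A)) := by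
    refine ⟨fun a b c => ?_⟩
    ext d
    simp [CharacterModule.smul_apply]
  exact ⟨e.restrictScalars A, g.restrictScalars A, fun x => LinearMap.congr_fun hg x⟩

end ResidueField

section Ascent

variable {R S C A : Type u} [CommRing R] [CommRing S] [CommRing C] [CommRing A] [Algebra R S]
  [Algebra S C] [Algebra R C] [IsScalarTower R S C] [Algebra R A] [Module.FaithfullyFlat S C]
  {𝔪 : Ideal R}

theorem TorsFlat.ev_completion
    (hC : ∀ c : C, ∃ s : S, c - algebraMap S C s ∈ 𝔪.map (algebraMap R C))
    {X V : Type u} [AddCommGroup X] [Module R X] [Module S X] [IsScalarTower R S X]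
    [AddCommGroup V] [Module R V] (hV : ∀ v : V, v ∈ Gam 𝔪 V) (i : ℕ)
    (h : EV R (i + 1) X (CharacterModule V)) : EV R (i + 1) (C ⊗[S] X) (CharacterModule V) := by
  obtain ⟨T, _, _, g, hg, hT⟩ := exists_ses_torsFlat hC X
  exact hg.ev_mid h (hT V hV i)

theorem FD.completion [IsNoetherianRing R]
    (hC : ∀ c : C, ∃ s : S, c - algebraMap S C s ∈ 𝔪.map (algebraMap R C))
    {X E : Type u} [AddCommGroup X] [Module R X] [Module S X] [IsScalarTower R S X]
    [AddCommGroup E] [Module R E] {ε : E} (hE : IsHull 𝔪 E ε) {n : ℕ} (h : FD R E n X) :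
    FD R E n (C ⊗[S] X) := by
  obtain ⟨T, _, _, g, hg, hT⟩ := exists_ses_torsFlat hC X
  exact FD.ext hE hg h (FD.mono (Nat.zero_le n) (hT.good hE))

/-- Ext modules into the ring itself, computed through the character module of the hull. -/
theorem ev_ring_iff [IsNoetherianRing R] [IsNoetherianRing A] [IsLocalRing A] [Module.Flat R A]
    [𝔪.IsMaximal] (h𝔪 : 𝔪.map (algebraMap R A) = maximalIdeal A) {E : Type u} [AddCommGroup E]
    [Module R E] {ε : E} (hE : IsHull 𝔪 E ε) {Y : Type u} [AddCommGroup Y] [Module R Y]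
    [Module A Y] [IsScalarTower R A Y] [Module.Finite A Y] (i : ℕ) :
    EV R (i + 1) Y (CharacterModule E) ↔ EV A (i + 1) Y A := by
  have := faithfullyFlat_characterModule h𝔪 hE
  rw [ev_changeRing (A := A), ev_faithfullyFlat_iff]

theorem EV.residueField [IsLocalRing A] [Module.Flat R A]
    (h𝔪 : 𝔪.map (algebraMap R A) = maximalIdeal A) {Y : Type u}
    [AddCommGroup Y] [Module R Y] [Module A Y] [IsScalarTower R A Y] (i : ℕ)
    (h : EV R (i + 1) Y (CharacterModule (R ⧸ 𝔪))) : EV A (i + 1) Y (ResidueField A) := by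
  rw [ev_changeRing (A := A)] at h
  let e : (A ⊗[R] (R ⧸ 𝔪)) ≃ₗ[A] ResidueField A :=
    (Algebra.TensorProduct.quotIdealMapEquivTensorQuot A 𝔪).symm.toLinearEquiv ≪≫ₗ
      Submodule.quotEquivOfEq _ _ h𝔪
  obtain ⟨f, g, hfg⟩ := exists_retract_character (A := A)
  refine EV.of_retract_right (h.congr_right (CharacterModule.congr e)) f g hfg

end Ascent

end GFD

namespace GFD

open TensorProduct IsLocalRing

section FreeCriterion

variable {A : Type u} [CommRing A] [IsLocalRing A]

theorem ses_injective_lTensor_residueField {K U X : Type u} [AddCommGroup K] [Module A K]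
    [AddCommGroup U] [Module A U] [AddCommGroup X] [Module A X] {f : K →ₗ[A] U} {g : U →ₗ[A] X}
    (hs : SES f g) (h : EV A 1 X (ResidueField A)) :
    Function.Injective (f.lTensor (ResidueField A)) := by
  rw [injective_iff_map_eq_zero]
  intro z hz
  by_contra hne
  obtain ⟨l, hl⟩ := Module.Projective.exists_dual_ne_zero (ResidueField A) hne
  let φ : K →ₗ[A] ResidueField A :=
    l.restrictScalars A ∘ₗ TensorProduct.mk A (ResidueField A) K 1
  obtain ⟨ψ, hψ⟩ := hs.extend h φ
  have key : l = (LinearMap.liftBaseChange (ResidueField A) ψ) ∘ₗ f.baseChange (ResidueField A) := by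
    ext k
    have := LinearMap.congr_fun hψ k
    simp [φ] at this
    simp [this]
  apply hl
  rw [key]
  have : f.baseChange (ResidueField A) z = 0 := hz
  simp [this]

variable [IsNoetherianRing A]

theorem exists_ses_finite {A : Type u} [CommRing A] (X : Type u) [AddCommGroup X] [Module A X] [Module.Finite A X] :
    ∃ (a : ℕ) (K : Submodule A (Fin a → A)) (g : (Fin a → A) →ₗ[A] X), SES K.subtype g := by
  obtain ⟨a, g, hg⟩ := Module.Finite.exists_fin' A X
  exact ⟨a, LinearMap.ker g, g, SES.ofSurj g hg⟩

theorem free_of_ev_residueField {X : Type u} [AddCommGroup X] [Module A X] [Module.Finite A X]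
    (h : EV A 1 X (ResidueField A)) : Module.Free A X := by
  obtain ⟨a, K, g, hs⟩ := exists_ses_finite (A := A) X
  exact Module.free_of_lTensor_residueField_injective K.subtype g hs.surj hs.exact
    (ses_injective_lTensor_residueField hs h)

theorem ev_of_ev_residueField (p : ℕ) : ∀ {X : Type u} [AddCommGroup X] [Module A X]
    [Module.Finite A X], (∀ i > p, EV A i X (ResidueField A)) →
    ∀ i > p, ∀ (Y : Type u) [AddCommGroup Y] [Module A Y], EV A i X Y := by
  induction p with
  | zero =>
    intro X _ _ _ h i hi Y _ _
    have := free_of_ev_residueField (h 1 one_pos)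
    obtain ⟨j, rfl⟩ : ∃ j, i = j + 1 := ⟨i - 1, by omega⟩
    exact EV.of_projective j
  | succ p ih =>
    intro X _ _ _ h i hi Y _ _
    obtain ⟨a, K, g, hs⟩ := exists_ses_finite (A := A) X
    obtain ⟨j, rfl⟩ : ∃ j, i = j + 2 := ⟨i - 2, by omega⟩
    rw [hs.ev_shift (fun i => EV.of_projective i)]
    refine ih (fun k hk => ?_) (j + 1) (by omega) Y
    obtain ⟨l, rfl⟩ : ∃ l, k = l + 1 := ⟨k - 1, by omega⟩
    rw [← hs.ev_shift (fun i => EV.of_projective i)]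
    exact h _ (by omega)

end FreeCriterion

section Rank

theorem injective_lTensor_of_socle {B : Type u} [CommRing B] [IsLocalRing B] {y : B} (hy : y ≠ 0)
    (hm : ∀ b ∈ maximalIdeal B, b * y = 0) {K : Type u} [AddCommGroup K] [Module B K]
    [Module.Finite B K] [Module.Free B K] {a : ℕ} (f : K →ₗ[B] (Fin a → B))
    (hf : Function.Injective f) : Function.Injective (f.lTensor (ResidueField B)) := by
  rw [injective_iff_map_eq_zero]
  intro z hz
  obtain ⟨v, rfl⟩ := TensorProduct.mk_surjective B K (ResidueField B) (residue_surjective) z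
  have h1 : ∀ j, f v j ∈ maximalIdeal B := by
    intro j
    have := congrArg (fun w => TensorProduct.rid B _
      ((LinearMap.proj (R := B) (φ := fun _ : Fin a => B) j).lTensor (ResidueField B) w)) hz
    rw [← residue_eq_zero_iff]
    simpa [Algebra.smul_def] using this
  have h2 : y • v = 0 := by
    apply hf
    rw [map_smul, map_zero]
    ext j
    simpa [mul_comm] using hm _ (h1 j)
  let b := Module.Free.chooseBasis B K
  have h3 : ∀ i, b.repr v i ∈ maximalIdeal B := by
    intro i hu
    have h4 : y * b.repr v i = 0 := by
      have := DFunLike.congr_fun (congrArg b.repr h2) i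
      simpa using this
    exact hy ((IsUnit.mul_left_eq_zero hu).mp h4)
  rw [← b.sum_repr v, map_sum]
  refine Finset.sum_eq_zero fun i _ => ?_
  rw [map_smul]
  change b.repr v i • ((1 : ResidueField B) ⊗ₜ[B] b i) = 0
  rw [TensorProduct.smul_tmul', Algebra.smul_def, ResidueField.algebraMap_eq,
    (residue_eq_zero_iff _).mpr (h3 i), zero_mul, TensorProduct.zero_tmul]

theorem finrank_of_socle {B : Type u} [CommRing B] [IsLocalRing B] [IsNoetherianRing B] {y : B}
    (hy : y ≠ 0) (hm : ∀ b ∈ maximalIdeal B, b * y = 0) {K U X : Type u} [AddCommGroup K]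
    [Module B K] [AddCommGroup U] [Module B U] [AddCommGroup X] [Module B X]
    [Module.Finite B K] [Module.Free B K] [Module.Finite B U] [Module.Free B U]
    {f : K →ₗ[B] U} {g : U →ₗ[B] X} (hs : SES f g) :
    Module.Free B X ∧ Module.finrank B X + Module.finrank B K = Module.finrank B U := by
  let e : U ≃ₗ[B] (Fin (Module.finrank B U) → B) := (Module.finBasis B U).equivFun
  have hinj : Function.Injective (f.lTensor (ResidueField B)) := by
    have := injective_lTensor_of_socle hy hm (e.toLinearMap ∘ₗ f) (e.injective.comp hs.inj)
    rw [LinearMap.lTensor_comp] at this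
    exact Function.Injective.of_comp this
  have hX := Module.free_of_lTensor_residueField_injective f g hs.surj hs.exact hinj
  have : Module.Finite B X := Module.Finite.of_surjective g hs.surj
  refine ⟨hX, ?_⟩
  obtain ⟨l, hl⟩ := Module.projective_lifting_property g LinearMap.id hs.surj
  have hs' : Function.Exact f g := hs.exact
  obtain ⟨e', -, -⟩ := hs'.splitSurjectiveEquiv hs.inj ⟨l, hl⟩
  rw [e'.finrank_eq, Module.finrank_prod, add_comm]

/-- A finitely generated module of finite projective dimension has a rank. -/
theorem exists_rank {A : Type u} [CommRing A] [IsNoetherianRing A] [IsLocalRing A] (n : ℕ) :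
    ∀ (X : Type u) [AddCommGroup X] [Module A X] [Module.Finite A X],
    (∀ i > n, ∀ (Y : Type u) [AddCommGroup Y] [Module A Y], EV A i X Y) → ∃ χ : ℕ,
    ∀ (B : Type u) [CommRing B] [IsNoetherianRing B] [IsLocalRing B] [Algebra A B]
      [Module.Flat A B] (y : B), y ≠ 0 → (∀ b ∈ maximalIdeal B, b * y = 0) →
      Module.Free B (B ⊗[A] X) ∧ Module.finrank B (B ⊗[A] X) = χ := by
  induction n with
  | zero =>
    intro X _ _ _ h
    have := free_of_ev_residueField (h 1 one_pos (ResidueField A))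
    exact ⟨Module.finrank A X, fun B _ _ _ _ _ y _ _ => ⟨inferInstance, Module.finrank_baseChange⟩⟩
  | succ n ih =>
    intro X _ _ _ h
    obtain ⟨a, K, g, hs⟩ := exists_ses_finite (A := A) X
    obtain ⟨χ, hχ⟩ := ih K (fun i hi Y _ _ => by
      obtain ⟨j, rfl⟩ : ∃ j, i = j + 1 := ⟨i - 1, by omega⟩
      exact (hs.ev_shift (fun i => EV.of_projective i) j).mp (h _ (by omega) Y))
    refine ⟨a - χ, fun B _ _ _ _ _ y hy hm => ?_⟩
    obtain ⟨h1, h2⟩ := hχ B y hy hm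
    have hsB := SES.baseChange (R1 := B) hs
    obtain ⟨h3, h4⟩ := finrank_of_socle hy hm hsB
    refine ⟨h3, ?_⟩
    rw [h2, Module.finrank_baseChange (M' := Fin a → A), Module.finrank_fin_fun] at h4
    omega

/-- The kernel of a surjection of finite projective dimension is zero or contains a
nonzerodivisor. -/
theorem ker_eq_bot_or_not_le {A : Type u} [CommRing A] [IsNoetherianRing A] [IsLocalRing A]
    {C : Type u} [CommRing C] [Algebra A C] (hsurj : Function.Surjective (algebraMap A C))
    (n : ℕ) (h : ∀ i > n, ∀ (Y : Type u) [AddCommGroup Y] [Module A Y], EV A i C Y) :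
    RingHom.ker (algebraMap A C) = ⊥ ∨
      ∀ p ∈ associatedPrimes A A, ¬ RingHom.ker (algebraMap A C) ≤ p := by
  have : Module.Finite A C := Module.Finite.of_surjective (Algebra.linearMap A C) hsurj
  obtain ⟨χ, hχ⟩ := exists_rank n C h
  have hloc : ∀ p ∈ associatedPrimes A A, ∃ _ : p.IsPrime,
      Module.Free (Localization.AtPrime p) (Localization.AtPrime p ⊗[A] C) ∧
      Module.finrank (Localization.AtPrime p) (Localization.AtPrime p ⊗[A] C) = χ := by
    intro p hp
    have hp1 : p.IsPrime := hp.isPrime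
    obtain ⟨-, a, ha⟩ := isAssociatedPrime_iff.mp hp
    have hmem : ∀ s : A, s ∈ p ↔ s * a = 0 := by
      intro s
      rw [ha, Submodule.mem_colon_singleton, Submodule.mem_bot, smul_eq_mul]
    refine ⟨hp1, hχ (Localization.AtPrime p) (algebraMap A _ a) ?_ ?_⟩
    · intro h0
      obtain ⟨s, hs⟩ := (IsLocalization.map_eq_zero_iff p.primeCompl _ a).mp h0
      exact s.2 ((hmem s).mpr hs)
    · intro b hb
      rw [← Localization.AtPrime.map_eq_maximalIdeal] at hb
      refine Submodule.span_induction ?_ ?_ ?_ ?_ hb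
      · rintro _ ⟨s, hs, rfl⟩
        rw [← map_mul, (hmem s).mp hs, map_zero]
      · simp
      · intro c d _ _ hc hd
        rw [add_mul, hc, hd, add_zero]
      · intro c d _ hd
        rw [smul_eq_mul, mul_assoc, hd, mul_zero]
  rcases Nat.eq_zero_or_pos χ with h0 | h0
  · right
    intro p hp hle
    obtain ⟨hp1, h1, h2⟩ := hloc p hp
    have hsub : Subsingleton (Localization.AtPrime p ⊗[A] C) := by
      rw [h0] at h2
      exact (Module.finrank_eq_zero_iff_of_free _ _).mp h2
    let φ : C →+* p.ResidueField :=
      RingHom.liftOfSurjective (algebraMap A C) hsurj ⟨algebraMap A p.ResidueField, fun x hx => by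
        rw [RingHom.mem_ker, Ideal.algebraMap_residueField_eq_zero]
        exact hle hx⟩
    have hφ : ∀ x, φ (algebraMap A C x) = algebraMap A p.ResidueField x := fun x =>
      RingHom.liftOfRightInverse_comp_apply _ _ _ _ _
    let φ' : C →ₐ[A] p.ResidueField := { φ with commutes' := hφ }
    let Φ : Localization.AtPrime p ⊗[A] C →ₐ[A] p.ResidueField :=
      Algebra.TensorProduct.lift (IsScalarTower.toAlgHom A _ _) φ' (fun _ _ => Commute.all _ _)
    have : Subsingleton p.ResidueField := RingHom.codomain_trivial Φ.toRingHom
    exact not_subsingleton _ this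
  · left
    rw [eq_bot_iff]
    intro x hx
    by_contra hne
    obtain ⟨p, hp, hle⟩ := exists_le_isAssociatedPrime_of_isNoetherianRing A x hne
    obtain ⟨hp1, h1, h2⟩ := hloc p hp
    have hnt : Nontrivial (Localization.AtPrime p ⊗[A] C) :=
      Module.nontrivial_of_finrank_pos (R := Localization.AtPrime p) (h2 ▸ h0)
    have hx0 : algebraMap A (Localization.AtPrime p) x = 0 := by
      have hann : Module.annihilator (Localization.AtPrime p)
          (Localization.AtPrime p ⊗[A] C) = ⊥ :=
        Module.annihilator_eq_bot.mpr inferInstance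
      refine hann.le ?_
      rw [Module.mem_annihilator]
      intro t
      rw [algebraMap_smul]
      induction t with
      | zero => simp
      | add t₁ t₂ h₁ h₂ => rw [smul_add, h₁, h₂, add_zero]
      | tmul b c =>
        rw [← TensorProduct.tmul_smul, Algebra.smul_def, (RingHom.mem_ker).mp hx, zero_mul,
          TensorProduct.tmul_zero]
    obtain ⟨s, hs⟩ := (IsLocalization.map_eq_zero_iff p.primeCompl _ x).mp hx0
    refine s.2 (hle ?_)
    rw [Submodule.mem_colon_singleton, Submodule.mem_bot, smul_eq_mul, hs]

end Rank

end GFD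

namespace GFD

open TensorProduct IsLocalRing

section Embdim

theorem exists_finset_maximalIdeal (A : Type u) [CommRing A] [IsNoetherianRing A] [IsLocalRing A] :
    ∃ s : Finset A, s.card = embDim A ∧ Ideal.span (s : Set A) = maximalIdeal A := by
  obtain ⟨s, h1, h2⟩ := Submodule.FG.exists_span_set_encard_eq_spanFinrank
    (maximalIdeal A).fg_of_isNoetherianRing
  have hfin : s.Finite := Set.finite_of_encard_eq_coe h1
  refine ⟨hfin.toFinset, ?_, by simpa using h2⟩
  rw [hfin.encard_eq_coe_toFinset_card] at h1
  rw [embDim, ← spanFinrank_maximalIdeal_eq_finrank_cotangentSpace]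
  exact_mod_cast h1

theorem embDim_le_card {A : Type u} [CommRing A] [IsNoetherianRing A] [IsLocalRing A]
    (s : Finset A) (hs : Ideal.span (s : Set A) = maximalIdeal A) : embDim A ≤ s.card := by
  rw [embDim, ← spanFinrank_maximalIdeal_eq_finrank_cotangentSpace, ← hs]
  simpa using Submodule.spanFinrank_span_le_ncard_of_finite (R := A) s.finite_toSet

theorem embDim_le_of_ker {A C : Type u} [CommRing A] [IsNoetherianRing A] [IsLocalRing A]
    [CommRing C] [IsNoetherianRing C] [IsLocalRing C] (φ : A →+* C)
    (hφ : Function.Surjective φ) (t : Finset A) (ht : (t : Set A) ⊆ maximalIdeal A)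
    (hker : RingHom.ker φ ≤ Ideal.span (t : Set A) ⊔ maximalIdeal A ^ 2) :
    embDim A ≤ embDim C + t.card := by
  classical
  have hlocal : IsLocalHom φ := hφ.isLocalHom
  obtain ⟨s, hs, hspan⟩ := exists_finset_maximalIdeal C
  choose σ hσ using hφ
  let s' : Finset A := s.image σ
  have hs' : (s' : Set A) ⊆ maximalIdeal A := by
    intro a ha
    obtain ⟨c, hc, rfl⟩ := Finset.mem_image.mp (Finset.mem_coe.mp ha)
    have : c ∈ maximalIdeal C := hspan ▸ Ideal.subset_span hc
    rw [← hσ c] at this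
    exact (mem_maximalIdeal _).mpr fun hu => (mem_maximalIdeal _).mp this (hu.map φ)
  have hmap : (Ideal.span (s' : Set A)).map φ = maximalIdeal C := by
    rw [Ideal.map_span, ← hspan]
    congr 1
    ext c
    simp [s', hσ]
  have hle : maximalIdeal A ≤ Ideal.span ((s' ∪ t : Finset A) : Set A) := by
    apply Submodule.le_of_le_smul_of_le_jacobson_bot (IsNoetherian.noetherian _)
      (IsLocalRing.jacobson_eq_maximalIdeal _ bot_ne_top).ge
    rw [smul_eq_mul, ← pow_two, Finset.coe_union, Ideal.span_union, sup_assoc]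
    have h1 : maximalIdeal A ≤ Ideal.span (s' : Set A) ⊔ RingHom.ker φ := by
      have hcm := Ideal.comap_map_of_surjective' φ (fun c => ⟨σ c, hσ c⟩) (Ideal.span (s' : Set A))
      rw [← hcm, hmap]
      exact fun a ha => (mem_maximalIdeal _).mpr fun hu =>
        (mem_maximalIdeal _).mp ha (isUnit_of_map_unit φ a hu)
    exact h1.trans (sup_le_sup_left hker _)
  refine (embDim_le_card (s' ∪ t) (le_antisymm ?_ hle)).trans ?_
  · rw [Ideal.span_le, Finset.coe_union]
    exact Set.union_subset hs' ht
  · refine (Finset.card_union_le _ _).trans ?_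
    rw [← hs]
    gcongr
    exact Finset.card_image_le

end Embdim

section Descent

theorem ses_lsmul_quotient {A : Type u} [CommRing A] {x : A} (hx : IsSMulRegular A x) :
    SES (LinearMap.lsmul A A x) (Algebra.linearMap A (A ⧸ Ideal.span {x})) where
  inj := hx
  exact := by
    intro a
    rw [Algebra.linearMap_apply, Ideal.Quotient.algebraMap_eq, Ideal.Quotient.eq_zero_iff_mem,
      Ideal.mem_span_singleton']
    constructor
    · rintro ⟨b, rfl⟩
      exact ⟨b, by simp [mul_comm]⟩
    · rintro ⟨b, rfl⟩
      exact ⟨b, by simp [mul_comm]⟩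
  surj := Ideal.Quotient.mk_surjective

theorem exists_mem_regular {A : Type u} [CommRing A] [IsNoetherianRing A] {I : Ideal A}
    (h : ∀ p ∈ associatedPrimes A A, ¬ I ≤ p) (J : Ideal A) (hJ : ¬ I ≤ J) :
    ∃ x ∈ I, x ∉ J ∧ IsSMulRegular A x := by
  have hfin : (insert J (associatedPrimes A A)).Finite := (associatedPrimes.finite A A).insert J
  have := (Ideal.subset_union_prime_finite hfin (f := id) J J (I := I) (by
    rintro p (rfl | hp) h1 -
    · exact absurd rfl h1
    · exact hp.isPrime)).not.mpr (by
    rintro ⟨p, rfl | hp, hle⟩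
    · exact hJ hle
    · exact h p hp hle)
  obtain ⟨x, hxI, hx⟩ := Set.not_subset.mp this
  simp only [Set.mem_iUnion, not_exists, id, SetLike.mem_coe, Set.mem_insert_iff] at hx
  refine ⟨x, hxI, fun h => hx J (Or.inl rfl) h, ?_⟩
  by_contra hreg
  have hx' : x ∈ ⋃ p ∈ associatedPrimes A A, (p : Set A) := by
    rw [biUnion_associatedPrimes_eq_compl_regular]
    exact hreg
  simp only [Set.mem_iUnion, SetLike.mem_coe] at hx'
  obtain ⟨p, hp, hxp⟩ := hx'
  exact hx p (Or.inr hp) hxp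

variable {A : Type u} [CommRing A] [IsNoetherianRing A] [IsLocalRing A]

/-- Killing a regular element outside the square of the maximal ideal preserves the finiteness
of projective dimension. -/
theorem ev_residueField_quotient {x : A} (hx : IsSMulRegular A x) (hxm : x ∈ maximalIdeal A)
    (hx2 : x ∉ maximalIdeal A ^ 2) [IsLocalRing (A ⧸ Ideal.span {x})] {Y : Type u}
    [AddCommGroup Y] [Module A Y] [Module (A ⧸ Ideal.span {x}) Y]
    [IsScalarTower A (A ⧸ Ideal.span {x}) Y] (i : ℕ)
    (h : EV A (i + 2) Y (maximalIdeal A)) :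
    EV (A ⧸ Ideal.span {x}) (i + 1) Y (ResidueField (A ⧸ Ideal.span {x})) := by
  set A' := A ⧸ Ideal.span {x}
  let Y₁ := (maximalIdeal A) ⧸ (Ideal.span {x} • (⊤ : Submodule A (maximalIdeal A)))
  have hq : SES (LinearMap.lsmul A (maximalIdeal A) x)
      (Submodule.mkQ (Ideal.span {x} • (⊤ : Submodule A (maximalIdeal A)))) := by
    refine ⟨fun a b hab => ?_, fun a => ?_, Submodule.mkQ_surjective _⟩
    · exact Subtype.ext (hx (congrArg Subtype.val hab))
    · rw [Submodule.mkQ_apply, Submodule.Quotient.mk_eq_zero,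
        Submodule.ideal_span_singleton_smul, Submodule.mem_smul_pointwise_iff_exists]
      simp
  have h1 : EV A' (i + 1) Y Y₁ := (ev_rees (ses_lsmul_quotient hx) hq i).mpr h
  let xm : maximalIdeal A := ⟨x, hxm⟩
  have hsurj : Function.Surjective (algebraMap A A') := Ideal.Quotient.mk_surjective
  have hlocal : IsLocalHom (algebraMap A A') := hsurj.isLocalHom
  let f : ResidueField A' →ₗ[A'] Y₁ :=
    (maximalIdeal A').liftQ (LinearMap.toSpanSingleton A' Y₁ (Submodule.Quotient.mk xm)) (by
      intro b hb
      obtain ⟨a, rfl⟩ := hsurj b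
      have ha : a ∈ maximalIdeal A := (mem_maximalIdeal _).mpr fun hu =>
        (mem_maximalIdeal _).mp hb (hu.map (algebraMap A A'))
      rw [LinearMap.mem_ker, LinearMap.toSpanSingleton_apply, algebraMap_smul,
        ← Submodule.Quotient.mk_smul, Submodule.Quotient.mk_eq_zero]
      have : a • xm = x • (⟨a, ha⟩ : maximalIdeal A) := Subtype.ext (mul_comm _ _)
      rw [this]
      exact Submodule.smul_mem_smul (Ideal.mem_span_singleton_self x) trivial)
  have hcot : (maximalIdeal A).toCotangent xm ≠ 0 := by
    rw [ne_eq, Ideal.toCotangent_eq_zero]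
    exact hx2
  obtain ⟨l, hl⟩ := Module.Projective.exists_dual_ne_zero (ResidueField A)
    (x := ((maximalIdeal A).toCotangent xm : CotangentSpace A)) hcot
  let r : ResidueField A →ₗ[A] ResidueField A' :=
    { ResidueField.map (algebraMap A A') with
      map_smul' := fun a b => by
        simp only [Algebra.smul_def, RingHom.toMonoidHom_eq_coe, OneHom.toFun_eq_coe,
          MonoidHom.toOneHom_coe, MonoidHom.coe_coe, map_mul, RingHom.id_apply]
        rfl }
  let ℓ : maximalIdeal A →ₗ[A] ResidueField A' :=
    r ∘ₗ l.restrictScalars A ∘ₗ (maximalIdeal A).toCotangent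
  have hℓ : ℓ xm ≠ 0 := fun h0 => hl ((ResidueField.map (algebraMap A A')).injective
    (h0.trans (map_zero _).symm))
  have hx0 : ∀ z : ResidueField A', x • z = 0 := by
    intro z
    rw [← algebraMap_smul A' x z]
    have : algebraMap A A' x = 0 :=
      Ideal.Quotient.eq_zero_iff_mem.mpr (Ideal.mem_span_singleton_self x)
    rw [this, zero_smul]
  let g₀ : Y₁ →ₗ[A] ResidueField A' := Submodule.liftQ _ ℓ (by
    rw [Submodule.ideal_span_singleton_smul]
    intro z hz
    obtain ⟨w, -, rfl⟩ := (Submodule.mem_smul_pointwise_iff_exists _ _ _).mp hz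
    rw [LinearMap.mem_ker, map_smul, hx0])
  let g : Y₁ →ₗ[A'] ResidueField A' :=
    LinearMap.lsmul A' (ResidueField A') ((residue_surjective (ℓ xm)⁻¹).choose) ∘ₗ
      LinearMap.extendScalarsOfSurjective hsurj g₀
  refine h1.of_retract_right f g fun z => ?_
  obtain ⟨b, rfl⟩ := residue_surjective z
  have hfb : f (residue A' b) = b • (Submodule.Quotient.mk xm : Y₁) := rfl
  have hg : g (Submodule.Quotient.mk xm) = 1 := by
    change (residue_surjective (ℓ xm)⁻¹).choose • ℓ xm = 1
    rw [Algebra.smul_def, ResidueField.algebraMap_eq,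
      (residue_surjective (ℓ xm)⁻¹).choose_spec, inv_mul_cancel₀ hℓ]
  rw [hfb, map_smul, hg, Algebra.smul_def, mul_one, ResidueField.algebraMap_eq]

theorem ev_ne_zero_of_regular {C N : Type u} [CommRing C] [Algebra A C] [AddCommGroup N]
    [Module A N] [Module C N] [IsScalarTower A C N] [Nontrivial N] [Module.Finite A N] {x : A}
    (hx : IsSMulRegular A x) (hxC : algebraMap A C x = 0) :
    ¬ ∀ i, EV A (i + 1) N A := by
  intro h
  have hkill : ∀ n : N, x • n = 0 := fun n => by
    rw [← algebraMap_smul C x n, hxC, zero_smul]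
  have hall : ∀ i, EV A i N A := by
    rintro (_ | i)
    · rw [EV.zero_iff]
      intro φ
      ext n
      apply hx
      simp only [smul_eq_mul, LinearMap.zero_apply, mul_zero]
      rw [← smul_eq_mul, ← map_smul, hkill, map_zero]
    · exact h i
  have hann : Module.annihilator A N ≠ ⊤ := by
    rw [ne_eq, Module.annihilator_eq_top_iff]
    exact not_subsingleton N
  obtain ⟨d, hd⟩ : ∃ d : ℕ, ringKrullDim A < d := by
    have h1 : ringKrullDim A < ⊤ := ringKrullDim_lt_top
    have h2 : ringKrullDim A ≠ ⊥ := ringKrullDim_ne_bot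
    obtain ⟨k, hk⟩ := WithBot.ne_bot_iff_exists.mp h2
    rw [← hk] at h1 ⊢
    have h3 : k ≠ ⊤ := by
      rintro rfl
      exact lt_irrefl _ h1
    obtain ⟨m, rfl⟩ := ENat.ne_top_iff_exists.mp h3
    exact ⟨m + 1, by exact_mod_cast Nat.lt_succ_self m⟩
  obtain ⟨rs, hlen, -, hrs⟩ := ModuleCat.exists_isRegular_of_exists_subsingleton_ext
    (Module.annihilator A N) d (ModuleCat.of A A)
    (lt_top_iff_ne_top.mpr (by simpa using hann)) (ModuleCat.of A N)
    (Module.support_eq_zeroLocus) (fun i _ => hall i)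
  have hdim := ringKrullDim_add_length_eq_ringKrullDim_of_isRegular rs hrs
  rw [hlen] at hdim
  rw [← hdim] at hd
  have : Nontrivial (A ⧸ Ideal.ofList rs) := by
    refine Ideal.Quotient.nontrivial_iff.mpr fun htop => hrs.top_ne_smul ?_
    change (⊤ : Ideal A) = Ideal.ofList rs • ⊤
    rw [htop, smul_eq_mul, Ideal.mul_top]
  have h0 : (0 : WithBot ℕ∞) ≤ ringKrullDim (A ⧸ Ideal.ofList rs) := ringKrullDim_nonneg_of_nontrivial
  refine absurd hd (not_lt.mpr ?_)
  exact le_add_of_nonneg_left h0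

theorem exists_isRegular_ker (c : ℕ) :
    ∀ (A C N : Type u) [CommRing A] [IsNoetherianRing A] [IsLocalRing A] [CommRing C]
      [IsNoetherianRing C] [IsLocalRing C] [Algebra A C] [AddCommGroup N] [Module A N]
      [Module C N] [IsScalarTower A C N] [Nontrivial N] [Module.Finite C N],
      Function.Surjective (algebraMap A C) →
      (∃ n : ℕ, ∀ i > n, ∀ (Y : Type u) [AddCommGroup Y] [Module A Y], EV A i C Y) →
      (∀ i > c, EV A i N A) → c + embDim C ≤ embDim A →
      ∃ rs : List A, RingTheory.Sequence.IsRegular A rs ∧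
        Ideal.ofList rs = RingHom.ker (algebraMap A C) ∧ rs.length = c ∧
        c + embDim C = embDim A := by
  induction c with
  | zero =>
    intro A C N _ _ _ _ _ _ _ _ _ _ _ _ _ hsurj ⟨n, hn⟩ hN hdim
    have : Module.Finite A C := Module.Finite.of_surjective (Algebra.linearMap A C) hsurj
    have : Module.Finite A N := Module.Finite.trans C N
    have hker : RingHom.ker (algebraMap A C) = ⊥ := by
      rcases ker_eq_bot_or_not_le hsurj n hn with h | h
      · exact h
      · by_contra hne
        obtain ⟨x, hx, -, hreg⟩ := exists_mem_regular h ⊥ (fun hle => hne (le_bot_iff.mp hle))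
        exact ev_ne_zero_of_regular (C := C) (N := N) hreg hx fun i => hN _ i.succ_pos
    refine ⟨[], ?_, ?_, rfl, ?_⟩
    · exact RingTheory.Sequence.IsRegular.nil A A
    · rw [Ideal.ofList_nil, hker]
    · refine le_antisymm hdim ?_
      have := embDim_le_of_ker (algebraMap A C) hsurj ∅ (by simp) (by rw [hker]; exact bot_le)
      simpa using this
  | succ c ih =>
    intro A C N _ _ _ _ _ _ _ _ _ _ _ _ _ hsurj ⟨n, hn⟩ hN hdim
    have : Module.Finite A C := Module.Finite.of_surjective (Algebra.linearMap A C) hsurj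
    have hlocal : IsLocalHom (algebraMap A C) := hsurj.isLocalHom
    have hnle : ¬ RingHom.ker (algebraMap A C) ≤ maximalIdeal A ^ 2 := by
      intro hle
      have := embDim_le_of_ker (algebraMap A C) hsurj ∅ (by simp) (hle.trans le_sup_right)
      rw [Finset.card_empty] at this
      omega
    have hAss : ∀ p ∈ associatedPrimes A A, ¬ RingHom.ker (algebraMap A C) ≤ p := by
      rcases ker_eq_bot_or_not_le hsurj n hn with h | h
      · exact absurd (h.trans_le bot_le) hnle
      · exact h
    obtain ⟨x, hxk, hx2, hreg⟩ := exists_mem_regular hAss _ hnle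
    have hkm : RingHom.ker (algebraMap A C) ≤ maximalIdeal A :=
      le_maximalIdeal (RingHom.ker_ne_top _)
    have hxm : x ∈ maximalIdeal A := hkm hxk
    have hnt : Nontrivial (A ⧸ Ideal.span {x}) := Ideal.Quotient.nontrivial_iff.mpr fun h =>
      (maximalIdeal.isMaximal A).ne_top (top_le_iff.mp (h ▸ (Ideal.span_singleton_le_iff_mem _).mpr hxm))
    have hlocA' : IsLocalRing (A ⧸ Ideal.span {x}) :=
      IsLocalRing.of_surjective' (Ideal.Quotient.mk _) Ideal.Quotient.mk_surjective
    let _ : Algebra (A ⧸ Ideal.span {x}) C := (Ideal.Quotient.lift (Ideal.span {x}) (algebraMap A C)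
      (fun a ha => (Ideal.span_singleton_le_iff_mem _).mpr hxk ha)).toAlgebra
    have htow : IsScalarTower A (A ⧸ Ideal.span {x}) C := IsScalarTower.of_algebraMap_eq fun a => rfl
    let _ : Module (A ⧸ Ideal.span {x}) N := Module.compHom N (algebraMap (A ⧸ Ideal.span {x}) C)
    have htow2 : IsScalarTower (A ⧸ Ideal.span {x}) C N := ⟨fun a b n => by
      rw [Algebra.smul_def, mul_smul]
      rfl⟩
    have htow3 : IsScalarTower A (A ⧸ Ideal.span {x}) N := ⟨fun a b n => by
      change algebraMap (A ⧸ Ideal.span {x}) C (a • b) • n = a • (algebraMap (A ⧸ Ideal.span {x}) C b • n)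
      rw [Algebra.smul_def a b, map_mul, mul_smul, ← IsScalarTower.algebraMap_apply,
        algebraMap_smul]⟩
    have hsurj' : Function.Surjective (algebraMap (A ⧸ Ideal.span {x}) C) := fun y => by
      obtain ⟨a, rfl⟩ := hsurj y
      exact ⟨algebraMap A _ a, rfl⟩
    have : Module.Finite (A ⧸ Ideal.span {x}) C :=
      Module.Finite.of_surjective (Algebra.linearMap _ C) hsurj'
    have hdim' : embDim A ≤ embDim (A ⧸ Ideal.span {x}) + 1 := by
      have := embDim_le_of_ker (Ideal.Quotient.mk (Ideal.span {x})) Ideal.Quotient.mk_surjective {x}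
        (by simpa using hxm) (by rw [Ideal.mk_ker]; simp)
      simpa using this
    obtain ⟨rs, h1, h2, h3, h4⟩ := ih (A ⧸ Ideal.span {x}) C N hsurj'
      ⟨n, ev_of_ev_residueField n fun i hi => by
        obtain ⟨j, rfl⟩ : ∃ j, i = j + 1 := ⟨i - 1, by omega⟩
        exact ev_residueField_quotient hreg hxm hx2 j (hn _ (by omega) _)⟩
      (fun i hi => by
        obtain ⟨j, rfl⟩ : ∃ j, i = j + 1 := ⟨i - 1, by omega⟩
        exact (ev_rees (ses_lsmul_quotient hreg) (ses_lsmul_quotient hreg) j).mpr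
          (hN _ (by omega))) (by omega)
    obtain ⟨ts, rfl⟩ : ∃ ts : List A, ts.map (algebraMap A (A ⧸ Ideal.span {x})) = rs :=
      (List.map_surjective_iff.mpr Ideal.Quotient.mk_surjective) rs
    have hker : Ideal.ofList (x :: ts) = RingHom.ker (algebraMap A C) := by
      have h5 : RingHom.ker (algebraMap A C) =
          (RingHom.ker (algebraMap (A ⧸ Ideal.span {x}) C)).comap (Ideal.Quotient.mk _) := rfl
      rw [h5, ← h2, Ideal.Quotient.algebraMap_eq, ← Ideal.map_ofList,
        Ideal.comap_map_of_surjective' _ Ideal.Quotient.mk_surjective, Ideal.mk_ker,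
        Ideal.ofList_cons, sup_comm]
    refine ⟨x :: ts, ?_, hker, ?_, ?_⟩
    · rw [IsLocalRing.isRegular_iff_isWeaklyRegular_of_subset_maximalIdeal,
        RingTheory.Sequence.isWeaklyRegular_cons_iff]
      · refine ⟨hreg, ?_⟩
        have h6 := (RingTheory.Sequence.isWeaklyRegular_map_algebraMap_iff _ _ _).mp
          h1.toIsWeaklyRegular
        refine (LinearEquiv.isWeaklyRegular_congr (Submodule.quotEquivOfEq _ _ ?_) ts).mp h6
        rw [← Submodule.ideal_span_singleton_smul]
        simp
      · intro r hr
        exact hkm (hker ▸ Ideal.subset_span hr)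
    · simpa using h3
    · omega

end Descent

end GFD

namespace GFD

open TensorProduct IsLocalRing

section DualTensor

variable {A : Type u} [CommRing A] {X Θ : Type u} [AddCommGroup X] [Module A X]
  [Module.Finite A X] [AddCommGroup Θ] [Module A Θ] [Module.Flat A Θ]

theorem dualTensorHom_injective_of_flat : Function.Injective (dualTensorHom A X Θ) := by
  obtain ⟨b, p, hp⟩ := Module.Finite.exists_fin' A X
  have h1 := dualTensorHom_comp_rTensor_dualMap (R := A) (P := Θ) p
  have h2 : Function.Injective (dualTensorHom A (Fin b → A) Θ) :=
    (dualTensorHomEquivOfBasis (N := Θ) (Pi.basisFun A (Fin b))).injective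
  have h3 : Function.Injective (p.dualMap.rTensor Θ) :=
    Module.Flat.rTensor_preserves_injective_linearMap _ (LinearMap.dualMap_injective_of_surjective hp)
  have h4 : Function.Injective ((p.lcomp A Θ) ∘ₗ dualTensorHom A X Θ) := by
    rw [← h1]
    exact h2.comp h3
  rw [LinearMap.coe_comp] at h4
  exact Function.Injective.of_comp h4

theorem dualTensorHom_surjective_of_flat [IsNoetherianRing A] : Function.Surjective (dualTensorHom A X Θ) := by
  intro φ
  have := Module.finitePresentation_of_finite A X
  obtain ⟨k, f, g, rfl⟩ := Module.Flat.exists_factorization_of_finitePresentation φ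
  have h2 := (dualTensorHomEquivOfBasis (N := Θ) (Module.Free.chooseBasis A (Fin k →₀ A))).surjective g
  obtain ⟨t, ht⟩ := h2
  refine ⟨f.dualMap.rTensor Θ t, ?_⟩
  have h1 := LinearMap.congr_fun (dualTensorHom_comp_rTensor_dualMap (R := A) (P := Θ) f) t
  rw [LinearMap.comp_apply, LinearMap.comp_apply] at h1
  rw [h1]
  exact congrArg (LinearMap.lcomp A Θ f) ht

end DualTensor

section HomCharacter

variable {R A : Type u} [CommRing R] [CommRing A] [Algebra R A] {E X : Type u} [AddCommGroup E]
  [Module R E] [AddCommGroup X] [Module R X] [Module A X] [IsScalarTower R A X]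

/-- Restriction of an `A`-linear map into `(A ⊗ E)^+` to an `R`-linear map into `E^+`. -/
noncomputable def homChar (ψ : X →ₗ[A] CharacterModule (A ⊗[R] E)) : X →ₗ[R] CharacterModule E where
  toFun x := CharacterModule.dual (TensorProduct.mk R A E 1) (ψ x)
  map_add' x y := by rw [map_add, map_add]
  map_smul' r x := by
    ext e
    rw [← algebraMap_smul A r x, map_smul]
    change ψ x (algebraMap R A r • ((1 : A) ⊗ₜ[R] e)) = ψ x ((1 : A) ⊗ₜ[R] (r • e))
    rw [algebraMap_smul, TensorProduct.tmul_smul]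

theorem homChar_apply (ψ : X →ₗ[A] CharacterModule (A ⊗[R] E)) (x : X) (e : E) :
    homChar ψ x e = ψ x (1 ⊗ₜ e) := rfl

theorem homChar_bijective :
    Function.Bijective (homChar (R := R) (A := A) (E := E) (X := X)) := by
  constructor
  · intro ψ₁ ψ₂ h
    ext x t
    induction t with
    | zero => simp
    | add t₁ t₂ h₁ h₂ => rw [map_add, map_add, h₁, h₂]
    | tmul a e =>
      have key : ∀ ψ : X →ₗ[A] CharacterModule (A ⊗[R] E), ψ x (a ⊗ₜ e) = homChar ψ (a • x) e := by
        intro ψ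
        rw [homChar_apply, map_smul]
        change _ = ψ x (a • ((1 : A) ⊗ₜ[R] e))
        rw [TensorProduct.smul_tmul', smul_eq_mul, mul_one]
      rw [key, key, h]
  · intro φ
    let ψ : X →ₗ[A] CharacterModule (A ⊗[R] E) :=
      { toFun := fun x => CharacterModule.homEquiv
          (φ ∘ₗ (LinearMap.toSpanSingleton A X x).restrictScalars R)
        map_add' := fun x y => by
          ext t
          induction t with
          | zero => simp
          | add t₁ t₂ h₁ h₂ => rw [map_add, map_add, h₁, h₂]
          | tmul a e =>
            change _ = CharacterModule.homEquiv _ _ + CharacterModule.homEquiv _ _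
            rw [homEquiv_tmul, homEquiv_tmul, homEquiv_tmul]
            simp only [LinearMap.comp_apply, LinearMap.restrictScalars_apply,
              LinearMap.toSpanSingleton_apply, smul_add, map_add]
            rfl
        map_smul' := fun b x => by
          ext t
          induction t with
          | zero => simp
          | add t₁ t₂ h₁ h₂ => rw [map_add, map_add, h₁, h₂]
          | tmul a e =>
            rw [homEquiv_tmul]
            change _ = CharacterModule.homEquiv _ (b • (a ⊗ₜ[R] e))
            rw [TensorProduct.smul_tmul', homEquiv_tmul]
            simp [smul_smul, mul_comm] }
    refine ⟨ψ, ?_⟩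
    ext x e
    rw [homChar_apply]
    change CharacterModule.homEquiv _ _ = _
    rw [homEquiv_tmul]
    simp

theorem homChar_add (ψ₁ ψ₂ : X →ₗ[A] CharacterModule (A ⊗[R] E)) :
    homChar (ψ₁ + ψ₂) = homChar ψ₁ + homChar ψ₂ := rfl

theorem homChar_smul (r : R) (ψ : X →ₗ[A] CharacterModule (A ⊗[R] E)) :
    homChar (algebraMap R A r • ψ) = r • homChar ψ := by
  ext x e
  change ψ x (algebraMap R A r • ((1 : A) ⊗ₜ[R] e)) = ψ x ((1 : A) ⊗ₜ[R] (r • e))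
  rw [algebraMap_smul, TensorProduct.tmul_smul]

end HomCharacter

/-- Over `B`, the dual of a `B`-module of finite good dimension without higher self-extensions
into `B` has no higher extensions into `B` either. -/
def DualAcyc (R E B : Type u) [CommRing R] [AddCommGroup E] [Module R E] [CommRing B]
    [Algebra R B] : Prop :=
  ∀ (X : Type u) [AddCommGroup X] [Module R X] [Module B X] [IsScalarTower R B X]
    [Module.Finite B X], (∃ n, FD R E n X) → (∀ i, EV B (i + 1) X B) →
    ∀ i, EV B (i + 1) (Module.Dual B X) B

theorem DualAcyc.of_flat {R A : Type u} [CommRing R] [IsNoetherianRing R] [CommRing A]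
    [IsNoetherianRing A] [IsLocalRing A] [Algebra R A] [Module.Flat R A] {𝔪 : Ideal R}
    [𝔪.IsMaximal] (h𝔪 : 𝔪.map (algebraMap R A) = maximalIdeal A) {E : Type u} [AddCommGroup E]
    [Module R E] {ε : E} (hE : IsHull 𝔪 E ε) : DualAcyc R E A := by
  intro X _ _ _ _ _ ⟨n, hn⟩ hX i
  have hff := faithfullyFlat_characterModule h𝔪 hE
  have hac : Acyc R E X := fun i => (ev_ring_iff h𝔪 hE i).mpr (hX i)
  have hbi := (FD.bi hE.inj hn hac 0).bi.2 i
  let Θ := CharacterModule (A ⊗[R] E)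
  let Y := Θ ⊗[A] Module.Dual A X
  let _ : Module R Y := Module.compHom Y (algebraMap R A)
  have hsm : ∀ (r : R) (y : Y), r • y = algebraMap R A r • y := fun _ _ => rfl
  have : IsScalarTower R A Y := IsScalarTower.of_algebraMap_smul fun r y => rfl
  let T₀ : Y ≃ₗ[A] (X →ₗ[A] Θ) := (TensorProduct.comm A Θ (Module.Dual A X)).trans
    (LinearEquiv.ofBijective (dualTensorHom A X Θ)
      ⟨dualTensorHom_injective_of_flat, dualTensorHom_surjective_of_flat⟩)
  let T : Y →ₗ[R] Dg R E X :=
    { toFun := fun y => homChar (T₀ y)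
      map_add' := fun y z => by rw [map_add, homChar_add]
      map_smul' := fun r y => by rw [hsm, map_smul, homChar_smul, RingHom.id_apply] }
  have hT : Function.Bijective T := homChar_bijective.comp T₀.bijective
  have h1 : EV R (i + 1) Y (CharacterModule E) :=
    hbi.congr_left (LinearEquiv.ofBijective T hT).symm
  rw [ev_changeRing (A := A)] at h1
  rw [← ev_faithfullyFlat_iff (Θ := Θ)]
  exact EV.of_tensor_faithfullyFlat i h1

end GFD

namespace GFD

open TensorProduct IsLocalRing

section DualQuotient

variable {B B' : Type u} [CommRing B] [CommRing B'] [Algebra B B'] {x : B}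

theorem smul_eq_zero_of_ses_lsmul (hB : SES (LinearMap.lsmul B B x) (Algebra.linearMap B B'))
    {X : Type u} [AddCommGroup X] [Module B X] [Module B' X] [IsScalarTower B B' X] (t : X) :
    x • t = 0 := by
  have h := hB.comp_zero 1
  rw [LinearMap.lsmul_apply, smul_eq_mul, mul_one, Algebra.linearMap_apply] at h
  rw [← algebraMap_smul B' x t, h, zero_smul]

/-- The short exact sequence `0 → P^* → L^* → Hom_{B'}(X, B') → 0` attached to a presentation
`0 → L → P → X → 0` over `B` of a module over `B' = B/x`. -/
theorem exists_ses_dual_quotient (hB : SES (LinearMap.lsmul B B x) (Algebra.linearMap B B'))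
    {L P X : Type u} [AddCommGroup L] [Module B L] [AddCommGroup P] [Module B P]
    [Module.Projective B P] [AddCommGroup X] [Module B X] [Module B' X] [IsScalarTower B B' X]
    {j : L →ₗ[B] P} {p : P →ₗ[B] X} (h : SES j p) :
    ∃ δ : Module.Dual B L →ₗ[B] Module.Dual B' X, SES j.dualMap δ := by
  obtain ⟨m, hm⟩ := h.factor (LinearMap.lsmul B P x) fun t => by
    rw [LinearMap.lsmul_apply, map_smul, smul_eq_zero_of_ses_lsmul hB]
  simp only [LinearMap.lsmul_apply] at hm
  have hmj : ∀ l, m (j l) = x • l := fun l => h.inj (by rw [hm, map_smul])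
  have hπ : ∀ b : B, algebraMap B B' (x * b) = 0 := fun b => hB.comp_zero b
  have hreg : ∀ a b : B, x * a = x * b → a = b := fun a b hab => hB.inj hab
  have hex : ∀ φ : Module.Dual B L, ∃ ψ : Module.Dual B' X, ∀ u, ψ (p u) = algebraMap B B' (φ (m u)) := by
    intro φ
    obtain ⟨ψ, hψ⟩ := h.descend (Algebra.linearMap B B' ∘ₗ φ ∘ₗ m) fun l => by
      change algebraMap B B' (φ (m (j l))) = 0
      rw [hmj, map_smul, smul_eq_mul, hπ]
    exact ⟨ψ.extendScalarsOfSurjective hB.surj, fun u => hψ u⟩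
  choose δ hδ using hex
  have hδu : ∀ ψ₁ ψ₂ : Module.Dual B' X, (∀ u, ψ₁ (p u) = ψ₂ (p u)) → ψ₁ = ψ₂ := by
    intro ψ₁ ψ₂ hψ
    ext t
    obtain ⟨u, rfl⟩ := h.surj t
    exact hψ u
  let δ' : Module.Dual B L →ₗ[B] Module.Dual B' X :=
    { toFun := δ
      map_add' := fun φ₁ φ₂ => hδu _ _ fun u => by
        rw [LinearMap.add_apply, hδ, hδ, hδ, LinearMap.add_apply, map_add]
      map_smul' := fun b φ => hδu _ _ fun u => by
        rw [RingHom.id_apply, LinearMap.smul_apply, hδ, hδ, LinearMap.smul_apply, smul_eq_mul,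
          map_mul, Algebra.smul_def] }
  refine ⟨δ', ⟨?_, ?_, ?_⟩⟩
  · rw [injective_iff_map_eq_zero]
    intro θ hθ
    ext u
    apply hreg
    have h1 := LinearMap.congr_fun hθ (m u)
    rw [LinearMap.dualMap_apply, hm, map_smul, smul_eq_mul] at h1
    rw [h1, LinearMap.zero_apply, LinearMap.zero_apply, mul_zero]
  · intro φ
    constructor
    · intro hφ
      obtain ⟨θ, hθ⟩ := hB.factor (φ ∘ₗ m) fun u => by
        change algebraMap B B' (φ (m u)) = 0
        rw [← hδ]
        exact LinearMap.congr_fun hφ (p u)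
      refine ⟨θ, ?_⟩
      ext l
      apply hreg
      have h1 := hθ (j l)
      rw [LinearMap.comp_apply, hmj, map_smul] at h1
      exact h1
    · rintro ⟨θ, rfl⟩
      refine hδu _ _ fun u => ?_
      change δ _ _ = 0
      rw [hδ, LinearMap.dualMap_apply, hm, map_smul, smul_eq_mul, hπ]
  · intro ψ
    obtain ⟨θ, hθ⟩ := Module.projective_lifting_property (Algebra.linearMap B B')
      (ψ.restrictScalars B ∘ₗ p) hB.surj
    have hθ' : ∀ u, algebraMap B B' (θ u) = ψ (p u) := fun u => LinearMap.congr_fun hθ u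
    obtain ⟨φ, hφ⟩ := hB.factor (θ ∘ₗ j) fun l => by
      change algebraMap B B' (θ (j l)) = 0
      rw [hθ', h.comp_zero, map_zero]
    have hφ' : ∀ l, x * φ l = θ (j l) := hφ
    refine ⟨φ, hδu _ _ fun u => ?_⟩
    change δ φ (p u) = _
    rw [hδ, ← hθ']
    congr 1
    apply hreg
    rw [hφ', hm, map_smul, smul_eq_mul]

end DualQuotient

section Finite

variable {R E : Type u} [CommRing R] [IsNoetherianRing R] [AddCommGroup E] [Module R E]
  {𝔪 : Ideal R} {ε : E}

theorem FD.pi_fin (hE : IsHull 𝔪 E ε) {B : Type u} [AddCommGroup B] [Module R B] {n : ℕ}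
    (h : FD R E n B) (b : ℕ) : FD R E n (Fin b → B) := by
  induction b with
  | zero =>
    have : Module.Flat R (Fin 0 → B) := Module.Flat.of_free
    exact FD.of_flat hE.inj n
  | succ b ih =>
    exact (FD.ext hE ses_inl_snd h ih).congr (Fin.consLinearEquiv R (fun _ : Fin (b + 1) => B))

theorem DualAcyc.quotient (hE : IsHull 𝔪 E ε) {B B' : Type u} [CommRing B] [IsNoetherianRing B]
    [CommRing B'] [Algebra R B] [Algebra R B'] [Algebra B B'] [IsScalarTower R B B'] {x : B}
    (hB : SES (LinearMap.lsmul B B x) (Algebra.linearMap B B')) (hP : ∃ n, FD R E n B)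
    (h : DualAcyc R E B) : DualAcyc R E B' := by
  intro X _ _ _ _ _ ⟨n, hn⟩ hX i
  obtain ⟨m, hm⟩ := hP
  let _ : Module B X := Module.compHom X (algebraMap B B')
  have : IsScalarTower B B' X := IsScalarTower.of_algebraMap_smul fun r y => rfl
  have : IsScalarTower R B X := IsScalarTower.of_algebraMap_smul fun r y => by
    rw [← algebraMap_smul B', ← IsScalarTower.algebraMap_apply, algebraMap_smul]
  have : Module.Finite B B' := Module.Finite.of_surjective (Algebra.linearMap B B') hB.surj
  have : Module.Finite B X := Module.Finite.trans B' X
  obtain ⟨b, p, hp⟩ := Module.Finite.exists_fin' B X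
  have hs := SES.ofSurj p hp
  obtain ⟨δ, hδ⟩ := exists_ses_dual_quotient hB hs
  have hL : FD R E (max n m) (LinearMap.ker p) := FD.of_ker hE (hs.restrict (R := R))
    ((hm.mono (le_max_right _ _)).pi_fin hE b) (hn.mono (le_max_left _ _))
  have hLB : ∀ i, EV B (i + 1) (LinearMap.ker p) B := fun i =>
    (hs.ev_shift EV.of_projective i).mp ((ev_rees hB hB i).mp (hX i))
  rw [ev_rees hB hB]
  exact hδ.ev_right (EV.of_projective i) (h _ ⟨_, hL⟩ hLB (i + 1))

end Finite

section Bijective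

theorem ev_iff_of_bijective {A C N : Type u} [CommRing A] [CommRing C] [Algebra A C]
    (hAC : Function.Bijective (algebraMap A C)) [AddCommGroup N] [Module A N] [Module C N]
    [IsScalarTower A C N] (i : ℕ) : EV A (i + 1) N A ↔ EV C (i + 1) N C := by
  let e : A ≃ₗ[A] C := LinearEquiv.ofBijective (Algebra.linearMap A C) hAC
  have : Module.Flat A C := Module.Flat.of_linearEquiv e.symm
  let φ : C ⊗[A] N →ₗ[C] N := (LinearMap.id : N →ₗ[A] N).liftBaseChange C
  have hφ1 : ∀ n : N, φ (1 ⊗ₜ n) = n := fun n => by simp [φ]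
  have hrep : ∀ t : C ⊗[A] N, ∃ n : N, t = 1 ⊗ₜ n := by
    intro t
    induction t with
    | zero => exact ⟨0, by simp⟩
    | add a b ha hb =>
      obtain ⟨n, rfl⟩ := ha
      obtain ⟨m, rfl⟩ := hb
      exact ⟨n + m, by rw [TensorProduct.tmul_add]⟩
    | tmul c n =>
      obtain ⟨a, rfl⟩ := hAC.2 c
      refine ⟨a • n, ?_⟩
      rw [TensorProduct.tmul_smul, TensorProduct.smul_tmul', Algebra.smul_def, mul_one]
  have hφ : Function.Bijective φ := by
    constructor
    · intro t₁ t₂ h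
      obtain ⟨n, rfl⟩ := hrep t₁
      obtain ⟨m, rfl⟩ := hrep t₂
      rw [hφ1, hφ1] at h
      rw [h]
    · exact fun n => ⟨1 ⊗ₜ n, hφ1 n⟩
  have e' := LinearEquiv.ofBijective φ hφ
  have h1 : EV A (i + 1) N A ↔ EV A (i + 1) N C := ⟨EV.congr_right e, EV.congr_right e.symm⟩
  rw [h1, ev_baseChange_iff (B' := C)]
  exact ⟨EV.congr_left e', EV.congr_left e'.symm⟩

end Bijective

section Iterate

variable {R E : Type u} [CommRing R] [IsNoetherianRing R] [AddCommGroup E] [Module R E]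
  {𝔪 : Ideal R} {ε : E}

theorem DualAcyc.of_bijective {A C : Type u} [CommRing A] [CommRing C] [Algebra R A] [Algebra R C]
    [Algebra A C] [IsScalarTower R A C] (hAC : Function.Bijective (algebraMap A C))
    (h : DualAcyc R E A) : DualAcyc R E C := by
  intro X _ _ _ _ _ hn hX i
  let _ : Module A X := Module.compHom X (algebraMap A C)
  have : IsScalarTower A C X := IsScalarTower.of_algebraMap_smul fun r y => rfl
  have : IsScalarTower R A X := IsScalarTower.of_algebraMap_smul fun r y => by
    rw [← algebraMap_smul C, ← IsScalarTower.algebraMap_apply, algebraMap_smul]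
  have : Module.Finite A C := Module.Finite.of_surjective (Algebra.linearMap A C) hAC.2
  have : Module.Finite A X := Module.Finite.trans C X
  let e : A ≃ₗ[A] C := LinearEquiv.ofBijective (Algebra.linearMap A C) hAC
  let T : Module.Dual C X ≃ₗ[A] Module.Dual A X :=
    { toFun := fun φ => e.symm.toLinearMap ∘ₗ φ.restrictScalars A
      map_add' := fun φ₁ φ₂ => by ext; simp
      map_smul' := fun a φ => by ext; simp
      invFun := fun ψ => (e.toLinearMap ∘ₗ ψ).extendScalarsOfSurjective hAC.2
      left_inv := fun φ => by ext; simp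
      right_inv := fun ψ => by ext; simp }
  exact (ev_iff_of_bijective hAC i).mp
    ((h X hn (fun i => (ev_iff_of_bijective hAC i).mpr (hX i)) i).congr_left T.symm)

/-- Passage from `A` to its quotient by a regular sequence. -/
theorem DualAcyc.of_isWeaklyRegular (hE : IsHull 𝔪 E ε) (k : ℕ) :
    ∀ (A C : Type u) [CommRing A] [IsNoetherianRing A] [CommRing C] [Algebra R A] [Algebra R C]
      [Algebra A C] [IsScalarTower R A C] (rs : List A), rs.length = k →
      RingTheory.Sequence.IsWeaklyRegular A rs → Function.Surjective (algebraMap A C) →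
      Ideal.ofList rs = RingHom.ker (algebraMap A C) → (∃ n, FD R E n A) → DualAcyc R E A →
      DualAcyc R E C ∧ (∃ n, FD R E n C) ∧
        ∀ (N : Type u) [AddCommGroup N] [Module A N] [Module C N] [IsScalarTower A C N],
          (∀ i > k, EV A i N A) → ∀ i, EV C (i + 1) N C := by
  induction k with
  | zero =>
    intro A C _ _ _ _ _ _ _ rs hlen hreg hsurj hker ⟨n, hn⟩ h
    have hAC : Function.Bijective (algebraMap A C) := by
      refine ⟨(RingHom.injective_iff_ker_eq_bot _).mpr ?_, hsurj⟩
      rw [← hker, List.length_eq_zero_iff.mp hlen, Ideal.ofList_nil]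
    let e : A ≃ₗ[A] C := LinearEquiv.ofBijective (Algebra.linearMap A C) hAC
    exact ⟨h.of_bijective hAC, ⟨n, hn.congr (e.restrictScalars R)⟩, fun N _ _ _ _ hN i =>
      (ev_iff_of_bijective hAC i).mp (hN _ i.succ_pos)⟩
  | succ k ih =>
    intro A C _ _ _ _ _ _ _ rs hlen hreg hsurj hker ⟨n, hn⟩ h
    obtain ⟨x, ts, rfl⟩ := List.exists_cons_of_length_eq_add_one hlen
    rw [RingTheory.Sequence.isWeaklyRegular_cons_iff] at hreg
    have hxk : x ∈ RingHom.ker (algebraMap A C) := hker ▸ Ideal.subset_span (by simp)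
    let _ : Algebra (A ⧸ Ideal.span {x}) C := (Ideal.Quotient.lift (Ideal.span {x}) (algebraMap A C)
      (fun a ha => (Ideal.span_singleton_le_iff_mem _).mpr hxk ha)).toAlgebra
    have htow : IsScalarTower A (A ⧸ Ideal.span {x}) C := IsScalarTower.of_algebraMap_eq fun a => rfl
    have htow' : IsScalarTower R (A ⧸ Ideal.span {x}) C := IsScalarTower.of_algebraMap_eq fun r => by
      rw [IsScalarTower.algebraMap_apply R A (A ⧸ Ideal.span {x}), ← IsScalarTower.algebraMap_apply,
        ← IsScalarTower.algebraMap_apply]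
    have hsurj' : Function.Surjective (algebraMap (A ⧸ Ideal.span {x}) C) := fun y => by
      obtain ⟨a, rfl⟩ := hsurj y
      exact ⟨algebraMap A _ a, rfl⟩
    have hses := ses_lsmul_quotient hreg.1
    obtain ⟨h1, h2, h3⟩ := ih (A ⧸ Ideal.span {x}) C
      (ts.map (algebraMap A (A ⧸ Ideal.span {x}))) (by simpa using hlen)
      (by
        rw [RingTheory.Sequence.isWeaklyRegular_map_algebraMap_iff]
        refine (LinearEquiv.isWeaklyRegular_congr (Submodule.quotEquivOfEq _ _ ?_) ts).mp hreg.2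
        rw [← Submodule.ideal_span_singleton_smul]
        simp) hsurj'
      (by
        have h5 : RingHom.ker (algebraMap A C) =
          (RingHom.ker (algebraMap (A ⧸ Ideal.span {x}) C)).comap (Ideal.Quotient.mk _) := rfl
        rw [Ideal.Quotient.algebraMap_eq, ← Ideal.map_ofList]
        refine Ideal.comap_injective_of_surjective (Ideal.Quotient.mk (Ideal.span {x}))
          Ideal.Quotient.mk_surjective ?_
        rw [← h5, ← hker, Ideal.comap_map_of_surjective' _ Ideal.Quotient.mk_surjective, Ideal.mk_ker,
          Ideal.ofList_cons, sup_comm])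
      ⟨n + 1, FD.of_coker hE (hses.restrict (R := R)) hn hn⟩ (h.quotient hE hses ⟨n, hn⟩)
    refine ⟨h1, h2, fun N _ _ _ _ hN => ?_⟩
    let _ : Module (A ⧸ Ideal.span {x}) N := Module.compHom N (algebraMap (A ⧸ Ideal.span {x}) C)
    have htow2 : IsScalarTower (A ⧸ Ideal.span {x}) C N :=
      IsScalarTower.of_algebraMap_smul fun a n => rfl
    have htow3 : IsScalarTower A (A ⧸ Ideal.span {x}) N := IsScalarTower.of_algebraMap_smul
      fun a n => by
        rw [← algebraMap_smul C, ← IsScalarTower.algebraMap_apply, algebraMap_smul]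
    refine h3 N fun i hi => ?_
    obtain ⟨j, rfl⟩ : ∃ j, i = j + 1 := ⟨i - 1, by omega⟩
    exact (ev_rees hses hses j).mpr (hN _ (by omega))

end Iterate

end GFD

namespace GFD

open TensorProduct IsLocalRing

section DualBaseChange

variable (S C X : Type u) [CommRing S] [IsNoetherianRing S] [CommRing C] [Algebra S C]
  [Module.Flat S C] [AddCommGroup X] [Module S X] [Module.Finite S X]

theorem exists_dual_baseChange : Nonempty (C ⊗[S] Module.Dual S X ≃ₗ[C] Module.Dual C (C ⊗[S] X)) := by
  let T₀ : Module.Dual S X →ₗ[S] (X →ₗ[S] C) := LinearMap.compRight S (Algebra.linearMap S C)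
  let T : C ⊗[S] Module.Dual S X →ₗ[C] (X →ₗ[S] C) := T₀.liftBaseChange C
  have hT : ∀ t, T t = dualTensorHom S X C (TensorProduct.comm S C (Module.Dual S X) t) := by
    intro t
    induction t with
    | zero => simp
    | add a b ha hb => rw [map_add, map_add, map_add, ha, hb]
    | tmul c φ =>
      ext x
      simp [T, T₀, Algebra.smul_def, mul_comm]
  have hT' : Function.Bijective T := by
    have h : (T : C ⊗[S] Module.Dual S X → (X →ₗ[S] C)) =
        dualTensorHom S X C ∘ TensorProduct.comm S C (Module.Dual S X) := funext hT
    rw [h]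
    exact Function.Bijective.comp ⟨dualTensorHom_injective_of_flat, dualTensorHom_surjective_of_flat⟩
      (TensorProduct.comm S C (Module.Dual S X)).bijective
  exact ⟨(LinearEquiv.ofBijective T hT').trans (LinearMap.liftBaseChangeEquiv C)⟩

end DualBaseChange

section Biduality

variable {S : Type u} [CommRing S] {X K P : Type u} [AddCommGroup X] [Module S X] [AddCommGroup K]
  [Module S K] [AddCommGroup P] [Module S P] {j : K →ₗ[S] P} {p : P →ₗ[S] X}

theorem SES.dualMap_of_ev (h : SES j p) (hX : EV S 1 X S) : SES p.dualMap j.dualMap := by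
  refine ⟨LinearMap.dualMap_injective_of_surjective h.surj, ?_, fun φ => h.extend hX φ⟩
  intro φ
  constructor
  · intro hφ
    obtain ⟨ψ, hψ⟩ := h.descend φ fun t => LinearMap.congr_fun hφ t
    exact ⟨ψ, LinearMap.ext fun u => hψ u⟩
  · rintro ⟨ψ, rfl⟩
    ext t
    simp [h.comp_zero]

theorem SES.eval_surjective (h : SES j p) (hX : EV S 1 X S) (hK : EV S 1 (Module.Dual S K) S)
    (hP : Function.Surjective (Module.Dual.eval S P)) :
    Function.Surjective (Module.Dual.eval S X) := by
  intro ξ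
  obtain ⟨η, rfl⟩ := ((h.dualMap_of_ev hX).dualMap_of_ev hK).surj ξ
  obtain ⟨u, rfl⟩ := hP η
  exact ⟨p u, rfl⟩

theorem SES.eval_injective (h : SES j p) (hX : EV S 1 X S) (hK : EV S 1 (Module.Dual S K) S)
    (hP : Function.Injective (Module.Dual.eval S P))
    (hKs : Function.Surjective (Module.Dual.eval S K)) :
    Function.Injective (Module.Dual.eval S X) := by
  rw [injective_iff_map_eq_zero]
  intro t ht
  obtain ⟨u, rfl⟩ := h.surj t
  obtain ⟨κ, hκ⟩ := (((h.dualMap_of_ev hX).dualMap_of_ev hK).exact (Module.Dual.eval S P u)).mp ht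
  obtain ⟨k, rfl⟩ := hKs κ
  have h1 : u = j k := hP (hκ.symm.trans rfl)
  rw [h1, h.comp_zero]

end Biduality

section Descent

variable {R E S C : Type u} [CommRing R] [IsNoetherianRing R] [AddCommGroup E] [Module R E]
  {𝔪 : Ideal R} {ε : E} [CommRing S] [IsNoetherianRing S] [CommRing C] [Algebra R C] [Algebra S C]

theorem FD.tensor_ker (hE : IsHull 𝔪 E ε) [Module.Flat S C] (hC : ∃ n, FD R E n C) {a : ℕ}
    {K X : Type u} [AddCommGroup K] [Module S K] [AddCommGroup X] [Module S X]
    {j : K →ₗ[S] (Fin a → S)} {p : (Fin a → S) →ₗ[S] X} (h : SES j p)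
    (hX : ∃ n, FD R E n (C ⊗[S] X)) : ∃ n, FD R E n (C ⊗[S] K) := by
  obtain ⟨m, hm⟩ := hC
  obtain ⟨n, hn⟩ := hX
  refine ⟨max n m, FD.of_ker hE ((h.baseChange (R1 := C)).restrict (R := R)) ?_
    (hn.mono (le_max_left _ _))⟩
  exact FD.congr ((TensorProduct.piScalarRight S C C (Fin a)).restrictScalars R).symm
    ((hm.mono (le_max_right _ _)).pi_fin hE a)

variable [Module.FaithfullyFlat S C]

theorem ev_completion_iff {X : Type u} [AddCommGroup X] [Module S X] [Module.Finite S X] (i : ℕ) :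
    EV S (i + 1) X S ↔ EV C (i + 1) (C ⊗[S] X) C := by
  rw [← ev_baseChange_iff (B := S) (B' := C)]
  exact (ev_faithfullyFlat_iff i).symm

theorem DualAcyc.descend (hD : DualAcyc R E C) {X : Type u} [AddCommGroup X] [Module S X]
    [Module.Finite S X] (hX : ∃ n, FD R E n (C ⊗[S] X)) (hXS : ∀ i, EV S (i + 1) X S) (i : ℕ) :
    EV S (i + 1) (Module.Dual S X) S := by
  rw [ev_completion_iff (C := C)]
  obtain ⟨e⟩ := exists_dual_baseChange S C X
  exact (hD _ hX (fun i => ev_completion_iff i |>.mp (hXS i)) i).congr_left e.symm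

theorem DualAcyc.eval_bijective (hE : IsHull 𝔪 E ε) (hD : DualAcyc R E C) (hC : ∃ n, FD R E n C)
    {X : Type u} [AddCommGroup X] [Module S X] [Module.Finite S X]
    (hX : ∃ n, FD R E n (C ⊗[S] X)) (hXS : ∀ i, EV S (i + 1) X S) :
    Function.Bijective (Module.Dual.eval S X) := by
  have hP : ∀ a, Function.Bijective (Module.Dual.eval S (Fin a → S)) := fun a =>
    Module.IsReflexive.bijective_dual_eval'
  obtain ⟨a, p, hp⟩ := Module.Finite.exists_fin' S X
  have hs := SES.ofSurj p hp
  have hK := FD.tensor_ker hE hC hs hX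
  have hKS : ∀ i, EV S (i + 1) (LinearMap.ker p) S := fun i =>
    (hs.ev_shift EV.of_projective i).mp (hXS (i + 1))
  obtain ⟨b, q, hq⟩ := Module.Finite.exists_fin' S (LinearMap.ker p)
  have ht := SES.ofSurj q hq
  have hL := FD.tensor_ker hE hC ht hK
  have hLS : ∀ i, EV S (i + 1) (LinearMap.ker q) S := fun i =>
    (ht.ev_shift EV.of_projective i).mp (hKS (i + 1))
  have hsurj := ht.eval_surjective (hKS 0) (hD.descend hL hLS 0) (hP b).2
  exact ⟨hs.eval_injective (hXS 0) (hD.descend hK hKS 0) (hP a).1 hsurj,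
    hs.eval_surjective (hXS 0) (hD.descend hK hKS 0) (hP a).2⟩

end Descent

end GFD

namespace GFD

open TensorProduct IsLocalRing

section Cotangent

theorem le_embDim_of_cotangent {R A : Type u} [CommRing R] [CommRing A] [IsNoetherianRing A]
    [IsLocalRing A] [Algebra R A] [Module.Flat R A] {𝔪 : Ideal R}
    (h𝔪 : 𝔪.map (algebraMap R A) = maximalIdeal A) {N : ℕ} (φ : 𝔪 →ₗ[R] (Fin N → R ⧸ 𝔪))
    (hφ : Function.Surjective φ) : N ≤ embDim A := by
  obtain ⟨s, hs, hspan⟩ := exists_finset_maximalIdeal A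
  rw [← hs]
  let κ : R ⧸ 𝔪 →ₗ[R] ResidueField A := Submodule.liftQ 𝔪
    ((Algebra.linearMap A (ResidueField A)).restrictScalars R ∘ₗ Algebra.linearMap R A) fun r hr => by
      change residue A (algebraMap R A r) = 0
      rw [residue_eq_zero_iff, ← h𝔪]
      exact Ideal.mem_map_of_mem _ hr
  have hκ1 : κ 1 = 1 := by
    change residue A (algebraMap R A 1) = 1
    rw [map_one, map_one]
  let ψ : A ⊗[R] 𝔪 →ₗ[A] (Fin N → ResidueField A) := ((LinearMap.pi fun i => κ ∘ₗ LinearMap.proj i) ∘ₗ φ).liftBaseChange A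
  let μ : A ⊗[R] 𝔪 →ₗ[A] A := (Algebra.linearMap R A ∘ₗ 𝔪.subtype).liftBaseChange A
  have hμ : Function.Injective μ := by
    have h1 := Module.Flat.lTensor_preserves_injective_linearMap (M := A) 𝔪.subtype
      (Submodule.subtype_injective 𝔪)
    have h2 : ∀ t, μ t = TensorProduct.rid R A (𝔪.subtype.lTensor A t) := by
      intro t
      induction t with
      | zero => simp
      | add a b ha hb => rw [map_add, map_add, map_add, ha, hb]
      | tmul a x => simp [μ, Algebra.smul_def, mul_comm]
    intro t₁ t₂ h
    rw [h2, h2] at h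
    exact h1 ((TensorProduct.rid R A).injective h)
  have hμr : ∀ a ∈ maximalIdeal A, ∃ t, μ t = a := by
    intro a ha
    rw [← h𝔪] at ha
    have h3 : 𝔪.map (algebraMap R A) ≤ LinearMap.range μ := Ideal.map_le_iff_le_comap.mpr fun r hr =>
      ⟨1 ⊗ₜ ⟨r, hr⟩, by simp [μ]⟩
    exact h3 ha
  have hsm : ∀ a : s, ∃ t, μ t = a := fun a => hμr a (hspan ▸ Ideal.subset_span a.2)
  choose τ hτ using hsm
  have hτspan : Submodule.span A (Set.range τ) = ⊤ := by
    rw [eq_top_iff]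
    rintro t -
    have h4 : μ t ∈ (Submodule.span A (Set.range τ)).map μ := by
      have h5 : (Submodule.span A (Set.range τ)).map μ = maximalIdeal A := by
        rw [Submodule.map_span, ← Set.range_comp, ← hspan]
        congr 1
        have : ⇑μ ∘ τ = Subtype.val := funext hτ
        rw [this, Subtype.range_coe]
      rw [h5, ← h𝔪]
      induction t with
      | zero => rw [map_zero]; exact zero_mem _
      | add a b ha hb => rw [map_add]; exact add_mem ha hb
      | tmul a x =>
        have : μ (a ⊗ₜ x) = a * algebraMap R A x := by simp [μ]
        rw [this]
        exact Ideal.mul_mem_left _ _ (Ideal.mem_map_of_mem _ x.2)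
    obtain ⟨t', ht', htt⟩ := h4
    rwa [← hμ htt]
  have hψ : Submodule.span (ResidueField A) (Set.range (ψ ∘ τ)) = ⊤ := by
    have h6 : ∀ t, ψ t ∈ Submodule.span (ResidueField A) (Set.range (ψ ∘ τ)) := by
      intro t
      have ht : t ∈ Submodule.span A (Set.range τ) := hτspan ▸ Submodule.mem_top
      induction ht using Submodule.span_induction with
      | mem x hx =>
        obtain ⟨a, rfl⟩ := hx
        exact Submodule.subset_span ⟨a, rfl⟩
      | zero => rw [map_zero]; exact zero_mem _
      | add x y _ _ hx hy => rw [map_add]; exact add_mem hx hy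
      | smul a x _ hx =>
        rw [map_smul, ← algebraMap_smul (ResidueField A) a]
        exact Submodule.smul_mem _ _ hx
    rw [eq_top_iff, ← (Pi.basisFun (ResidueField A) (Fin N)).span_eq, Submodule.span_le]
    rintro _ ⟨i, rfl⟩
    obtain ⟨x, hx⟩ := hφ (Pi.single i 1)
    have h8 : Pi.basisFun (ResidueField A) (Fin N) i = ψ (1 ⊗ₜ x) := ?_
    · rw [h8]
      exact h6 (1 ⊗ₜ x)
    ext k
    rw [Pi.basisFun_apply]
    simp only [ψ, LinearMap.liftBaseChange_tmul, one_smul, LinearMap.comp_apply, LinearMap.pi_apply,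
      LinearMap.proj_apply, hx]
    by_cases hik : k = i
    · subst hik
      rw [Pi.single_eq_same, Pi.single_eq_same, hκ1]
    · rw [Pi.single_eq_of_ne hik, Pi.single_eq_of_ne hik, map_zero]
  have h7 := finrank_range_le_card (R := ResidueField A) (ψ ∘ τ)
  rw [Set.finrank, hψ, finrank_top, Module.finrank_fin_fun, Fintype.card_coe] at h7
  exact h7

end Cotangent

section Core

variable {R S C A M : Type u} [CommRing R] [IsNoetherianRing R] [CommRing S] [IsNoetherianRing S]
  [IsLocalRing S] [CommRing C] [IsNoetherianRing C] [IsLocalRing C] [CommRing A]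
  [IsNoetherianRing A] [IsLocalRing A] [Algebra R S] [Algebra S C] [Algebra R C]
  [IsScalarTower R S C] [Algebra R A] [Algebra A C] [IsScalarTower R A C]
  [Module.FaithfullyFlat S C] [Module.Flat R A] [AddCommGroup M] [Module R M] [Module S M]
  [IsScalarTower R S M] [Module.Finite S M] [Nontrivial M]

/-- The homological heart of the argument, over a flat cover `A` of the completion `C` of `S`. -/
theorem exists_isRegular_and_reflexive {𝔪 : Ideal R} [𝔪.IsMaximal]
    (h𝔪 : 𝔪.map (algebraMap R A) = maximalIdeal A) (hAC : Function.Surjective (algebraMap A C))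
    (hC : ∀ c : C, ∃ s : S, c - algebraMap S C s ∈ 𝔪.map (algebraMap R C))
    (hnC : (maximalIdeal S).map (algebraMap S C) = maximalIdeal C) {c p N : ℕ}
    (hg : HG R M c) (hf : HF R S p) (φ : 𝔪 →ₗ[R] (Fin N → R ⧸ 𝔪)) (hφ : Function.Surjective φ)
    (hN : c + embDim S ≤ N) :
    (∃ rs : List A, RingTheory.Sequence.IsRegular A rs ∧
      Ideal.ofList rs = RingHom.ker (algebraMap A C) ∧ rs.length = c ∧ c + embDim S = N) ∧
    (∀ i, EV S (i + 1) M S) ∧ (∀ i, EV S (i + 1) (Module.Dual S M) S) ∧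
      Function.Bijective (Module.Dual.eval S M) := by
  obtain ⟨E, _, _, ε, hE⟩ := exists_hull 𝔪
  have hcomm : SMulCommClass S A C := ⟨fun s a c => by
    rw [Algebra.smul_def, Algebra.smul_def, Algebra.smul_def, Algebra.smul_def]
    ring⟩
  obtain ⟨⟨n, hn⟩, hev⟩ := hg R 𝔪 E ε hE
  have hn' : FD R E n (C ⊗[S] M) := FD.completion hC hE (hn.congr (TensorProduct.lid R M))
  have : Module.Finite A C := Module.Finite.of_surjective (Algebra.linearMap A C) hAC
  have : Module.Finite A (C ⊗[S] M) := Module.Finite.trans C (C ⊗[S] M)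
  have hNA : ∀ i > c, EV A i (C ⊗[S] M) A := by
    intro i hi
    obtain ⟨j, rfl⟩ : ∃ j, i = j + 1 := ⟨i - 1, by omega⟩
    rw [← ev_ring_iff h𝔪 hE]
    exact TorsFlat.ev_completion hC hE.tors j ((hev _ hi).congr_left (TensorProduct.lid R M))
  have hCA : ∀ i > p, EV A i C (ResidueField A) := by
    intro i hi
    obtain ⟨j, rfl⟩ : ∃ j, i = j + 1 := ⟨i - 1, by omega⟩
    refine EV.residueField h𝔪 j ?_
    have h1 : EV R (j + 1) (C ⊗[S] S) (CharacterModule (R ⧸ 𝔪)) := by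
      refine TorsFlat.ev_completion hC (fun v => ⟨1, fun a ha => ?_⟩) j
        ((hf R (R ⧸ 𝔪) _ hi).congr_left (TensorProduct.lid R S))
      rw [pow_one] at ha
      obtain ⟨r, rfl⟩ := Ideal.Quotient.mk_surjective v
      rw [← Ideal.Quotient.mk_eq_mk, ← Submodule.Quotient.mk_smul]
      exact (Submodule.Quotient.mk_eq_zero _).mpr (Ideal.mul_mem_right _ _ ha)
    exact h1.congr_left ((TensorProduct.AlgebraTensorModule.rid S C C).restrictScalars R)
  have hdimC : embDim C ≤ embDim S := by
    classical
    obtain ⟨s, hs, hspan⟩ := exists_finset_maximalIdeal S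
    rw [← hs]
    refine le_trans (embDim_le_card (s.image (algebraMap S C)) ?_) Finset.card_image_le
    rw [Finset.coe_image, ← Ideal.map_span, hspan, hnC]
  have hdimA := le_embDim_of_cotangent h𝔪 φ hφ
  have hnt : Nontrivial (C ⊗[S] M) := inferInstance
  obtain ⟨rs, hreg, hker, hlen, hdim⟩ := exists_isRegular_ker c A C (C ⊗[S] M) hAC
    ⟨p, ev_of_ev_residueField p hCA⟩ hNA (by omega)
  obtain ⟨hD, hPC, hCC⟩ := DualAcyc.of_isWeaklyRegular hE c A C rs hlen hreg.toIsWeaklyRegular hAC hker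
    ⟨0, FD.of_flat hE.inj 0⟩ (DualAcyc.of_flat h𝔪 hE)
  have hMS : ∀ i, EV S (i + 1) M S := fun i => (ev_completion_iff (C := C) i).mpr (hCC _ hNA i)
  exact ⟨⟨rs, hreg, hker, hlen, by omega⟩, hMS, hD.descend ⟨n, hn'⟩ hMS,
    hD.eval_bijective hE hPC ⟨n, hn'⟩ hMS⟩

end Core

end GFD

namespace GFD

open TensorProduct IsLocalRing

section Fiber

open RingTheory.Sequence

variable {R R0 A : Type u} [CommRing R] [IsLocalRing R] [CommRing R0] [CommRing A]
  [IsNoetherianRing A] [IsLocalRing A] [Algebra R R0] [Algebra R0 A] [Algebra R A]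
  [IsScalarTower R R0 A] [Module.Flat R0 A] {𝔪 : Ideal R0} {zs : List R0}

/-- The closed fiber of `A` is a regular local ring of dimension the length of the sequence `zs`. -/
theorem isRegularLocal_fiber (hA : 𝔪.map (algebraMap R0 A) = maximalIdeal A)
    (h𝔪 : 𝔪 = (maximalIdeal R).map (algebraMap R R0) ⊔ Ideal.ofList zs)
    (hreg : IsWeaklyRegular (R0 ⊗[R] ResidueField R) zs) :
    IsRegularLocal (A ⧸ (maximalIdeal R).map (algebraMap R A)) ∧
      ringKrullDim (A ⧸ (maximalIdeal R).map (algebraMap R A)) = zs.length := by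
  set J := (maximalIdeal R).map (algebraMap R A) with hJ
  have hJ0 : J = ((maximalIdeal R).map (algebraMap R R0)).map (algebraMap R0 A) := by
    rw [Ideal.map_map, ← IsScalarTower.algebraMap_eq]
  have hsup : J ⊔ (Ideal.ofList zs).map (algebraMap R0 A) = maximalIdeal A := by
    rw [hJ0, ← Ideal.map_sup, ← h𝔪, hA]
  have hJm : J ≤ maximalIdeal A := hsup ▸ le_sup_left
  have hnt : Nontrivial (A ⧸ J) := Ideal.Quotient.nontrivial_iff.mpr fun h =>
    (maximalIdeal.isMaximal A).ne_top (top_le_iff.mp (h ▸ hJm))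
  have hloc : IsLocalRing (A ⧸ J) :=
    IsLocalRing.of_surjective' (Ideal.Quotient.mk _) Ideal.Quotient.mk_surjective
  have hmax : maximalIdeal (A ⧸ J) = (maximalIdeal A).map (Ideal.Quotient.mk J) :=
    (IsLocalRing.map_maximalIdeal_of_surjective _ Ideal.Quotient.mk_surjective).symm
  let rs : List (A ⧸ J) := zs.map (algebraMap R0 (A ⧸ J))
  have hrsmax : Ideal.ofList rs = maximalIdeal (A ⧸ J) := by
    rw [hmax, ← hsup, Ideal.map_sup, Ideal.map_quotient_self, bot_sup_eq, Ideal.map_map,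
      Ideal.map_ofList]
    rfl
  have e : A ⊗[R0] (R0 ⊗[R] ResidueField R) ≃ₗ[A] (A ⧸ J) :=
    (TensorProduct.AlgebraTensorModule.cancelBaseChange R R0 A A (ResidueField R)).trans
      (Algebra.TensorProduct.quotIdealMapEquivTensorQuot A (maximalIdeal R)).symm.toLinearEquiv
  have hrs : IsRegular (A ⧸ J) rs := by
    rw [IsLocalRing.isRegular_iff_isWeaklyRegular_of_subset_maximalIdeal fun r hr =>
      hrsmax ▸ Ideal.subset_span hr, isWeaklyRegular_map_algebraMap_iff]
    exact ((e.restrictScalars R0).isWeaklyRegular_congr zs).mp hreg.isWeaklyRegular_lTensor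
  refine ⟨⟨inferInstance, hloc, rs, hrs, hrsmax⟩, ?_⟩
  have h1 := ringKrullDim_add_length_eq_ringKrullDim_of_isRegular rs hrs
  rw [hrsmax, ringKrullDim_eq_zero_of_isField ((Ideal.Quotient.maximal_ideal_iff_isField_quotient _).mp
    (maximalIdeal.isMaximal _)), zero_add, List.length_map] at h1
  exact h1.symm

end Fiber

theorem ringKrullDim_eq_add_fiber {R A : Type u} [CommRing R] [IsLocalRing R] [IsNoetherianRing R]
    [CommRing A] [IsNoetherianRing A] [IsLocalRing A] [Algebra R A] [Module.Flat R A]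
    [IsLocalHom (algebraMap R A)] :
    ringKrullDim A = ringKrullDim R + ringKrullDim (A ⧸ (maximalIdeal R).map (algebraMap R A)) := by
  set J := (maximalIdeal R).map (algebraMap R A) with hJ
  have hJm : J ≤ maximalIdeal A := ((local_hom_TFAE (algebraMap R A)).out 0 2).mp ‹_›
  have hnt : Nontrivial (A ⧸ J) := Ideal.Quotient.nontrivial_iff.mpr fun h =>
    (maximalIdeal.isMaximal A).ne_top (top_le_iff.mp (h ▸ hJm))
  have hloc : IsLocalRing (A ⧸ J) :=
    IsLocalRing.of_surjective' (Ideal.Quotient.mk _) Ideal.Quotient.mk_surjective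
  have hmax : (maximalIdeal A).map (Ideal.Quotient.mk J) = maximalIdeal (A ⧸ J) :=
    IsLocalRing.map_maximalIdeal_of_surjective _ Ideal.Quotient.mk_surjective
  have hcomap : (maximalIdeal A).comap (algebraMap R A) = maximalIdeal R :=
    ((local_hom_TFAE (algebraMap R A)).out 0 4).mp ‹_›
  have hover : (maximalIdeal A).LiesOver (maximalIdeal R) := ⟨hcomap.symm⟩
  have h := Ideal.height_eq_height_add_of_liesOver_of_hasGoingDown (maximalIdeal R) (maximalIdeal A)
  rw [← hJ, hmax] at h
  rw [← maximalIdeal_height_eq_ringKrullDim, ← maximalIdeal_height_eq_ringKrullDim,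
    ← maximalIdeal_height_eq_ringKrullDim, h, WithBot.coe_add]

end GFD

namespace GFD

open TensorProduct IsLocalRing

section Cohen

variable {R S : Type u} [CommRing R] [CommRing S] [IsLocalRing R] [IsLocalRing S]
  {f : R →+* S} {M : Type u} [AddCommGroup M] [Module S M] {ss : List S} {c p N : ℕ}

namespace Pres

theorem comap_eq (P : Pres f M ss c p N) (hloc : IsLocalHom f)
    (hss : Ideal.ofList ss = maximalIdeal S) :
    letI := P.ring
    letI := P.alg
    letI := P.alg'
    (maximalIdeal S).comap (algebraMap P.R0 S) =
      (maximalIdeal R).map (algebraMap R P.R0) ⊔ Ideal.ofList P.zs := by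
  let _ := P.ring
  let _ := P.alg
  let _ := P.alg'
  have hf : ∀ r, algebraMap P.R0 S (algebraMap R P.R0 r) = f r := fun r => by
    rw [← RingHom.comp_apply, P.comp]
  have hzs : Ideal.ofList P.zs ≤ (maximalIdeal S).comap (algebraMap P.R0 S) := by
    rw [← Ideal.map_le_iff_le_comap, Ideal.map_ofList, P.map_zs, hss]
  have hm : (maximalIdeal S).comap f = maximalIdeal R := ((local_hom_TFAE f).out 0 4).mp hloc
  refine le_antisymm (fun a ha => ?_) (sup_le ?_ hzs)
  · obtain ⟨r, hr⟩ := P.surj a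
    have h1 : f r ∈ maximalIdeal S := by
      have := sub_mem (Ideal.mem_comap.mp ha) (Ideal.mem_comap.mp (hzs hr))
      rwa [← map_sub, sub_sub_cancel, hf] at this
    have h2 : r ∈ maximalIdeal R := hm ▸ h1
    have := add_mem (Ideal.mem_sup_right (S := (maximalIdeal R).map (algebraMap R P.R0)) hr)
      (Ideal.mem_sup_left (T := Ideal.ofList P.zs) (Ideal.mem_map_of_mem (algebraMap R P.R0) h2))
    rwa [sub_add_cancel] at this
  · rw [Ideal.map_le_iff_le_comap, Ideal.comap_comap, P.comp, hm]

theorem isMaximal_comap (P : Pres f M ss c p N) (hloc : IsLocalHom f)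
    (hss : Ideal.ofList ss = maximalIdeal S) :
    letI := P.ring
    letI := P.alg'
    ((maximalIdeal S).comap (algebraMap P.R0 S)).IsMaximal := by
  let _ := P.ring
  let _ := P.alg
  let _ := P.alg'
  have hf : ∀ r, algebraMap P.R0 S (algebraMap R P.R0 r) = f r := fun r => by
    rw [← RingHom.comp_apply, P.comp]
  have hzs : Ideal.ofList P.zs ≤ (maximalIdeal S).comap (algebraMap P.R0 S) := by
    rw [← Ideal.map_le_iff_le_comap, Ideal.map_ofList, P.map_zs, hss]
  refine Ideal.isMaximal_iff.mpr ⟨fun h => ?_, fun J a hJ ha haJ => ?_⟩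
  · exact (Ideal.ne_top_iff_one _).mp (Ideal.comap_ne_top (algebraMap P.R0 S)
      (maximalIdeal.isMaximal S).ne_top) h
  · obtain ⟨r, hr⟩ := P.surj a
    by_cases hu : IsUnit r
    · have h1 : algebraMap R P.R0 r ∈ J := by
        have := sub_mem haJ (hJ (hzs hr))
        rwa [sub_sub_cancel] at this
      exact (Ideal.eq_top_iff_one J).mp (Ideal.eq_top_of_isUnit_mem _ h1 (hu.map _))
    · refine absurd ?_ ha
      have h2 : f r ∈ maximalIdeal S := fun h => hu (hloc.map_nonunit r h)
      have := add_mem (Ideal.mem_comap.mp (hzs hr)) h2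
      rwa [← hf, ← map_add, sub_add_cancel] at this

theorem map_comap_eq (P : Pres f M ss c p N) (hss : Ideal.ofList ss = maximalIdeal S) :
    letI := P.ring
    letI := P.alg'
    maximalIdeal S = ((maximalIdeal S).comap (algebraMap P.R0 S)).map (algebraMap P.R0 S) := by
  let _ := P.ring
  let _ := P.alg
  let _ := P.alg'
  have hzs : Ideal.ofList P.zs ≤ (maximalIdeal S).comap (algebraMap P.R0 S) := by
    rw [← Ideal.map_le_iff_le_comap, Ideal.map_ofList, P.map_zs, hss]
  refine le_antisymm ?_ Ideal.map_comap_le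
  have := Ideal.map_mono (f := algebraMap P.R0 S) hzs
  rwa [Ideal.map_ofList, P.map_zs, hss] at this

end Pres

theorem ringKrullDim_adicCompletion [IsNoetherianRing S]
    [IsNoetherianRing (AdicCompletion (maximalIdeal S) S)] :
    ringKrullDim (AdicCompletion (maximalIdeal S) S) = ringKrullDim S := by
  have hloc : IsLocalHom (algebraMap S (AdicCompletion (maximalIdeal S) S)) :=
    ((local_hom_TFAE _).out 2 0).mp (AdicCompletion.maximalIdeal_eq_map (R := S)).ge
  rw [ringKrullDim_eq_add_fiber (R := S), ← AdicCompletion.maximalIdeal_eq_map,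
    ringKrullDim_eq_zero_of_isField ((Ideal.Quotient.maximal_ideal_iff_isField_quotient _).mp
      (maximalIdeal.isMaximal _)), add_zero]

theorem isExceptionalCIMap_and_reflexive [IsNoetherianRing R] [IsNoetherianRing S] [Nontrivial M] [Module.Finite S M] {g : ℕ}
    (hloc : IsLocalHom f) (hg : letI := Module.compHom M f; HG R M g)
    (hf : letI := f.toModule; HF R S p) (hle : g + embDim S ≤ embDim R) :
    g + embDim S = embDim R ∧ IsExceptionalCIMap f ∧ (∀ i, EV S (i + 1) M S) ∧
      (∀ i, EV S (i + 1) (Module.Dual S M) S) ∧ Function.Bijective (Module.Dual.eval S M) := by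
  obtain ⟨s, hs, hspan⟩ := exists_finset_maximalIdeal S
  have hss : Ideal.ofList s.toList = maximalIdeal S := by
    rw [← hspan]
    simp [Ideal.ofList]
  have hlen : s.toList.length = embDim S := by rw [Finset.length_toList, hs]
  obtain ⟨P⟩ := nonempty_pres hloc hg hf s.toList fun x hx => hss ▸ Ideal.subset_span hx
  let _ := P.ring
  let _ := P.alg
  let _ := P.alg'
  have := P.noeth
  have hzlen : P.zs.length = embDim S := by
    have := congrArg List.length P.map_zs
    rw [List.length_map] at this
    exact this.trans hlen
  set 𝔪 := (maximalIdeal S).comap (algebraMap P.R0 S) with h𝔪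
  have hmax : 𝔪.IsMaximal := P.isMaximal_comap hloc hss
  obtain ⟨A, _, _, _, _, hflat, hA, hcompl, h, hsurj, hcomm⟩ :=
    exists_flat_complete_cover h𝔪 (P.map_comap_eq hss)
  let C := AdicCompletion (maximalIdeal S) S
  let _ : Algebra A C := h.toAlgebra
  have hnoeth : IsNoetherianRing C := isNoetherianRing_of_surjective A C h hsurj
  have htSC : IsScalarTower P.R0 S C := IsScalarTower.of_algebraMap_eq fun _ => rfl
  have htAC : IsScalarTower P.R0 A C := IsScalarTower.of_algebraMap_eq fun r => (hcomm r).symm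
  have hnC : (maximalIdeal S).map (algebraMap S C) = maximalIdeal C :=
    AdicCompletion.maximalIdeal_eq_map.symm
  have hlocC : IsLocalHom (algebraMap S C) := ((local_hom_TFAE _).out 2 0).mp hnC.le
  have hff : Module.FaithfullyFlat S C := Module.FaithfullyFlat.of_flat_of_isLocalHom
  let _ : Module P.R0 M := Module.compHom M (algebraMap P.R0 S)
  have htM : IsScalarTower P.R0 S M := ⟨fun a b m => by
    rw [Algebra.smul_def, mul_smul]
    rfl⟩
  have hC : ∀ c : C, ∃ t : S, c - algebraMap S C t ∈ 𝔪.map (algebraMap P.R0 C) := by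
    intro c
    obtain ⟨t, ht⟩ := exists_completionHom_sub_mem S c
    refine ⟨t, ?_⟩
    rw [IsScalarTower.algebraMap_eq P.R0 S C, ← Ideal.map_map, ← P.map_comap_eq hss, hnC,
      ← neg_sub]
    exact neg_mem ht
  obtain ⟨φ, hφ⟩ := P.cot
  obtain ⟨⟨rs, hrs, hker, hrslen, heq⟩, hrefl⟩ := exists_isRegular_and_reflexive (A := A) (C := C)
    (M := M) hA hsurj hC hnC P.hg P.hf φ hφ (by omega)
  let _ : Algebra R A := ((algebraMap P.R0 A).comp (algebraMap R P.R0)).toAlgebra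
  have htA : IsScalarTower R P.R0 A := IsScalarTower.of_algebraMap_eq fun _ => rfl
  have hflatR := P.flat
  have hflatA : Module.Flat R A := Module.Flat.trans R P.R0 A
  have hlocA : IsLocalHom (algebraMap R A) := by
    refine ((local_hom_TFAE _).out 2 0).mp ?_
    rw [IsScalarTower.algebraMap_eq R P.R0 A, ← Ideal.map_map, ← hA]
    refine Ideal.map_mono ?_
    rw [h𝔪, P.comap_eq hloc hss]
    exact le_sup_left
  obtain ⟨hfib, hdim⟩ := isRegularLocal_fiber hA (P.comap_eq hloc hss) P.reg
  refine ⟨by omega, ⟨⟨A, inferInstance, algebraMap R A, h, ⟨inferInstance, inferInstance, ?_, ?_,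
    hlocA, ?_, hfib, hsurj⟩, rs, hrs, hker.symm⟩, ?_⟩, hrefl⟩
  · rwa [IsLocalRing.jacobson_eq_maximalIdeal _ bot_ne_top]
  · ext1 r
    change h (algebraMap P.R0 A (algebraMap R P.R0 r)) = completionHom S (f r)
    rw [hcomm, ← RingHom.comp_apply (algebraMap P.R0 S), P.comp]
  · rw [RingHom.flat_algebraMap_iff]
    exact hflatA
  · have h1 := ringKrullDim_add_length_eq_ringKrullDim_of_isRegular rs hrs
    have e : (A ⧸ Ideal.ofList rs) ≃+* C :=
      (Ideal.quotEquivOfEq hker).trans (RingHom.quotientKerEquivOfSurjective hsurj)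
    rw [ringKrullDim_eq_of_ringEquiv e, ringKrullDim_adicCompletion,
      ringKrullDim_eq_add_fiber (R := R) (A := A), hdim, hzlen, hrslen] at h1
    have h2 : g + s.toList.length = embDim R := by omega
    rw [h2] at h1
    rw [add_comm, h1, add_comm]
end Cohen

end GFD

namespace GFD

open TensorProduct IsLocalRing

section

open CategoryTheory

theorem subsingleton_extModule {S X Y : Type u} [CommRing S] [AddCommGroup X] [Module S X]
    [AddCommGroup Y] [Module S Y] {n : ℕ} (h : EV S (n + 1) X Y) :
    Subsingleton (extModule S (n + 1) X Y) := by
  let P := ProjectiveResolution.of (ModuleCat.of S X)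
  refine ModuleCat.subsingleton_of_isZero (Limits.IsZero.of_iso ?_ (P.isoExt (n + 1) (ModuleCat.of S Y)))
  rw [← HomologicalComplex.exactAt_iff_isZero_homology,
    HomologicalComplex.exactAt_iff' _ n (n + 1) (n + 2) (by simp) (by simp),
    ShortComplex.moduleCat_exact_iff]
  intro (x : P.complex.X (n + 1) ⟶ ModuleCat.of S Y) hx
  have hx' : P.complex.d (n + 2) (n + 1) ≫ x = 0 := hx
  have h0 : P.extMk x (n + 2) rfl hx' = 0 := h.elim _ _
  obtain ⟨y, hy⟩ := (P.extMk_eq_zero_iff x (n + 2) rfl hx' n rfl).mp h0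
  exact ⟨y, hy⟩

end

theorem exists_of_sInf_coe_lt_top {s : Set ℕ} (h : sInf ((fun n : ℕ => (n : ℕ∞)) '' s) < ⊤) :
    ∃ n ∈ s, sInf ((fun n : ℕ => (n : ℕ∞)) '' s) = n := by
  have hne : ((fun n : ℕ => (n : ℕ∞)) '' s).Nonempty := by
    rw [Set.nonempty_iff_ne_empty]
    intro h0
    rw [h0, sInf_empty] at h
    exact lt_irrefl _ h
  obtain ⟨n, hn, hn'⟩ := csInf_mem hne
  exact ⟨n, hn, hn'.symm⟩

end GFD

/-- **Theorem A.** If `f : R → S` is a local homomorphism of noetherian local rings with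
`fd_R S < ∞` and `M` is a non-zero finitely generated `S`-module with
`Gfd_R M ≤ edim R - edim S`, then `M` is totally reflexive over `S`, `f` is an exceptional
complete intersection map, and `Gfd_R M = edim R - edim S`; in particular, if `M` is
Gorenstein flat over `R`, then `edim R = edim S`. -/
theorem gfd_bound_implies_eci {R S : Type u} [CommRing R] [CommRing S]
    [IsLocalRing R] [IsLocalRing S] [IsNoetherianRing R] [IsNoetherianRing S]
    (f : R →+* S) (hloc : IsLocalHom f) (hfd : flatDimAlong f < ⊤)
    (M : Type u) [AddCommGroup M] [Module S M] [Nontrivial M] [Module.Finite S M]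
    (hgfd : gfdAlong f M + embDim S ≤ (embDim R : ℕ∞)) :
    IsTotallyReflexive S M ∧ IsExceptionalCIMap f ∧
      gfdAlong f M + embDim S = (embDim R : ℕ∞) ∧
      (IsGorensteinFlatAlong f M → embDim R = embDim S) := by
  obtain ⟨p, hp, -⟩ := GFD.exists_of_sInf_coe_lt_top hfd
  obtain ⟨g, hg, hgeq⟩ := GFD.exists_of_sInf_coe_lt_top
    (lt_of_le_of_lt (le_self_add.trans hgfd) (ENat.natCast_lt_top _) : gfdAlong f M < ⊤)
  replace hgeq : gfdAlong f M = g := hgeq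
  rw [hgeq] at hgfd
  have hG : letI := Module.compHom M f; GFD.HG R M g :=
    let _ := Module.compHom M f
    GFD.HG.of_gfdLE hg
  have hF : letI := f.toModule; GFD.HF R S p :=
    let _ := f.toModule
    GFD.HF.of_fdLE hp
  obtain ⟨heq, heci, hM, hMd, hbij⟩ := GFD.isExceptionalCIMap_and_reflexive hloc hG hF
    (by exact_mod_cast hgfd)
  refine ⟨⟨inferInstance, hbij, fun i hi => ?_⟩, heci, ?_, fun hflat => ?_⟩
  · obtain ⟨j, rfl⟩ : ∃ j, i = j + 1 := ⟨i - 1, by omega⟩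
    exact ⟨GFD.subsingleton_extModule (hM j), GFD.subsingleton_extModule (hMd j)⟩
  · rw [hgeq]
    exact_mod_cast heq
  · have h0 : gfdAlong f M ≤ ((0 : ℕ) : ℕ∞) := sInf_le ⟨0, hflat, rfl⟩
    rw [hgeq] at h0
    have : g ≤ 0 := by exact_mod_cast h0
    omega
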